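/- Let w ≥ 6 be an even integer and d_w = ⌊(w−2)/4⌋ ≥ 1. Then each of the families of functions (R_{2,w,2i−1})_{i=1,…,d_w} and (R_{2,w,w−2i+1})_{i=1,…,d_w} is a basis of S_{w+2}(Γ₀(2)): in each family the functions are linearly independent over ℂ, and for every cusp form f ∈ S_{w+2}(Γ₀(2)) there exist complex numbers c₁,…,c_{d_w} such that f(z) = Σ_{i=1}^{d_w} c_i · (the i-th member of the family)(z) for all z ∈ ℍ. -/

import Mathlib

open MeasureTheory

noncomputable section

/-- The constant `c_{w,n} = (-1)^n · 2πi · C(w,n)`. -/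
def cwn (w n : ℕ) : ℂ := (-1) ^ n * (2 * (Real.pi : ℂ) * Complex.I) * (w.choose n : ℂ)

/-- The Poincaré-type series `R_{N,w,n}`, viewed as a function on `ℂ`. -/
def RG (N w n : ℕ) (z : ℂ) : ℂ :=
  (cwn w n)⁻¹ * ∑' γ : CongruenceSubgroup.Gamma0 N,
    ((γ.1.1 0 0 : ℂ) * z + (γ.1.1 0 1 : ℂ)) ^ (-((w : ℤ) - n + 1)) *
      ((γ.1.1 1 0 : ℂ) * z + (γ.1.1 1 1 : ℂ)) ^ (-((n : ℤ) + 1))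


/-- Vertical exponential decay, uniform on vertical strips. -/
def VDec (G : ℂ → ℂ) : Prop :=
  ∃ c : ℝ, 0 < c ∧ ∀ y0 : ℝ, 0 < y0 → ∀ x0 : ℝ, ∃ C : ℝ, 0 ≤ C ∧ ∀ z : ℂ, y0 ≤ z.im → |z.re| ≤ x0 →
    ‖G z‖ ≤ C * Real.exp (-c * z.im)

/-- One-periodic holomorphic functions on the upper half plane with exponential decay. -/
structure CF (f : ℂ → ℂ) : Prop where
  d : DifferentiableOn ℂ f {z | 0 < z.im}
  p : ∀ z : ℂ, 0 < z.im → f (z + 1) = f z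
  e : ∃ c : ℝ, 0 < c ∧ ∀ y0 : ℝ, 0 < y0 → ∃ C : ℝ, 0 ≤ C ∧ ∀ z : ℂ, y0 ≤ z.im →
    ‖f z‖ ≤ C * Real.exp (-c * z.im)

lemma isOpen_H : IsOpen {z : ℂ | 0 < z.im} := isOpen_lt continuous_const Complex.continuous_im

lemma pow_mul_exp_bdd (n : ℕ) (c : ℝ) (hc : 0 < c) :
    ∃ C : ℝ, 0 ≤ C ∧ ∀ y : ℝ, 0 ≤ y → y ^ n * Real.exp (-c * y) ≤ C := by
  refine ⟨n.factorial / c ^ n, by positivity, fun y hy => ?_⟩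
  have h1 := Real.pow_div_factorial_le_exp (c * y) (by positivity) n
  rw [neg_mul, Real.exp_neg, ← div_eq_mul_inv, div_le_div_iff₀ (Real.exp_pos _) (by positivity)]
  rw [div_le_iff₀ (by positivity), mul_pow] at h1
  nlinarith

lemma CF.vdec {f : ℂ → ℂ} (hf : CF f) (n : ℕ) : VDec (fun z => f z * z ^ n) := by
  obtain ⟨c, hc, h⟩ := hf.e
  refine ⟨c / 2, by positivity, fun y0 hy0 x0 => ?_⟩
  obtain ⟨C, hC, hCb⟩ := h y0 hy0
  obtain ⟨D, hD, hDb⟩ := pow_mul_exp_bdd n (c / 2) (by positivity)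
  refine ⟨C * ((|x0| / y0 + 1) ^ n * D), by positivity, fun z hz hx => ?_⟩
  have hz0 : 0 < z.im := lt_of_lt_of_le hy0 hz
  have h1 : ‖z‖ ≤ (|x0| / y0 + 1) * z.im := by
    have := Complex.norm_le_abs_re_add_abs_im z
    rw [abs_of_pos hz0] at this
    have h2 : |z.re| ≤ |x0| / y0 * z.im := by
      rw [div_mul_eq_mul_div, le_div_iff₀ hy0]
      have := hx.trans (le_abs_self x0)
      have h3 := abs_nonneg z.re
      nlinarith [abs_nonneg x0]
    nlinarith
  have h2 := hDb z.im hz0.le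
  rw [norm_mul, norm_pow]
  calc ‖f z‖ * ‖z‖ ^ n ≤ (C * Real.exp (-c * z.im)) * ((|x0| / y0 + 1) * z.im) ^ n := by
        gcongr
        exact hCb z hz
    _ = C * ((|x0| / y0 + 1) ^ n * (z.im ^ n * Real.exp (-(c/2) * z.im))) * Real.exp (-(c/2) * z.im) := by
        rw [mul_pow, show -c * z.im = -(c/2) * z.im + -(c/2) * z.im by ring, Real.exp_add]; ring
    _ ≤ _ := by gcongr

lemma vline_im (z : ℂ) (t : ℝ) : (z + t * Complex.I).im = z.im + t := by simp
lemma vline_re (z : ℂ) (t : ℝ) : (z + t * Complex.I).re = z.re := by simp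

lemma vline_cont {G : ℂ → ℂ} (hd : DifferentiableOn ℂ G {z | 0 < z.im}) {z : ℂ} (hz : 0 < z.im) :
    ContinuousOn (fun t : ℝ => G (z + t * Complex.I)) (Set.Ici 0) := by
  refine hd.continuousOn.comp (by fun_prop) fun t ht => ?_
  simp only [Set.mem_ofPred_eq, vline_im]
  have : (0:ℝ) ≤ t := ht
  linarith

lemma vint {G : ℂ → ℂ} (hd : DifferentiableOn ℂ G {z | 0 < z.im}) (hG : VDec G) {z : ℂ}
    (hz : 0 < z.im) : IntegrableOn (fun t : ℝ => G (z + t * Complex.I)) (Set.Ioi 0) := by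
  obtain ⟨c, hc, h⟩ := hG
  obtain ⟨C, hC, hCb⟩ := h z.im hz |z.re|
  have hI : IntegrableOn (fun t : ℝ => C * Real.exp (-c * z.im) * Real.exp (-c * t)) (Set.Ioi 0) :=
    (integrableOn_exp_mul_Ioi (by linarith) 0).const_mul _
  refine Integrable.mono' hI (((vline_cont hd hz).mono Set.Ioi_subset_Ici_self).aestronglyMeasurable
    measurableSet_Ioi) ?_
  filter_upwards [ae_restrict_mem measurableSet_Ioi] with t ht
  have ht : (0:ℝ) < t := ht
  refine (hCb _ (by rw [vline_im]; linarith) (by rw [vline_re])).trans (le_of_eq ?_)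
  rw [vline_im, mul_add, Real.exp_add]; ring

lemma vderiv {G : ℂ → ℂ} (hd : DifferentiableOn ℂ G {z | 0 < z.im}) (hG : VDec G) {z : ℂ}
    (hz : 0 < z.im) :
    HasDerivAt (fun z => Complex.I * ∫ t in Set.Ioi (0:ℝ), G (z + t * Complex.I)) (- G z) z := by
  have hG' := hG
  obtain ⟨c, hc, h⟩ := hG
  set r := z.im / 3 with hr
  have hr0 : 0 < r := by positivity
  obtain ⟨C, hC, hCb⟩ := h r hr0 (|z.re| + 2 * r)
  have hdG : ∀ x : ℂ, 0 < x.im → HasDerivAt G (deriv G x) x := fun x hx =>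
    ((hd x hx).differentiableAt (isOpen_H.mem_nhds hx)).hasDerivAt
  -- derivative bound
  have hder : ∀ x ∈ Metric.ball z r, ∀ t : ℝ, 0 ≤ t →
      ‖deriv G (x + t * Complex.I)‖ ≤ C / r * Real.exp (-c * t) := by
    intro x hx t ht
    have hx' : ‖x - z‖ < r := by simpa [dist_eq_norm] using hx
    have := Complex.norm_deriv_le_of_forall_mem_sphere_norm_le (f := G)
      (c := x + t * Complex.I) (R := r) (C := C * Real.exp (-c * t)) hr0 ?_ ?_
    · rw [div_mul_eq_mul_div]; exact this
    · apply DifferentiableOn.diffContOnCl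
      refine hd.mono fun y hy => ?_
      have hy := Metric.closure_ball_subset_closedBall hy
      have hy' : ‖y - (x + t * Complex.I)‖ ≤ r := by simpa [dist_eq_norm] using hy
      have h1 := (Complex.abs_im_le_norm (y - (x + t * Complex.I))).trans hy'
      have h2 := (Complex.abs_im_le_norm (x - z)).trans hx'.le
      simp only [Complex.sub_im, vline_im] at h1 h2
      rw [abs_le] at h1 h2
      show 0 < y.im
      linarith
    · intro y hy
      have hy' : ‖y - (x + t * Complex.I)‖ ≤ r := by
        rw [← dist_eq_norm]; exact (Metric.mem_sphere.mp hy).le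
      have h1 := (Complex.abs_im_le_norm (y - (x + t * Complex.I))).trans hy'
      have h2 := (Complex.abs_im_le_norm (x - z)).trans hx'.le
      have h3 := (Complex.abs_re_le_norm (y - (x + t * Complex.I))).trans hy'
      have h4 := (Complex.abs_re_le_norm (x - z)).trans hx'.le
      simp only [Complex.sub_im, vline_im, Complex.sub_re, vline_re] at h1 h2 h3 h4
      have h5 : |y.re| ≤ |z.re| + 2 * r := by
        have e : y.re = z.re + (y.re - x.re) + (x.re - z.re) := by ring
        rw [e]
        refine (abs_add_le _ _).trans ?_
        have := abs_add_le z.re (y.re - x.re)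
        linarith
      rw [abs_le] at h1 h2
      refine (hCb y (by linarith) h5).trans ?_
      have h6 : t ≤ y.im := by linarith
      exact mul_le_mul_of_nonneg_left (Real.exp_le_exp.mpr (by nlinarith)) hC
  have key := hasDerivAt_integral_of_dominated_loc_of_deriv_le (μ := volume.restrict (Set.Ioi (0:ℝ)))
    (F := fun (x : ℂ) (t : ℝ) => G (x + t * Complex.I))
    (F' := fun (x : ℂ) (t : ℝ) => deriv G (x + t * Complex.I)) (x₀ := z)
    (s := Metric.ball z r) (bound := fun t => C / r * Real.exp (-c * t))
    (Metric.ball_mem_nhds z hr0) ?_ (vint hd hG' hz) ?_ ?_ ?_ ?_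
  · have h2 := key.2.const_mul Complex.I
    refine h2.congr_deriv ?_
    have h3 := integral_Ioi_of_hasDerivAt_of_tendsto (a := (0:ℝ)) (m := 0)
      (f := fun t : ℝ => G (z + t * Complex.I))
      (f' := fun t : ℝ => Complex.I * deriv G (z + t * Complex.I)) ?_ ?_ ?_ ?_
    · rw [integral_const_mul] at h3
      rw [h3]; simp
    · exact (vline_cont hd hz).continuousWithinAt (Set.self_mem_Ici)
    · intro t ht
      have ht : (0:ℝ) < t := ht
      have h5 : HasDerivAt (fun t : ℝ => z + t * Complex.I) (Complex.I) t := by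
        simpa using (Complex.ofRealCLM.hasDerivAt (x := t)).mul_const Complex.I |>.const_add z
      have h4 := (hdG (z + t * Complex.I) (by rw [vline_im]; linarith)).scomp t h5
      simpa [Function.comp_def] using h4
    · exact key.1.const_mul _
    · rw [tendsto_zero_iff_norm_tendsto_zero]
      have : Filter.Tendsto (fun t : ℝ => C * Real.exp (-c * (z.im + t))) Filter.atTop (nhds 0) := by
        rw [← mul_zero C]
        refine Filter.Tendsto.const_mul _ (Real.tendsto_exp_atBot.comp ?_)
        refine Filter.Tendsto.const_mul_atTop_of_neg (by linarith) ?_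
        exact Filter.tendsto_atTop_add_const_left _ _ Filter.tendsto_id
      refine tendsto_of_tendsto_of_tendsto_of_le_of_le' tendsto_const_nhds this
        (Filter.Eventually.of_forall fun t => norm_nonneg _) ?_
      filter_upwards [Filter.eventually_ge_atTop 0] with t ht
      have := hCb (z + t * Complex.I) (by rw [vline_im]; linarith) (by rw [vline_re]; linarith)
      rwa [vline_im] at this
  · filter_upwards [Metric.ball_mem_nhds z hr0] with x hx
    have hx' : ‖x - z‖ < r := by simpa [dist_eq_norm] using hx
    have h2 := (Complex.abs_im_le_norm (x - z)).trans hx'.le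
    simp only [Complex.sub_im] at h2
    rw [abs_le] at h2
    exact ((vline_cont hd (by linarith)).mono Set.Ioi_subset_Ici_self).aestronglyMeasurable
      measurableSet_Ioi
  · refine ((vline_cont (hd.deriv isOpen_H) hz).mono
      Set.Ioi_subset_Ici_self).aestronglyMeasurable measurableSet_Ioi
  · filter_upwards [ae_restrict_mem measurableSet_Ioi] with t ht x hx
    exact hder x hx t (le_of_lt ht)
  · exact (integrableOn_exp_mul_Ioi (by linarith) 0).const_mul _
  · filter_upwards [ae_restrict_mem measurableSet_Ioi] with t ht x hx
    have ht : (0:ℝ) < t := ht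
    have hx' : ‖x - z‖ < r := by simpa [dist_eq_norm] using hx
    have h2 := (Complex.abs_im_le_norm (x - z)).trans hx'.le
    simp only [Complex.sub_im] at h2
    rw [abs_le] at h2
    have := (hdG (x + t * Complex.I) (by rw [vline_im]; linarith)).comp_add_const x (t * Complex.I)
    exact this

/-- Moments of the Eichler integral. -/
def Mo (f : ℂ → ℂ) (n : ℕ) (z : ℂ) : ℂ :=
  Complex.I * ∫ t in Set.Ioi (0:ℝ), f (z + t * Complex.I) * (z + t * Complex.I) ^ n

/-- The polynomial valued Eichler integral. -/
def Ei (f : ℂ → ℂ) (w : ℕ) (z X : ℂ) : ℂ :=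
  ∑ j ∈ Finset.range (w + 1), (w.choose j : ℂ) * (-X) ^ (w - j) * Mo f j z

lemma CF.d' {f : ℂ → ℂ} (hf : CF f) (n : ℕ) :
    DifferentiableOn ℂ (fun z => f z * z ^ n) {z | 0 < z.im} :=
  hf.d.mul (by fun_prop)

lemma CF.mo_deriv {f : ℂ → ℂ} (hf : CF f) (n : ℕ) {z : ℂ} (hz : 0 < z.im) :
    HasDerivAt (Mo f n) (-(f z * z ^ n)) z :=
  vderiv (hf.d' n) (hf.vdec n) hz

lemma CF.mo_int {f : ℂ → ℂ} (hf : CF f) (n : ℕ) {z : ℂ} (hz : 0 < z.im) :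
    IntegrableOn (fun t : ℝ => f (z + t * Complex.I) * (z + t * Complex.I) ^ n) (Set.Ioi 0) :=
  vint (hf.d' n) (hf.vdec n) hz

lemma sub_pow_expand (a X : ℂ) (w : ℕ) :
    (a - X) ^ w = ∑ j ∈ Finset.range (w + 1), (w.choose j : ℂ) * (-X) ^ (w - j) * a ^ j := by
  rw [sub_eq_add_neg, add_pow]
  exact Finset.sum_congr rfl fun j _ => by ring

lemma CF.ei_eq {f : ℂ → ℂ} (hf : CF f) (w : ℕ) {z : ℂ} (hz : 0 < z.im) (X : ℂ) :
    Ei f w z X = Complex.I * ∫ t in Set.Ioi (0:ℝ), f (z + t * Complex.I) * (z + t * Complex.I - X) ^ w := by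
  have : ∀ t : ℝ, f (z + t * Complex.I) * (z + t * Complex.I - X) ^ w =
      ∑ j ∈ Finset.range (w + 1), (w.choose j : ℂ) * (-X) ^ (w - j) *
        (f (z + t * Complex.I) * (z + t * Complex.I) ^ j) := by
    intro t
    rw [sub_pow_expand, Finset.mul_sum]
    exact Finset.sum_congr rfl fun j _ => by ring
  simp_rw [this]
  rw [integral_finsetSum _ fun j _ => (hf.mo_int j hz).const_mul _, Finset.mul_sum]
  refine Finset.sum_congr rfl fun j _ => ?_
  rw [integral_const_mul, Mo]; ring

lemma CF.ei_T {f : ℂ → ℂ} (hf : CF f) (w : ℕ) {z : ℂ} (hz : 0 < z.im) (X : ℂ) :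
    Ei f w (z + 1) (X + 1) = Ei f w z X := by
  rw [hf.ei_eq w hz, hf.ei_eq w (by simpa using hz)]
  congr 1
  refine setIntegral_congr_fun measurableSet_Ioi fun t ht => ?_
  have ht : (0:ℝ) < t := ht
  have e : z + 1 + t * Complex.I = z + t * Complex.I + 1 := by ring
  simp only [e]
  rw [hf.p _ (by rw [vline_im]; linarith)]
  congr 2; ring

lemma CF.ei_deriv {f : ℂ → ℂ} (hf : CF f) (w : ℕ) {z : ℂ} (hz : 0 < z.im) (X : ℂ) :
    HasDerivAt (fun z => Ei f w z X) (-(f z * (z - X) ^ w)) z := by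
  have : HasDerivAt (fun z => Ei f w z X) (∑ j ∈ Finset.range (w + 1),
      (w.choose j : ℂ) * (-X) ^ (w - j) * (-(f z * z ^ j))) z :=
    HasDerivAt.fun_sum fun j _ => (hf.mo_deriv j hz).const_mul _
  refine this.congr_deriv ?_
  rw [sub_pow_expand, Finset.mul_sum, ← Finset.sum_neg_distrib]
  exact Finset.sum_congr rfl fun j _ => by ring

/-- decay of the Eichler integral -/
lemma CF.ei_decay {f : ℂ → ℂ} (hf : CF f) (w : ℕ) :
    ∃ c : ℝ, 0 < c ∧ ∃ C : ℝ, 0 ≤ C ∧ ∀ z X : ℂ, 1 ≤ z.im → ‖z - X‖ ≤ 2 * z.im →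
      ‖Ei f w z X‖ ≤ C * Real.exp (-c * z.im) := by
  obtain ⟨c, hc, h⟩ := hf.e
  obtain ⟨C, hC, hCb⟩ := h 1 one_pos
  obtain ⟨D, hD, hDb⟩ := pow_mul_exp_bdd w (c / 2) (by positivity)
  refine ⟨c / 2, by positivity, C * (2 ^ w * D) * ∫ t in Set.Ioi (0:ℝ), Real.exp (-(c / 2) * t),
    ?_, fun z X hz hX => ?_⟩
  · have : 0 ≤ ∫ t in Set.Ioi (0:ℝ), Real.exp (-(c / 2) * t) := 
      integral_nonneg fun t => (Real.exp_pos _).le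
    positivity
  rw [hf.ei_eq w (by linarith), norm_mul, Complex.norm_I, one_mul, mul_assoc, mul_comm (∫ t in _, _),
    ← mul_assoc, ← integral_const_mul]
  refine norm_integral_le_of_norm_le ((integrableOn_exp_mul_Ioi (by linarith) 0).const_mul _) ?_
  filter_upwards [ae_restrict_mem measurableSet_Ioi] with t ht
  have ht : (0:ℝ) < t := ht
  have h1 := hCb (z + t * Complex.I) (by rw [vline_im]; linarith)
  rw [vline_im] at h1
  have h2 : ‖z + t * Complex.I - X‖ ≤ 2 * (z.im + t) := by
    rw [show z + t * Complex.I - X = (z - X) + t * Complex.I by ring]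
    refine (norm_add_le _ _).trans ?_
    simp [abs_of_pos ht]; linarith
  have h3 := hDb (z.im + t) (by linarith)
  rw [norm_mul, norm_pow]
  calc _ ≤ (C * Real.exp (-c * (z.im + t))) * (2 * (z.im + t)) ^ w := by gcongr
    _ = C * (2 ^ w * ((z.im + t) ^ w * Real.exp (-(c / 2) * (z.im + t)))) *
      Real.exp (-(c/2) * z.im) * Real.exp (-(c/2) * t) := by
        rw [mul_pow, show -c * (z.im + t) = -(c/2) * (z.im + t) + (-(c/2) * z.im + -(c/2) * t) by ring,
          Real.exp_add, Real.exp_add (-(c/2) * z.im)]; ring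
    _ ≤ _ := by gcongr

/-- The Fricke involution. -/
def Wz (z : ℂ) : ℂ := -1 / (2 * z)

lemma Wz_im (z : ℂ) : (Wz z).im = z.im / (2 * Complex.normSq z) := by
  simp [Wz, Complex.div_im, Complex.normSq_mul]
  by_cases h : Complex.normSq z = 0
  · simp [h]
  · field_simp

lemma H_ne {z : ℂ} (hz : 0 < z.im) : z ≠ 0 := by rintro rfl; simp at hz

lemma Wz_pos {z : ℂ} (hz : 0 < z.im) : 0 < (Wz z).im := by
  rw [Wz_im]; exact div_pos hz (mul_pos two_pos (Complex.normSq_pos.mpr (H_ne hz)))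

lemma Wz_Wz (z : ℂ) : Wz (Wz z) = z := by
  unfold Wz
  by_cases h : z = 0
  · simp [h]
  · field_simp

/-- A Fricke pair of cusp forms of weight `2 m + 2`. -/
structure FP (m : ℕ) (f h : ℂ → ℂ) : Prop where
  cf : CF f
  ch : CF h
  fh : ∀ z : ℂ, 0 < z.im → h z = f (Wz z) / (2 * z ^ 2) ^ (m + 1)
  b : ∃ C : ℝ, ∀ z : ℂ, 0 < z.im → ‖f z‖ * z.im ^ (m + 1) ≤ C

lemma FP.hf {m : ℕ} {f h : ℂ → ℂ} (F : FP m f h) (z : ℂ) (hz : 0 < z.im) :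
    f z = h (Wz z) / (2 * z ^ 2) ^ (m + 1) := by
  have hz0 := H_ne hz
  rw [F.fh _ (Wz_pos hz), Wz_Wz, div_div, ← mul_pow]
  have : 2 * Wz z ^ 2 * (2 * z ^ 2) = 1 := by unfold Wz; field_simp
  rw [this]; simp

lemma FP.symm {m : ℕ} {f h : ℂ → ℂ} (F : FP m f h) : FP m h f where
  cf := F.ch
  ch := F.cf
  fh := F.hf
  b := by
    obtain ⟨C, hC⟩ := F.b
    refine ⟨C, fun z hz => ?_⟩
    refine le_trans (le_of_eq ?_) (hC (Wz z) (Wz_pos hz))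
    have h0 : ‖z‖ ≠ 0 := norm_ne_zero_iff.mpr (H_ne hz)
    rw [F.fh z hz, Wz_im, Complex.normSq_eq_norm_sq]
    simp only [norm_div, norm_pow, norm_mul, Complex.norm_ofNat, div_pow]
    ring

lemma FP.bound {m : ℕ} {f h : ℂ → ℂ} (F : FP m f h) (N : ℝ) (hN : 0 ≤ N) :
    ∃ C : ℝ, 0 ≤ C ∧ ∀ z : ℂ, 0 < z.im → ‖f z‖ ≤ C * z.im ^ (-(m + 1 : ℝ) - N) := by
  obtain ⟨C, hC⟩ := F.b
  obtain ⟨c, hc, h1⟩ := F.cf.e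
  obtain ⟨D, hD, hDb⟩ := h1 1 one_pos
  obtain ⟨B, hB, hBb⟩ := pow_mul_exp_bdd (m + 1 + ⌈N⌉₊) c hc
  have hC0 : 0 ≤ C := le_trans (by simp) (hC Complex.I (by simp))
  refine ⟨C + D * B, by positivity, fun z hz => ?_⟩
  rcases le_total z.im 1 with hy | hy
  · have h2 : ‖f z‖ ≤ C * z.im ^ (-(m + 1 : ℝ)) := by
      rw [Real.rpow_neg hz.le, ← div_eq_mul_inv, le_div_iff₀ (by positivity)]
      have := hC z hz
      rwa [← Real.rpow_natCast, Nat.cast_add, Nat.cast_one] at this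
    refine h2.trans ?_
    have : z.im ^ (-(m + 1 : ℝ)) ≤ z.im ^ (-(m + 1 : ℝ) - N) :=
      Real.rpow_le_rpow_of_exponent_ge hz hy (by linarith)
    have h3 : 0 ≤ z.im ^ (-(m + 1 : ℝ) - N) := by positivity
    nlinarith [mul_nonneg hD hB, mul_nonneg (mul_nonneg hD hB) h3]
  · have h2 := hDb z hy
    have h3 := hBb z.im hz.le
    have h4 : Real.exp (-c * z.im) ≤ B * z.im ^ (-(m + 1 : ℝ) - N) := by
      have : z.im ^ ((m + 1 : ℝ) + N) ≤ z.im ^ (m + 1 + ⌈N⌉₊) := by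
        rw [← Real.rpow_natCast]
        refine Real.rpow_le_rpow_of_exponent_le hy ?_
        push_cast
        linarith [Nat.le_ceil N]
      rw [show (-(m + 1 : ℝ) - N) = -((m + 1 : ℝ) + N) by ring, Real.rpow_neg hz.le,
        ← div_eq_mul_inv, le_div_iff₀ (by positivity)]
      refine le_trans ?_ h3
      rw [mul_comm]
      gcongr
    refine h2.trans ?_
    have h5 : 0 ≤ z.im ^ (-(m + 1 : ℝ) - N) := by positivity
    have := mul_le_mul_of_nonneg_left h4 hD
    nlinarith [mul_nonneg hC0 h5]

lemma FP.bound2 {m : ℕ} {f h : ℂ → ℂ} (F : FP m f h) (N : ℝ) (hN : 0 ≤ N) :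
    ∃ C : ℝ, 0 ≤ C ∧ ∀ z : ℂ, 0 < z.im →
      ‖f z‖ ≤ C * (z.im / ‖z‖) ^ (-(m + 1 : ℝ) - N) * ‖z‖ ^ (-(m + 1 : ℝ) + N) := by
  obtain ⟨C, hC, h1⟩ := F.symm.bound N hN
  refine ⟨C * (2 ^ (-(m + 1 : ℝ)) * 2 ^ (-(-(m + 1 : ℝ) - N))), by positivity, fun z hz => ?_⟩
  have h0 : 0 < ‖z‖ := norm_pos_iff.mpr (H_ne hz)
  have h2 := h1 _ (Wz_pos hz)
  have e1 : (Wz z).im = (z.im / ‖z‖) * 2⁻¹ * ‖z‖⁻¹ := by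
    rw [Wz_im, Complex.normSq_eq_norm_sq]; field_simp
  have e2 : ‖(2 * z ^ 2) ^ (m + 1)‖ = 2 ^ (m + 1 : ℝ) * ‖z‖ ^ (2 * (m + 1 : ℝ)) := by
    rw [Real.rpow_mul h0.le, ← Real.mul_rpow (by positivity) (by positivity)]
    norm_cast
    simp
  rw [F.hf z hz, norm_div, e2]
  rw [div_le_iff₀ (by positivity)]
  refine h2.trans (le_of_eq ?_)
  have hs : 0 < z.im / ‖z‖ := by positivity
  rw [e1, Real.mul_rpow (by positivity) (by positivity), Real.mul_rpow (by positivity) (by positivity),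
    Real.inv_rpow h0.le, Real.inv_rpow (by norm_num), ← Real.rpow_neg h0.le,
    ← Real.rpow_neg (by norm_num)]
  have e3 : ‖z‖ ^ (-(-(m + 1 : ℝ) - N)) = ‖z‖ ^ (-(m + 1 : ℝ) + N) * ‖z‖ ^ (2 * (m + 1 : ℝ)) := by
    rw [← Real.rpow_add h0]; congr 1; ring
  have e4 : (2:ℝ) ^ (-(m + 1 : ℝ)) * 2 ^ (m + 1 : ℝ) = 1 := by
    rw [← Real.rpow_add two_pos]; simp
  rw [e3]
  generalize (z.im / ‖z‖) ^ (-(m + 1 : ℝ) - N) = A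
  generalize (2:ℝ) ^ (-(-(m + 1 : ℝ) - N)) = B
  linear_combination (-(C * A * B * ‖z‖ ^ (-(m + 1 : ℝ) + N) * ‖z‖ ^ (2 * (m + 1 : ℝ)))) * e4

lemma FP.period_int {m : ℕ} {f h : ℂ → ℂ} (F : FP m f h) (n : ℕ) :
    IntegrableOn (fun t : ℝ => f (t * Complex.I) * (t * Complex.I) ^ n) (Set.Ioi 0) := by
  have hmeas : ContinuousOn (fun t : ℝ => f (t * Complex.I) * (t * Complex.I) ^ n) (Set.Ioi 0) := by
    refine (F.cf.d' n).continuousOn.comp (f := fun t : ℝ => (t * Complex.I)) (by fun_prop) fun t ht => ?_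
    simpa using ht
  obtain ⟨C, hC, h1⟩ := F.bound2 (m + 1) (by positivity)
  have hI1 : IntegrableOn (fun t : ℝ => f (t * Complex.I) * (t * Complex.I) ^ n) (Set.Ioc 0 1) := by
    refine Integrable.mono' (g := fun _ => C) (integrableOn_const (by simp))
      ((hmeas.mono Set.Ioc_subset_Ioi_self).aestronglyMeasurable measurableSet_Ioc) ?_
    filter_upwards [ae_restrict_mem measurableSet_Ioc] with t ht
    have h2 := h1 (t * Complex.I) (by simpa using ht.1)
    have h3 : 0 < t := ht.1
    simp [abs_of_pos h3, div_self h3.ne'] at h2 ⊢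
    have : t ^ n ≤ 1 := pow_le_one₀ h3.le ht.2
    have := norm_nonneg (f (t * Complex.I))
    nlinarith [pow_pos h3 n]
  have hI2 : IntegrableOn (fun t : ℝ => f (t * Complex.I) * (t * Complex.I) ^ n) (Set.Ioi 1) := by
    have := F.cf.mo_int n (z := Complex.I) (by simp)
    rw [← integrableOn_Ici_iff_integrableOn_Ioi] at this ⊢
    have := (measurePreserving_sub_right volume (1:ℝ)).integrableOn_comp_preimage
      (MeasurableEquiv.subRight (1:ℝ)).measurableEmbedding |>.mpr this
    refine IntegrableOn.congr_set_ae (this.congr_fun (fun t _ => ?_) ?_) ?_ 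
    · simp only [Function.comp]
      push_cast
      ring_nf
    · exact (measurableSet_Ici.preimage (measurable_id.sub_const 1))
    · have : (fun x : ℝ => x - 1) ⁻¹' Set.Ici 0 = Set.Ici 1 := by ext; simp
      rw [this]
      rfl
  rw [← Set.Ioc_union_Ioi_eq_Ioi (zero_le_one (α := ℝ))]
  exact hI1.union hI2

lemma integral_shift_Ioi (g : ℝ → ℂ) (a : ℝ) :
    ∫ t in Set.Ioi (0:ℝ), g (t + a) = ∫ t in Set.Ioi a, g t := by
  have := (measurePreserving_add_right volume a).setIntegral_preimage_emb
    (MeasurableEquiv.addRight a).measurableEmbedding g (Set.Ioi a)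
  have e : (fun x : ℝ => x + a) ⁻¹' Set.Ioi a = Set.Ioi 0 := by ext; simp
  rw [e] at this
  exact this

lemma FP.mo_tendsto {m : ℕ} {f h : ℂ → ℂ} (F : FP m f h) (n : ℕ) :
    Filter.Tendsto (fun k : ℕ => Mo f n ((1 / ((k:ℝ) + 1) : ℝ) * Complex.I)) Filter.atTop
      (nhds (Mo f n 0)) := by
  unfold Mo
  refine Filter.Tendsto.const_mul _ ?_
  have h1 := tendsto_setIntegral_of_monotone (μ := volume)
    (f := fun t : ℝ => f (t * Complex.I) * (t * Complex.I) ^ n)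
    (s := fun k : ℕ => Set.Ioi (1 / ((k:ℝ) + 1))) (fun _ => measurableSet_Ioi) ?_ ?_
  · have e : (⋃ k : ℕ, Set.Ioi (1 / ((k:ℝ) + 1))) = Set.Ioi 0 := by
      ext x
      simp only [Set.mem_iUnion, Set.mem_Ioi]
      constructor
      · rintro ⟨k, hk⟩; exact lt_trans (by positivity) hk
      · exact fun hx => exists_nat_one_div_lt hx
    rw [e] at h1
    simp only [zero_add]
    refine h1.congr fun k => ?_
    have := integral_shift_Ioi (fun t : ℝ => f (t * Complex.I) * (t * Complex.I) ^ n)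
      (1 / ((k:ℝ) + 1))
    rw [← this]
    refine integral_congr_ae (Filter.Eventually.of_forall fun t => ?_)
    simp only
    push_cast
    ring_nf
  · intro a b hab
    apply Set.Ioi_subset_Ioi
    gcongr
  · exact (F.period_int n).mono_set (Set.iUnion_subset fun k => Set.Ioi_subset_Ioi (by positivity))

lemma FP.ei_W {m : ℕ} {f h : ℂ → ℂ} (F : FP m f h) {X : ℂ} (hX : X ≠ 0) {z : ℂ} (hz : 0 < z.im) :
    Ei f (2 * m) z X = Ei f (2 * m) 0 X + (2 * X ^ 2) ^ m * Ei h (2 * m) (Wz z) (Wz X) := by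
  set D : ℂ → ℂ := fun z => Ei f (2 * m) z X - (2 * X ^ 2) ^ m * Ei h (2 * m) (Wz z) (Wz X) with hD
  have hder : ∀ z : ℂ, 0 < z.im → HasDerivAt D 0 z := by
    intro z hz
    have hz0 := H_ne hz
    have h1 := F.cf.ei_deriv (2 * m) hz X
    have hW : HasDerivAt Wz (1 / (2 * z ^ 2)) z := by
      have := ((hasDerivAt_inv hz0).const_mul (-1/2 : ℂ))
      refine (this.congr_deriv (by field_simp)).congr_of_eventuallyEq ?_
      exact Filter.Eventually.of_forall fun y => by simp only [Wz]; field_simp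
    have h2 := (F.ch.ei_deriv (2 * m) (Wz_pos hz) (Wz X)).comp z hW
    refine (h1.sub (h2.const_mul ((2 * X ^ 2) ^ m))).congr_deriv ?_
    rw [F.hf z hz]
    have e : Wz z - Wz X = (z - X) / (2 * z * X) := by unfold Wz; field_simp; ring
    rw [e, div_pow, pow_mul, pow_mul (2 * z * X)]
    have e2 : (2 * z * X) ^ 2 = (2 * z ^ 2) * (2 * X ^ 2) := by ring
    rw [e2, mul_pow (2 * z ^ 2) (2 * X ^ 2), pow_succ (2 * z ^ 2)]
    have h3 : (2 * z ^ 2) ^ m ≠ 0 := pow_ne_zero _ (by simp [hz0])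
    have h4 : (2 * X ^ 2) ^ m ≠ 0 := pow_ne_zero _ (by simp [hX])
    have h5 : (2 * z ^ 2) ≠ 0 := by simp [hz0]
    generalize (2 * z ^ 2) ^ m = a at *
    generalize (2 * X ^ 2) ^ m = b at *
    generalize (2 * z ^ 2) = e at *
    field_simp
    ring
  have hconst : ∀ z1 z2 : ℂ, 0 < z1.im → 0 < z2.im → D z1 = D z2 := by
    intro z1 z2 h1 h2
    have hconv : Convex ℝ {z : ℂ | 0 < z.im} := convex_halfSpace_im_gt 0
    refine hconv.is_const_of_fderivWithin_eq_zero (𝕜 := ℂ) (f := D)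
      (fun x hx => (hder x hx).differentiableAt.differentiableWithinAt) (fun x hx => ?_) h1 h2
    rw [fderivWithin_of_isOpen isOpen_H hx]
    ext; simp [(hder x hx).deriv]
  have hlim : Filter.Tendsto (fun k : ℕ => D ((1 / ((k:ℝ) + 1) : ℝ) * Complex.I)) Filter.atTop
      (nhds (Ei f (2 * m) 0 X - (2 * X ^ 2) ^ m * 0)) := by
    refine Filter.Tendsto.sub ?_ (Filter.Tendsto.const_mul _ ?_)
    · unfold Ei
      exact tendsto_finsetSum _ fun j _ => (F.mo_tendsto j).const_mul _
    · obtain ⟨c, hc, C, hC, hb⟩ := F.ch.ei_decay (2 * m)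
      have hy : ∀ k : ℕ, Wz ((1 / ((k:ℝ) + 1) : ℝ) * Complex.I) = (((k:ℝ) + 1) / 2 : ℝ) * Complex.I := by
        intro k
        have : ((k : ℂ) + 1) ≠ 0 := by exact_mod_cast k.succ_ne_zero
        unfold Wz; push_cast; field_simp; simp
      have hT : Filter.Tendsto (fun k : ℕ => (((k:ℝ) + 1) / 2 : ℝ)) Filter.atTop Filter.atTop :=
        (Filter.tendsto_atTop_add_const_right _ _ tendsto_natCast_atTop_atTop).atTop_div_const two_pos
      have hT2 : Filter.Tendsto (fun k : ℕ => C * Real.exp (-c * (((k:ℝ) + 1) / 2 : ℝ))) Filter.atTop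
          (nhds 0) := by
        rw [← mul_zero C]
        exact Filter.Tendsto.const_mul _ (Real.tendsto_exp_atBot.comp
          (hT.const_mul_atTop_of_neg (by linarith)))
      refine squeeze_zero_norm' ?_ hT2
      filter_upwards [hT.eventually_ge_atTop 1, hT.eventually_ge_atTop ‖Wz X‖] with k h1 h2
      rw [hy]
      have := hb ((((k:ℝ) + 1) / 2 : ℝ) * Complex.I) (Wz X) (by simpa using h1) ?_
      · simpa using this
      · refine (norm_sub_le _ _).trans ?_
        rw [norm_mul, Complex.norm_I, mul_one, Complex.norm_real, Complex.im_ofReal_mul, Complex.I_im,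
          Real.norm_of_nonneg (by linarith)]
        linarith
  have hl2 : Filter.Tendsto (fun k : ℕ => D ((1 / ((k:ℝ) + 1) : ℝ) * Complex.I)) Filter.atTop
      (nhds (D z)) := by
    refine tendsto_const_nhds.congr fun k => hconst _ _ hz ?_
    rw [Complex.im_ofReal_mul, Complex.I_im, mul_one]
    positivity
  have := tendsto_nhds_unique hl2 hlim
  simp only [hD] at this
  linear_combination this

lemma FP.per_rel {m : ℕ} {f h : ℂ → ℂ} (F : FP m f h) {X : ℂ} (hX : X ≠ 0) (hX1 : X - 1 ≠ 0)
    (hX2 : 2 * X - 1 ≠ 0) :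
    Ei f (2 * m) 0 X - Ei f (2 * m) 0 (X - 1) + (2 * X - 1) ^ (2 * m) *
      (Ei f (2 * m) 0 ((X - 1) / (2 * X - 1)) - Ei f (2 * m) 0 (-X / (2 * X - 1))) = 0 := by
  set z : ℂ := Complex.I with hz'
  have hz : 0 < z.im := by simp [hz']
  have hz1 : 0 < (z - 1).im := by simpa using hz
  have key : ∀ (Y x : ℂ), Y ≠ 0 → Y - 1 ≠ 0 → 0 < x.im → Ei f (2 * m) 0 Y - Ei f (2 * m) 0 (Y - 1) =
      (2 * (Y - 1) ^ 2) ^ m * Ei h (2 * m) (Wz (x - 1)) (Wz (Y - 1)) -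
      (2 * Y ^ 2) ^ m * Ei h (2 * m) (Wz x) (Wz Y) := by
    intro Y x h0 h1 hx
    have hx1 : 0 < (x - 1).im := by simpa using hx
    have e1 := F.ei_W h0 hx
    have e2 := F.ei_W h1 hx1
    have e3 := F.cf.ei_T (2 * m) hx1 (Y - 1)
    rw [sub_add_cancel, sub_add_cancel] at e3
    linear_combination e2 - e1 + e3
  have hz2 : 2 * z - 1 ≠ 0 := by
    intro h; have := congrArg Complex.im h; simp [hz'] at this
  have hz0 : z ≠ 0 := H_ne hz
  have hz10 : z - 1 ≠ 0 := H_ne hz1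
  have g0 : (X - 1) / (2 * X - 1) ≠ 0 := div_ne_zero hX1 hX2
  have e1 : (X - 1) / (2 * X - 1) - 1 = -X / (2 * X - 1) := by rw [div_sub_one hX2]; congr 1; ring
  have g1 : (X - 1) / (2 * X - 1) - 1 ≠ 0 := by rw [e1]; exact div_ne_zero (neg_ne_zero.mpr hX) hX2
  have e2 : (z - 1) / (2 * z - 1) - 1 = -z / (2 * z - 1) := by rw [div_sub_one hz2]; congr 1; ring
  have w1 : Wz ((X - 1) / (2 * X - 1)) = Wz (X - 1) - 1 := by
    unfold Wz; field_simp; ring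
  have w2 : Wz ((z - 1) / (2 * z - 1)) = Wz (z - 1) - 1 := by
    unfold Wz; field_simp; ring
  have w3 : Wz (-X / (2 * X - 1)) = Wz X + 1 := by
    unfold Wz; field_simp; ring
  have w4 : Wz (-z / (2 * z - 1)) = Wz z + 1 := by
    unfold Wz; field_simp; ring
  have gz : 0 < ((z - 1) / (2 * z - 1)).im := by
    have : (z - 1) / (2 * z - 1) = ⟨3/5, 1/5⟩ := by
      rw [div_eq_iff hz2]
      apply Complex.ext <;> simp [hz'] <;> norm_num
    rw [this]; norm_num
  have k1 := key X z hX hX1 hz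
  have k2 := key _ _ g0 g1 gz
  rw [e1, e2, w1, w2, w3, w4, F.ch.ei_T _ (Wz_pos hz)] at k2
  have k3 := F.ch.ei_T (2 * m) (z := Wz (z - 1) - 1) (by simpa using Wz_pos hz1) (Wz (X - 1) - 1)
  rw [sub_add_cancel, sub_add_cancel] at k3
  rw [k3] at k1
  rw [k1, k2, pow_mul (2 * X - 1), mul_sub, ← mul_assoc, ← mul_assoc, ← mul_pow, ← mul_pow]
  have q1 : (2 * X - 1) ^ 2 * (2 * (-X / (2 * X - 1)) ^ 2) = 2 * X ^ 2 := by field_simp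
  have q2 : (2 * X - 1) ^ 2 * (2 * ((X - 1) / (2 * X - 1)) ^ 2) = 2 * (X - 1) ^ 2 := by field_simp
  rw [q1, q2]; ring

open Polynomial in
/-- the period polynomial -/
def perPoly (f : ℂ → ℂ) (w : ℕ) : ℂ[X] :=
  ∑ j ∈ Finset.range (w + 1), C ((w.choose j : ℂ) * Mo f j 0) * (-X) ^ (w - j)

lemma perPoly_eval (f : ℂ → ℂ) (w : ℕ) (x : ℂ) : (perPoly f w).eval x = Ei f w 0 x := by
  simp only [perPoly, Ei, Polynomial.eval_finsetSum]
  refine Finset.sum_congr rfl fun j _ => ?_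
  simp; ring

open Polynomial in
lemma poly_E_zero (m D : ℕ) (E : ℂ[X]) (hD : E.natDegree ≤ D) (hD1 : Odd D) (hDm : D ≤ m + 1)
    (hev : E.comp (-X) = E) (hrel : ∀ y : ℂ, y ≠ 0 → y ≠ 1 → y ≠ -1 →
      E.eval y + y ^ (2 * m) * E.eval (-1 / y) = 0) (hm : 1 ≤ m) : E = 0 := by
  have hodd : ∀ j, Odd j → E.coeff j = 0 := by
    intro j hj
    have := congrArg (fun p => coeff p j) hev
    rw [show (-X : ℂ[X]) = C (-1) * X by simp] at this
    simp only [comp_C_mul_X_coeff, hj.neg_one_pow] at this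
    linear_combination (-1/2 : ℂ) * this
  have hbig : ∀ j, m < j → E.coeff j = 0 := by
    intro j hj
    rcases Nat.even_or_odd j with h | h
    · refine coeff_eq_zero_of_natDegree_lt ?_
      have : j ≠ D := by rintro rfl; exact (Nat.not_odd_iff_even.mpr h) hD1
      omega
    · exact hodd j h
  have hsum : E + reflect (2 * m) E = 0 := by
    refine Polynomial.eq_zero_of_infinite_isRoot _ ?_
    refine Set.Infinite.mono (s := ({0, 1, -1} : Set ℂ)ᶜ) ?_ (Set.Finite.infinite_compl (by simp))
    intro y hy
    simp only [Set.mem_compl_iff, Set.mem_insert_iff, Set.mem_singleton_iff, not_or] at hy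
    obtain ⟨h0, h1, h2⟩ := hy
    have h3 := hrel y h0 h1 h2
    have h4 : E.eval (-1 / y) = E.eval (y⁻¹) := by
      conv_rhs => rw [← hev]
      simp [neg_div]
    have hy0 : y⁻¹ ≠ 0 := inv_ne_zero h0
    let : Invertible (y⁻¹) := invertibleOfNonzero hy0
    have h5 := eval₂_reflect_mul_pow (RingHom.id ℂ) (y⁻¹) (2 * m) E (by omega)
    simp only [invOf_eq_inv, inv_inv, eval₂_id] at h5
    show (E + reflect (2 * m) E).eval y = 0
    rw [h4, ← h5] at h3
    rw [eval_add, ← h3, inv_pow]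
    have h6 : y ^ (2 * m) ≠ 0 := pow_ne_zero _ h0
    field_simp
  have hco : ∀ j, j ≤ 2 * m → E.coeff j + E.coeff (2 * m - j) = 0 := by
    intro j hj
    have := congrArg (fun p => coeff p j) hsum
    simpa [coeff_reflect, revAt_le hj] using this
  ext j
  rw [coeff_zero]
  rcases lt_trichotomy j m with h | h | h
  · have := hco j (by omega)
    rw [hbig (2 * m - j) (by omega)] at this
    simpa using this
  · have := hco j (by omega)
    rw [show 2 * m - j = j by omega] at this
    linear_combination (1/2 : ℂ) * this
  · exact hbig j h

open Polynomial in
lemma FP.per_even {m : ℕ} {f h : ℂ → ℂ} (F : FP m f h) (d : ℕ) (hd : m ≤ 2 * d + 2) (hm : 1 ≤ m)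
    (hdm : 2 * d < 2 * m)
    (hr : ∀ i < d, Mo f (2 * i + 1) 0 = 0) (x : ℂ) : Ei f (2 * m) 0 (-x) = Ei f (2 * m) 0 x := by
  set P := perPoly f (2 * m) with hP
  set p := P - P.comp (-X) with hp
  set E := p.comp (C (1/2) * (X + 1)) - p.comp (C (1/2) * (X - 1)) with hE
  have pev : ∀ x, p.eval x = Ei f (2 * m) 0 x - Ei f (2 * m) 0 (-x) := by
    intro x; simp [hp, hP, perPoly_eval]
  have Eev : ∀ y, E.eval y = p.eval ((y + 1) / 2) - p.eval ((y - 1) / 2) := by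
    intro x; simp [hE]; ring_nf
  have podd : ∀ x, p.eval (-x) = - p.eval x := by
    intro x; rw [pev, pev, neg_neg]; ring
  have hpdeg : p.natDegree ≤ 2 * m - 2 * d - 1 := by
    have e : p = ∑ j ∈ Finset.range (2 * m + 1), (C (((2 * m).choose j : ℂ) * Mo f j 0) * ((-X) ^ (2 * m - j) -
        X ^ (2 * m - j))) := by
      rw [hp, hP, perPoly]
      rw [sum_comp, ← Finset.sum_sub_distrib]
      refine Finset.sum_congr rfl fun j _ => ?_
      simp [mul_sub]
    rw [e]
    refine natDegree_sum_le_of_forall_le _ _ fun j hj => ?_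
    have hj : j < 2 * m + 1 := by simpa using hj
    rcases Nat.even_or_odd j with h | h
    · have : Even (2 * m - j) := by
        rcases h with ⟨a, rfl⟩; exact ⟨m - a, by omega⟩
      rw [this.neg_pow]; simp
    · obtain ⟨i, rfl⟩ := h
      by_cases hi : i < d
      · rw [hr i hi]; simp
      · refine (natDegree_C_mul_le _ _).trans ((natDegree_sub_le _ _).trans ?_)
        rw [neg_pow]
        have h1 : ((-1 : ℂ[X]) ^ (2 * m - (2 * i + 1)) * X ^ (2 * m - (2 * i + 1))).natDegree ≤ 
            2 * m - (2 * i + 1) := by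
          have : (-1 : ℂ[X]) ^ (2 * m - (2 * i + 1)) = C ((-1) ^ (2 * m - (2 * i + 1))) := by simp
          rw [this]
          exact natDegree_C_mul_X_pow_le _ _
        have h2 : (X ^ (2 * m - (2 * i + 1)) : ℂ[X]).natDegree = 2 * m - (2 * i + 1) := natDegree_X_pow _
        omega
  have hEdeg : E.natDegree ≤ 2 * m - 2 * d - 1 := by
    refine (natDegree_sub_le _ _).trans (max_le ?_ ?_)
    · rw [natDegree_comp]
      have : (C (1/2 : ℂ) * (X + 1)).natDegree ≤ 1 := by compute_degree
      nlinarith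
    · rw [natDegree_comp]
      have : (C (1/2 : ℂ) * (X - 1)).natDegree ≤ 1 := by compute_degree
      nlinarith
  have hE0 : E = 0 := by
    refine poly_E_zero m (2 * m - 2 * d - 1) E hEdeg ⟨m - d - 1, by omega⟩ (by omega) ?_ ?_ hm
    · apply Polynomial.funext
      intro r
      rw [eval_comp, eval_neg, eval_X, Eev, Eev, show (-r + 1) / 2 = -((r - 1) / 2) by ring,
        show (-r - 1) / 2 = -((r + 1) / 2) by ring, podd, podd]
      ring
    · intro y h0 h1 h2
      have a1 : (y + 1) ≠ 0 := by intro h; apply h2; linear_combination h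
      have a2 : (y - 1) ≠ 0 := by intro h; apply h1; linear_combination h
      have q1 := F.per_rel (X := (y + 1) / 2) (by simpa using a1)
        (by rw [show (y + 1) / 2 - 1 = (y - 1) / 2 by ring]; simpa using a2) (by ring_nf; exact h0)
      have q2 := F.per_rel (X := (1 - y) / 2) (by rw [show (1 - y) / 2 = -((y - 1)/2) by ring]; simpa using a2)
        (by rw [show (1 - y) / 2 - 1 = -((y + 1) / 2) by ring]; simpa using a1)
        (by rw [show 2 * ((1 - y) / 2) - 1 = -y by ring]; simpa using h0)
      rw [Eev, Eev, pev, pev, pev, pev]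
      rw [show 2 * ((y + 1) / 2) - 1 = y by ring] at q1
      rw [show 2 * ((1 - y) / 2) - 1 = -y by ring, (even_two_mul m).neg_pow] at q2
      have b1 : (-1 / y + 1) / 2 = ((y + 1) / 2 - 1) / y := by field_simp; ring
      have b2 : (-1 / y - 1) / 2 = (- ((y + 1) / 2)) / y := by field_simp; ring
      have b3 : ((1 - y) / 2 - 1) / -y = -(- ((y + 1) / 2) / y) := by field_simp; ring
      have b4 : - ((1 - y) / 2) / -y = -(((y + 1) / 2 - 1) / y) := by field_simp; ring
      have b5 : (1 - y) / 2 - 1 = -((y + 1) / 2) := by ring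
      have b6 : (1 - y) / 2 = -((y - 1) / 2) := by ring
      have b7 : (y + 1) / 2 - 1 = (y - 1) / 2 := by ring
      rw [b1, b2]
      rw [b3, b4, b5, b6] at q2
      rw [b7] at q1 q2 ⊢
      linear_combination q1 + q2
  have hper : ∀ x, p.eval (x + 1) = p.eval x := by
    intro x
    have := Eev (2 * x + 1)
    rw [hE0, eval_zero] at this
    rw [show (2 * x + 1 + 1) / 2 = x + 1 by ring, show (2 * x + 1 - 1) / 2 = x by ring] at this
    linear_combination -this
  have hp0 : p = 0 := by
    have h0 : ∀ n : ℕ, p.eval (n : ℂ) = 0 := by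
      intro n
      induction n with
      | zero => rw [pev]; simp
      | succ k ih => push_cast; rw [hper, ih]
    refine Polynomial.eq_zero_of_infinite_isRoot _ ?_
    refine Set.Infinite.mono (s := Set.range (fun n : ℕ => (n : ℂ))) ?_
      (Set.infinite_range_of_injective Nat.cast_injective)
    rintro _ ⟨n, rfl⟩
    exact h0 n
  have := pev x
  rw [hp0, eval_zero] at this
  linear_combination this

/-- reflection of the upper half plane -/
def mc (z : ℂ) : ℂ := -(starRingEnd ℂ z)

lemma mc_im (z : ℂ) : (mc z).im = z.im := by simp [mc]

/-- single-valued companion of the Eichler integral -/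
def AA (f : ℂ → ℂ) (w : ℕ) (z : ℂ) : ℂ := Ei f w z z - Ei f w (mc z) (-z)

def nn (f : ℂ → ℂ) (m : ℕ) (z : ℂ) : ℝ := ‖AA f (2 * m) z‖ / z.im ^ m

lemma CF.AA_T {f : ℂ → ℂ} (hf : CF f) (w : ℕ) {z : ℂ} (hz : 0 < z.im) :
    AA f w (z + 1) = AA f w z := by
  unfold AA
  rw [hf.ei_T w hz]
  have := hf.ei_T w (z := mc (z + 1)) (by rw [mc_im]; simpa using hz) (-(z + 1))
  rw [← this]
  congr 2 <;> simp [mc]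

lemma CF.nn_T {f : ℂ → ℂ} (hf : CF f) (m : ℕ) {z : ℂ} (hz : 0 < z.im) :
    nn f m (z + 1) = nn f m z := by
  unfold nn; rw [hf.AA_T _ hz]; simp

lemma CF.nn_T_int {f : ℂ → ℂ} (hf : CF f) (m : ℕ) {z : ℂ} (hz : 0 < z.im) (n : ℤ) :
    nn f m (z + n) = nn f m z := by
  induction n using Int.induction_on with
  | zero => simp
  | succ k ih =>
    rw [← ih]; push_cast
    rw [← add_assoc]; exact hf.nn_T m (by simpa using hz)
  | pred k ih =>
    rw [← ih]; push_cast
    rw [show z + -(k:ℂ) = z + (-k - 1) + 1 by ring]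
    exact (hf.nn_T m (by simpa using hz)).symm

lemma FP.AA_W {m : ℕ} {f h : ℂ → ℂ} (F : FP m f h)
    (hev : ∀ x, Ei f (2 * m) 0 (-x) = Ei f (2 * m) 0 x) {z : ℂ} (hz : 0 < z.im) :
    AA f (2 * m) z = (2 * z ^ 2) ^ m * AA h (2 * m) (Wz z) := by
  unfold AA
  have h0 := H_ne hz
  have e1 := F.ei_W h0 hz
  have e2 := F.ei_W (neg_ne_zero.mpr h0) (z := mc z) (by rwa [mc_im])
  have w1 : Wz (mc z) = mc (Wz z) := by
    unfold Wz mc; simp only [map_div₀, map_neg, map_one, map_mul, Complex.conj_ofNat]; ring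
  have w2 : Wz (-z) = - Wz z := by unfold Wz; simp [neg_div, div_neg]
  rw [w1, w2, hev] at e2
  rw [e1, e2]; ring

lemma FP.nn_W {m : ℕ} {f h : ℂ → ℂ} (F : FP m f h)
    (hev : ∀ x, Ei f (2 * m) 0 (-x) = Ei f (2 * m) 0 x) {z : ℂ} (hz : 0 < z.im) :
    nn f m z = nn h m (Wz z) := by
  unfold nn
  rw [F.AA_W hev hz, Wz_im, Complex.normSq_eq_norm_sq, norm_mul, norm_pow, norm_mul, norm_pow,
    Complex.norm_ofNat, div_pow]
  have : ‖z‖ ≠ 0 := norm_ne_zero_iff.mpr (H_ne hz)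
  field_simp

lemma CF.nn_decay {f : ℂ → ℂ} (hf : CF f) (m : ℕ) (ε : ℝ) (hε : 0 < ε) :
    ∃ Y : ℝ, 1 ≤ Y ∧ ∀ z : ℂ, Y ≤ z.im → nn f m z < ε := by
  obtain ⟨c, hc, C, hC, hb⟩ := hf.ei_decay (2 * m)
  have hT : Filter.Tendsto (fun y : ℝ => 2 * C * Real.exp (-c * y)) Filter.atTop (nhds 0) := by
    rw [← mul_zero (2 * C)]
    exact Filter.Tendsto.const_mul _ (Real.tendsto_exp_atBot.comp
          (Filter.tendsto_id.const_mul_atTop_of_neg (by linarith)))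
  obtain ⟨Y, hY⟩ := Filter.eventually_atTop.mp (hT.eventually_lt_const hε)
  refine ⟨max Y 1, le_max_right _ _, fun z hz => ?_⟩
  have h1 : 1 ≤ z.im := (le_max_right _ _).trans hz
  have h2 := hY z.im ((le_max_left _ _).trans hz)
  refine lt_of_le_of_lt ?_ h2
  unfold nn
  refine (div_le_self (norm_nonneg _) (one_le_pow₀ h1)).trans ?_
  refine (norm_sub_le _ _).trans ?_
  have a1 := hb z z h1 (by simp; linarith)
  have a2 := hb (mc z) (-z) (by rwa [mc_im]) ?_
  · rw [mc_im] at a2; linarith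
  · rw [mc_im]
    have : mc z - -z = 2 * (z.im : ℂ) * Complex.I := by
      unfold mc; apply Complex.ext <;> simp; ring
    rw [this]; simp [abs_of_pos (lt_of_lt_of_le one_pos h1)]

lemma CF.AA_cont {f : ℂ → ℂ} (hf : CF f) (w : ℕ) : ContinuousOn (AA f w) {z | 0 < z.im} := by
  have hM : ∀ j, ContinuousOn (Mo f j) {z | 0 < z.im} := fun j z hz =>
    (hf.mo_deriv j hz).continuousAt.continuousWithinAt
  have hmc : Continuous mc := by unfold mc; exact Complex.continuous_conj.neg
  unfold AA Ei
  refine ContinuousOn.sub ?_ ?_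
  · refine continuousOn_finsetSum _ fun j _ => ?_
    exact ContinuousOn.mul (by fun_prop) (hM j)
  · refine continuousOn_finsetSum _ fun j _ => ?_
    refine ContinuousOn.mul (by fun_prop) ((hM j).comp hmc.continuousOn fun z hz => ?_)
    show 0 < (mc z).im
    rw [mc_im]; exact hz

lemma CF.nn_cont {f : ℂ → ℂ} (hf : CF f) (m : ℕ) : ContinuousOn (nn f m) {z | 0 < z.im} := by
  unfold nn
  refine ContinuousOn.div (hf.AA_cont _).norm (by fun_prop) fun z hz => ?_
  have : 0 < z.im := hz
  positivity

/-- Reduction for the Fricke group. -/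
lemma fricke_reduce (Q : ℂ → Prop) (hT : ∀ z : ℂ, 0 < z.im → ∀ n : ℤ, Q (z + n) → Q z)
    (hW : ∀ z : ℂ, 0 < z.im → Q (Wz z) → Q z)
    (hQ : ∀ z : ℂ, 1 / 4 ≤ z.im → |z.re| ≤ 1 / 2 → Q z) (z : ℂ) (hz : 0 < z.im) : Q z := by
  have key : ∀ n : ℕ, ∀ z : ℂ, 0 < z.im → 1 / 4 ≤ z.im * (8 / 5) ^ n → Q z := by
    intro n
    induction n with
    | zero =>
      intro z hz h
      refine hT z hz (-round z.re) (hQ _ (by simpa using h) ?_)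
      have := abs_sub_round z.re
      simpa [sub_eq_add_neg] using this
    | succ n ih =>
      intro z hz h
      by_cases hy : 1 / 4 ≤ z.im
      · refine hT z hz (-round z.re) (hQ _ (by simpa using hy) ?_)
        have := abs_sub_round z.re
        simpa [sub_eq_add_neg] using this
      refine hT z hz (-round z.re) ?_
      set z' : ℂ := z + ((-round z.re : ℤ) : ℂ) with hz'
      have him : z'.im = z.im := by simp [hz']
      have hre : |z'.re| ≤ 1 / 2 := by
        have := abs_sub_round z.re
        simpa [hz', sub_eq_add_neg] using this
      have hz'0 : 0 < z'.im := by rw [him]; exact hz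
      refine hW z' hz'0 (ih _ (Wz_pos hz'0) ?_)
      rw [Wz_im, him]
      have hn : Complex.normSq z' ≤ 5 / 16 := by
        rw [Complex.normSq_apply, him]
        have : z'.re * z'.re ≤ 1/4 := by nlinarith [abs_mul_abs_self z'.re, abs_nonneg z'.re]
        push Not at hy
        nlinarith
      have hn0 : 0 < Complex.normSq z' := Complex.normSq_pos.mpr (H_ne hz'0)
      have : z.im * (8/5) ≤ z.im / (2 * Complex.normSq z') := by
        rw [le_div_iff₀ (by positivity)]
        nlinarith
      calc 1 / 4 ≤ z.im * (8/5) ^ (n + 1) := h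
        _ = z.im * (8/5) * (8/5) ^ n := by ring
        _ ≤ _ := by gcongr
  obtain ⟨n, hn⟩ := pow_unbounded_of_one_lt (1 / 4 / z.im) (show (1:ℝ) < 8 / 5 by norm_num)
  refine key n z hz ?_
  rw [div_lt_iff₀ hz] at hn
  linarith

lemma FP.nn_max {m : ℕ} {f h : ℂ → ℂ} (F : FP m f h)
    (hev : ∀ x, Ei f (2 * m) 0 (-x) = Ei f (2 * m) 0 x) {z1 : ℂ} (hz1 : 0 < z1.im)
    (hp : 0 < nn f m z1) :
    ∃ z0 : ℂ, 0 < z0.im ∧ 0 < nn f m z0 ∧ ∀ z : ℂ, 0 < z.im → nn f m z ≤ nn f m z0 := by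
  set N : ℂ → ℝ := fun z => max (nn f m z) (nn h m z) with hN
  have hWh : ∀ z : ℂ, 0 < z.im → nn h m z = nn f m (Wz z) := fun z hz => by
    rw [F.nn_W hev (Wz_pos hz), Wz_Wz]
  have hNT : ∀ z : ℂ, 0 < z.im → ∀ n : ℤ, N (z + n) = N z := fun z hz n => by
    simp only [hN, F.cf.nn_T_int m hz, F.ch.nn_T_int m hz]
  have hNW : ∀ z : ℂ, 0 < z.im → N (Wz z) = N z := fun z hz => by
    simp only [hN]
    rw [← hWh z hz, ← F.nn_W hev hz, max_comm]
  obtain ⟨Y1, hY1, hd1⟩ := F.cf.nn_decay m _ hp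
  obtain ⟨Y2, hY2, hd2⟩ := F.ch.nn_decay m _ hp
  set Y := max Y1 Y2 with hY
  have hdec : ∀ z : ℂ, Y ≤ z.im → N z < nn f m z1 := fun z hz =>
    max_lt (hd1 z ((le_max_left _ _).trans hz)) (hd2 z ((le_max_right _ _).trans hz))
  set K : Set ℂ := {z : ℂ | 1 / 4 ≤ z.im ∧ z.im ≤ Y ∧ |z.re| ≤ 1 / 2} with hK
  have hKc : IsCompact K := by
    refine Metric.isCompact_of_isClosed_isBounded ?_ ?_
    · refine (isClosed_le continuous_const Complex.continuous_im).inter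
        ((isClosed_le Complex.continuous_im continuous_const).inter
        (isClosed_le (continuous_abs.comp Complex.continuous_re) continuous_const))
    · refine (Metric.isBounded_closedBall (x := (0:ℂ)) (r := 1 / 2 + Y)).subset fun z hz => ?_
      rw [mem_closedBall_zero_iff]
      refine (Complex.norm_le_abs_re_add_abs_im z).trans ?_
      have h1 : 1 / 4 ≤ z.im := hz.1
      have h2 : z.im ≤ Y := hz.2.1
      have h3 : |z.re| ≤ 1/2 := hz.2.2
      rw [abs_of_pos (by linarith : 0 < z.im)]
      linarith
  have hKH : K ⊆ {z : ℂ | 0 < z.im} := fun z hz => lt_of_lt_of_le (by norm_num) hz.1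
  have hred : ∀ z : ℂ, 0 < z.im → nn f m z1 ≤ N z → ∃ z' ∈ K, N z' = N z := by
    intro z hz
    refine fricke_reduce (fun z => nn f m z1 ≤ N z → ∃ z' ∈ K, N z' = N z) ?_ ?_ ?_ z hz
    · intro z hz n hq h1
      rw [← hNT z hz n] at h1 ⊢
      exact hq h1
    · intro z hz hq h1
      rw [← hNW z hz] at h1 ⊢
      exact hq h1
    · intro z h1 h2 h3
      refine ⟨z, ⟨h1, ?_, h2⟩, rfl⟩
      by_contra hcon
      exact absurd (hdec z (le_of_not_ge hcon)) (not_lt.mpr h3)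
  have h1 : nn f m z1 ≤ N z1 := le_max_left _ _
  obtain ⟨z2, hz2, hz2e⟩ := hred z1 hz1 h1
  have hNc : ContinuousOn N K := ((F.cf.nn_cont m).mono hKH).sup ((F.ch.nn_cont m).mono hKH)
  obtain ⟨z3, hz3, hmax⟩ := hKc.exists_isMaxOn ⟨z2, hz2⟩ hNc
  have hall : ∀ z : ℂ, 0 < z.im → N z ≤ N z3 := by
    intro z hz
    by_cases hc : nn f m z1 ≤ N z
    · obtain ⟨z', hz', e⟩ := hred z hz hc
      rw [← e]; exact hmax hz'
    · have h5 : N z2 ≤ N z3 := hmax hz2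
      rw [hz2e] at h5
      exact ((le_of_not_ge hc).trans h1).trans h5
  have hpos : 0 < N z3 := lt_of_lt_of_le hp (h1.trans (hall z1 hz1))
  rcases max_choice (nn f m z3) (nn h m z3) with hc | hc
  · have e : N z3 = nn f m z3 := hc
    exact ⟨z3, hKH hz3, e ▸ hpos, fun z hz => e ▸ (le_max_left _ _).trans (hall z hz)⟩
  · have e : N z3 = nn f m (Wz z3) := by rw [← hWh z3 (hKH hz3)]; exact hc
    exact ⟨Wz z3, Wz_pos (hKH hz3), e ▸ hpos, fun z hz => e ▸ (le_max_left _ _).trans (hall z hz)⟩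

lemma no_max (q q' : ℂ → ℂ) (c : ℝ) (hc : 0 < c) (h1 : ∀ᶠ x in nhds (0:ℂ), HasDerivAt q (q' x) x)
    (h2 : HasDerivAt q' 0 0)
    (h3 : ∀ᶠ ε : ℝ in nhds (0:ℝ), (q (ε : ℂ)).re ≤ (q 0).re - c * ε ^ 2) : False := by
  set s : ℝ → ℝ := fun ε => (q (ε : ℂ)).re + c / 2 * ε ^ 2 with hs
  have hco : Filter.Tendsto (fun ε : ℝ => (ε : ℂ)) (nhds 0) (nhds 0) := by
    have := Complex.continuous_ofReal.tendsto (0:ℝ)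
    simpa using this
  have hd : ∀ᶠ ε : ℝ in nhds (0:ℝ), HasDerivAt s ((q' (ε:ℂ)).re + c / 2 * (2 * ε)) ε := by
    filter_upwards [hco.eventually h1] with ε hε
    have := (hasDerivAt_pow 2 ε).const_mul (c / 2)
    refine (hε.real_of_complex.add this).congr_deriv ?_
    simp
  have hdd : HasDerivAt (deriv s) c 0 := by
    have e : deriv s =ᶠ[nhds 0] fun ε : ℝ => (q' (ε:ℂ)).re + c / 2 * (2 * ε) :=
      hd.mono fun ε hε => hε.deriv
    refine HasDerivAt.congr_of_eventuallyEq ?_ e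
    have h2' : HasDerivAt q' 0 ((0:ℝ):ℂ) := by simpa using h2
    have := ((hasDerivAt_id (0:ℝ)).const_mul 2).const_mul (c / 2)
    refine (h2'.real_of_complex.add this).congr_deriv ?_
    simp
  have hs0 : s 0 = (q 0).re := by simp [hs]
  have hle : ∀ᶠ ε : ℝ in nhds (0:ℝ), s ε ≤ s 0 - c / 2 * ε ^ 2 := by
    filter_upwards [h3] with ε hε
    rw [hs0]; simp only [hs]; linarith
  have hmax : IsLocalMax s 0 := by
    filter_upwards [hle] with ε hε
    nlinarith [sq_nonneg ε]
  have hd0 := hmax.deriv_eq_zero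
  have hmin := isLocalMin_of_deriv_deriv_pos (f := s) (x₀ := 0) (by rw [hdd.deriv]; exact hc) hd0
    hd.self_of_nhds.continuousAt
  have : ∀ᶠ ε : ℝ in nhds (0:ℝ), ε = 0 := by
    filter_upwards [hle, hmin] with ε h5 h6
    have h7 : ε ^ 2 ≤ 0 := by
      have : c / 2 * ε ^ 2 ≤ 0 := by linarith
      by_contra hcon
      push Not at hcon
      have := mul_pos (half_pos hc) hcon
      linarith
    nlinarith [pow_eq_zero_iff (two_ne_zero) |>.mp (le_antisymm h7 (sq_nonneg ε))]
  have h8 := Metric.eventually_nhds_iff.mp this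
  obtain ⟨δ, hδ, h9⟩ := h8
  have := h9 (y := δ / 2) (by simp [abs_of_pos hδ]; linarith)
  linarith

/-- second order expansion for product terms -/
lemma second_prod {g h : ℂ → ℂ} {u0 z0 : ℂ} (hg : AnalyticAt ℂ g u0) (hh : AnalyticAt ℂ h z0) :
    ∃ k' : ℂ → ℂ, (∀ᶠ x in nhds (0:ℂ), HasDerivAt (fun x => g (u0 - x) * h (z0 + x) +
      g (u0 + Complex.I * x) * h (z0 + Complex.I * x)) (k' x) x) ∧
      HasDerivAt k' (-4 * (deriv g u0 * deriv h z0)) 0 := by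
  have t1 : ∀ x : ℂ, HasDerivAt (fun x : ℂ => u0 - x) (-1) x := fun x => by
    simpa using (hasDerivAt_id x).const_sub u0
  have t2 : ∀ x : ℂ, HasDerivAt (fun x : ℂ => z0 + x) 1 x := fun x => by
    simpa using (hasDerivAt_id x).const_add z0
  have t3 : ∀ a x : ℂ, HasDerivAt (fun x : ℂ => a + Complex.I * x) Complex.I x := fun a x => by
    simpa using ((hasDerivAt_id x).const_mul Complex.I).const_add a
  have n1 : Filter.Tendsto (fun x : ℂ => u0 - x) (nhds 0) (nhds u0) := by
    simpa using (t1 0).continuousAt.tendsto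
  have n2 : Filter.Tendsto (fun x : ℂ => z0 + x) (nhds 0) (nhds z0) := by
    simpa using (t2 0).continuousAt.tendsto
  have n3 : ∀ a : ℂ, Filter.Tendsto (fun x : ℂ => a + Complex.I * x) (nhds 0) (nhds a) := fun a => by
    simpa using (t3 a 0).continuousAt.tendsto
  have hg' := hg.eventually_analyticAt
  have hh' := hh.eventually_analyticAt
  refine ⟨fun x => (deriv g (u0 - x) * (-1)) * h (z0 + x) + g (u0 - x) * (deriv h (z0 + x) * 1) +
    ((deriv g (u0 + Complex.I * x) * Complex.I) * h (z0 + Complex.I * x) +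
      g (u0 + Complex.I * x) * (deriv h (z0 + Complex.I * x) * Complex.I)), ?_, ?_⟩
  · filter_upwards [n1.eventually hg', n2.eventually hh', (n3 u0).eventually hg',
      (n3 z0).eventually hh'] with x a1 a2 a3 a4
    exact ((a1.differentiableAt.hasDerivAt.comp x (t1 x)).mul
      (a2.differentiableAt.hasDerivAt.comp x (t2 x))).add
      ((a3.differentiableAt.hasDerivAt.comp x (t3 u0 x)).mul
      (a4.differentiableAt.hasDerivAt.comp x (t3 z0 x)))
  · have c1 : ∀ φ : ℂ → ℂ, AnalyticAt ℂ φ u0 → HasDerivAt (fun x : ℂ => φ (u0 - x)) (deriv φ u0 * (-1)) 0 := by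
      intro φ hφ
      have : HasDerivAt φ (deriv φ u0) (u0 - 0) := by simpa using hφ.differentiableAt.hasDerivAt
      exact this.comp 0 (t1 0)
    have c2 : ∀ φ : ℂ → ℂ, AnalyticAt ℂ φ z0 → HasDerivAt (fun x : ℂ => φ (z0 + x)) (deriv φ z0 * 1) 0 := by
      intro φ hφ
      have : HasDerivAt φ (deriv φ z0) (z0 + 0) := by simpa using hφ.differentiableAt.hasDerivAt
      exact this.comp 0 (t2 0)
    have c3 : ∀ a : ℂ, ∀ φ : ℂ → ℂ, AnalyticAt ℂ φ a →
        HasDerivAt (fun x : ℂ => φ (a + Complex.I * x)) (deriv φ a * Complex.I) 0 := by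
      intro a φ hφ
      have : HasDerivAt φ (deriv φ a) (a + Complex.I * 0) := by simpa using hφ.differentiableAt.hasDerivAt
      exact this.comp 0 (t3 a 0)
    have := (((c1 _ hg.deriv).mul_const (-1)).mul (c2 _ hh)).add ((c1 _ hg).mul ((c2 _ hh.deriv).mul_const 1))
    have := this.add (((((c3 u0 _ hg.deriv).mul_const Complex.I)).mul (c3 z0 _ hh)).add
      ((c3 u0 _ hg).mul ((c3 z0 _ hh.deriv).mul_const Complex.I)))
    refine this.congr_deriv ?_
    simp only [sub_zero, add_zero, mul_zero, mul_one]
    linear_combination (deriv (deriv g) u0 * h z0 + 2 * deriv g u0 * deriv h z0 + 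
      g u0 * deriv (deriv h) z0) * Complex.I_mul_I

lemma CF.mo_an {f : ℂ → ℂ} (hf : CF f) (n : ℕ) {z : ℂ} (hz : 0 < z.im) : AnalyticAt ℂ (Mo f n) z := by
  have : DifferentiableOn ℂ (Mo f n) {z | 0 < z.im} := fun z hz =>
    (hf.mo_deriv n hz).differentiableAt.differentiableWithinAt
  exact this.analyticAt (isOpen_H.mem_nhds hz)

lemma CF.no_max {f : ℂ → ℂ} (hf : CF f) {m : ℕ} (hm : 1 ≤ m) {z0 : ℂ} (hz0 : 0 < z0.im)
    (hp : 0 < nn f m z0) (hmax : ∀ z : ℂ, 0 < z.im → nn f m z ≤ nn f m z0) : False := by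
  set w := 2 * m with hw
  set u0 := mc z0 with hu0
  have hu0i : 0 < u0.im := by rw [hu0, mc_im]; exact hz0
  have hsum : z0 + u0 ≠ 0 := H_ne (by simp only [Complex.add_im]; linarith)
  set B0 : ℂ := AA f w z0 / (z0 + u0) ^ w with hB0
  have hA0 : AA f w z0 ≠ 0 := by
    intro h; unfold nn at hp; rw [← hw, h] at hp; simp at hp
  have hB00 : B0 ≠ 0 := div_ne_zero hA0 (pow_ne_zero _ hsum)
  -- pieces
  set hj : ℕ → ℂ → ℂ := fun j z => (w.choose j : ℂ) * z ^ (w - j) / (z + u0) ^ w with hhj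
  set H : ℂ → ℂ := fun z => Ei f w z z / (z + u0) ^ w with hH
  have han : ∀ j, AnalyticAt ℂ (hj j) z0 := by
    intro j
    have e1 : AnalyticAt ℂ (fun z : ℂ => (w.choose j : ℂ) * z ^ (w - j)) z0 := by fun_prop
    have e2 : AnalyticAt ℂ (fun z : ℂ => (z + u0) ^ w) z0 := by fun_prop
    exact e1.div e2 (pow_ne_zero _ hsum)
  have hHan : AnalyticAt ℂ H z0 := by
    have e2 : AnalyticAt ℂ (fun z : ℂ => (z + u0) ^ w) z0 := by fun_prop
    refine AnalyticAt.div ?_ e2 (pow_ne_zero _ hsum)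
    unfold Ei
    refine Finset.analyticAt_fun_sum _ fun j _ => ?_
    have e3 : AnalyticAt ℂ (fun z : ℂ => (w.choose j : ℂ) * (-z) ^ (w - j)) z0 := by fun_prop
    exact e3.mul (hf.mo_an j hz0)
  obtain ⟨K', hK1, hK2⟩ := second_prod (g := fun _ => 1) (u0 := u0) analyticAt_const hHan
  choose k' hk1 hk2 using fun j => second_prod (hf.mo_an j hu0i) (han j)
  set BB : ℂ → ℂ → ℂ := fun u z => H z - ∑ j ∈ Finset.range (w + 1), Mo f j u * hj j z with hBB
  have hBBA : ∀ z, BB (mc z) z = AA f w z / (z + u0) ^ w := by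
    intro z
    simp only [hBB, hH, hhj, AA, sub_div]
    congr 1
    rw [Ei, Finset.sum_div]
    refine Finset.sum_congr rfl fun j _ => ?_
    rw [neg_neg]; ring
  set q : ℂ → ℂ := fun x => (BB (u0 - x) (z0 + x) + BB (u0 + Complex.I * x) (z0 + Complex.I * x)) / B0
    with hq
  set q' : ℂ → ℂ := fun x => (K' x - ∑ j ∈ Finset.range (w + 1), k' j x) / B0 with hq'
  have hder1 : ∀ᶠ x in nhds (0:ℂ), HasDerivAt q (q' x) x := by
    have : ∀ᶠ x in nhds (0:ℂ), ∀ j ∈ Finset.range (w + 1), HasDerivAt (fun x => Mo f j (u0 - x) * hj j (z0 + x) +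
      Mo f j (u0 + Complex.I * x) * hj j (z0 + Complex.I * x)) (k' j x) x := by
      rw [Filter.eventually_all_finset]
      exact fun j _ => hk1 j
    filter_upwards [hK1, this] with x h1 h2
    have := (h1.sub (HasDerivAt.fun_sum h2)).div_const B0
    refine this.congr_of_eventuallyEq (Filter.Eventually.of_forall fun y => ?_)
    simp only [hq, hBB, Pi.sub_apply, Finset.sum_add_distrib]
    ring
  have hzero : ∑ j ∈ Finset.range (w + 1), deriv (Mo f j) u0 * deriv (hj j) z0 = 0 := by
    have h1 : HasDerivAt (fun z => ∑ j ∈ Finset.range (w + 1), deriv (Mo f j) u0 * hj j z)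
        (∑ j ∈ Finset.range (w + 1), deriv (Mo f j) u0 * deriv (hj j) z0) z0 :=
      HasDerivAt.fun_sum fun j _ => (han j).differentiableAt.hasDerivAt.const_mul _
    have h2 : (fun z => ∑ j ∈ Finset.range (w + 1), deriv (Mo f j) u0 * hj j z) =ᶠ[nhds z0]
        fun _ => - f u0 := by
      have : ∀ᶠ z in nhds z0, z + u0 ≠ 0 :=
        (continuous_id.add continuous_const).continuousAt.eventually_ne hsum
      filter_upwards [this] with z hz
      have e : ∀ j ∈ Finset.range (w + 1), deriv (Mo f j) u0 * hj j z =
          (- f u0 / (z + u0) ^ w) * (u0 ^ j * z ^ (w - j) * (w.choose j : ℂ)) := by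
        intro j _
        rw [(hf.mo_deriv j hu0i).deriv]; simp only [hhj]; ring
      rw [Finset.sum_congr rfl e, ← Finset.mul_sum, ← add_pow, add_comm u0 z]
      field_simp
    exact h1.unique ((hasDerivAt_const z0 _).congr_of_eventuallyEq h2)
  have hder2 : HasDerivAt q' 0 0 := by
    have := (hK2.sub (HasDerivAt.fun_sum (u := Finset.range (w + 1)) fun j _ => hk2 j)).div_const B0
    refine this.congr_deriv ?_
    rw [← Finset.mul_sum, hzero]; simp
  have hBB0 : BB u0 z0 = B0 := by rw [hu0, hBBA]
  have hq0 : q 0 = 2 := by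
    simp only [hq, sub_zero, add_zero, mul_zero, hBB0]; field_simp; norm_num
  -- the bound
  have hest : ∀ z : ℂ, ‖z - z0‖ ≤ z0.im / 2 →
      (BB (mc z) z / B0).re ≤ 1 - ‖z - z0‖ ^ 2 / (9 * z0.im ^ 2) := by
    intro z hz
    have him := (Complex.abs_im_le_norm (z - z0)).trans hz
    rw [Complex.sub_im, abs_le] at him
    have hzi : 0 < z.im := by linarith
    have hsz : z + u0 ≠ 0 := H_ne (by simp only [Complex.add_im]; linarith)
    have hnz : 0 < ‖z + u0‖ := norm_pos_iff.mpr hsz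
    have hu : ‖z0 + u0‖ = 2 * z0.im := by
      have : z0 + u0 = (2 * z0.im : ℝ) * Complex.I := by
        rw [hu0]; unfold mc; apply Complex.ext <;> simp; ring
      rw [this]; simp [abs_of_pos hz0]
    have hle3 : ‖z + u0‖ ≤ 3 * z0.im := by
      have : z + u0 = (z - z0) + (z0 + u0) := by ring
      rw [this]
      refine (norm_add_le _ _).trans ?_
      linarith
    have hid : 4 * z.im * z0.im = ‖z + u0‖ ^ 2 - ‖z - z0‖ ^ 2 := by
      rw [← Complex.normSq_eq_norm_sq, ← Complex.normSq_eq_norm_sq, Complex.normSq_apply,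
        Complex.normSq_apply, hu0]
      unfold mc; simp; ring
    have hn := hmax z hzi
    unfold nn at hn
    rw [div_le_div_iff₀ (by positivity) (by positivity)] at hn
    refine (Complex.re_le_norm _).trans ?_
    rw [hBBA, hB0, norm_div, norm_div, norm_div, norm_pow, norm_pow, hu]
    have hA0p : 0 < ‖AA f w z0‖ := norm_pos_iff.mpr hA0
    set t := 4 * z.im * z0.im / ‖z + u0‖ ^ 2 with ht
    have ht0 : 0 ≤ t := by positivity
    have ht1 : t ≤ 1 - ‖z - z0‖ ^ 2 / (9 * z0.im ^ 2) := by
      rw [ht, hid, sub_div, div_self (by positivity)]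
      have : ‖z - z0‖ ^ 2 / (9 * z0.im ^ 2) ≤ ‖z - z0‖ ^ 2 / ‖z + u0‖ ^ 2 := by
        gcongr
        nlinarith
      linarith
    have ht2 : t ≤ 1 := ht1.trans (by
      have : 0 ≤ ‖z - z0‖ ^ 2 / (9 * z0.im ^ 2) := by positivity
      linarith)
    refine le_trans ?_ ((pow_le_of_le_one ht0 ht2 (by omega : m ≠ 0)).trans ht1)
    rw [div_div_div_eq, div_le_iff₀ (by positivity), ht, hw, pow_mul, pow_mul, div_pow]
    have e : (2 * z0.im) ^ 2 = 4 * z0.im * z0.im := by ring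
    rw [e, mul_pow (4 * z0.im), mul_pow (4 * z.im), mul_pow 4, mul_pow 4]
    have : (4 * z.im ^ m * z0.im ^ m) = 4 * z.im ^ m * z0.im ^ m := rfl
    rw [div_mul_eq_mul_div, le_div_iff₀ (by positivity)]
    have hh : 0 ≤ 4 ^ m * z0.im ^ m * (‖z + u0‖ ^ 2) ^ m := by positivity
    nlinarith [mul_le_mul_of_nonneg_left hn hh]
  refine _root_.no_max q q' (2 / (9 * z0.im ^ 2)) (by positivity) hder1 hder2 ?_
  rw [hq0]
  filter_upwards [Metric.ball_mem_nhds (0:ℝ) (half_pos hz0)] with ε hε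
  have hε' : |ε| ≤ z0.im / 2 := by
    rw [Metric.mem_ball, dist_zero_right] at hε; exact hε.le
  have a1 := hest (z0 + ε) (by simpa using hε')
  have a2 := hest (z0 + Complex.I * ε) (by simpa using hε')
  have m1 : mc (z0 + ε) = u0 - ε := by rw [hu0]; unfold mc; simp; ring
  have m2 : mc (z0 + Complex.I * ε) = u0 + Complex.I * ε := by rw [hu0]; unfold mc; simp; ring
  rw [m1] at a1
  rw [m2] at a2
  simp only [add_sub_cancel_left, norm_mul, Complex.norm_I, one_mul, Complex.norm_real,
    Real.norm_eq_abs, sq_abs] at a1 a2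
  simp only [hq, add_div, Complex.add_re]
  simp only [Complex.re_ofNat]
  have : 2 / (9 * z0.im ^ 2) * ε ^ 2 = 2 * (ε ^ 2 / (9 * z0.im ^ 2)) := by ring
  linarith

lemma FP.AA_zero {m : ℕ} (hm : 1 ≤ m) {f h : ℂ → ℂ} (F : FP m f h)
    (hev : ∀ x, Ei f (2 * m) 0 (-x) = Ei f (2 * m) 0 x) {z : ℂ} (hz : 0 < z.im) :
    AA f (2 * m) z = 0 := by
  by_contra hne
  have hp : 0 < nn f m z := by
    unfold nn
    have := norm_pos_iff.mpr hne
    positivity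
  obtain ⟨z0, h0, h1, h2⟩ := F.nn_max hev hz hp
  exact F.cf.no_max hm h0 h1 h2

lemma FP.eq_zero {m : ℕ} (hm : 1 ≤ m) {f h : ℂ → ℂ} (F : FP m f h)
    (hev : ∀ x, Ei f (2 * m) 0 (-x) = Ei f (2 * m) 0 x) {u0 : ℂ} (hu0 : 0 < u0.im) :
    f u0 = 0 := by
  set w := 2 * m with hw
  set z0 := mc u0 with hz0'
  have hz0 : 0 < z0.im := by rw [hz0', mc_im]; exact hu0
  have hmc : mc z0 = u0 := by rw [hz0']; simp [mc]
  have hK : DifferentiableAt ℂ (fun z => Ei f w z z) z0 := by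
    unfold Ei
    refine DifferentiableAt.fun_sum fun j _ => ?_
    have e3 : DifferentiableAt ℂ (fun z : ℂ => (w.choose j : ℂ) * (-z) ^ (w - j)) z0 := by fun_prop
    exact e3.mul (F.cf.mo_deriv j hz0 |>.differentiableAt)
  set hj : ℕ → ℂ → ℂ := fun j z => (w.choose j : ℂ) * z ^ (w - j) with hhj
  have hjd : ∀ j, HasDerivAt (hj j) (deriv (hj j) z0) z0 := fun j => by
    refine DifferentiableAt.hasDerivAt ?_
    simp only [hhj]; fun_prop
  set k' := deriv (fun z => Ei f w z z) z0
  have hKd : HasDerivAt (fun z => Ei f w z z) k' z0 := hK.hasDerivAt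
  have hMd := fun j => F.cf.mo_deriv j hu0
  have t1 : ∀ a c : ℂ, HasDerivAt (fun x : ℂ => a + c * x) c 0 := fun a c => by
    simpa using ((hasDerivAt_id (0:ℂ)).const_mul c).const_add a
  have comp : ∀ (φ : ℂ → ℂ) (φ' a c : ℂ), HasDerivAt φ φ' a →
      HasDerivAt (fun x : ℂ => φ (a + c * x)) (φ' * c) 0 := by
    intro φ φ' a c h
    have h' : HasDerivAt φ φ' (a + c * 0) := by simpa using h
    exact h'.comp 0 (t1 a c)
  -- general directional derivative
  have dir : ∀ c d : ℂ, (∀ᶠ x : ℝ in nhds 0, mc (z0 + c * x) = u0 + d * x) →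
      k' * c - ∑ j ∈ Finset.range (w + 1), ((deriv (hj j) z0 * c) * Mo f j u0 +
        hj j z0 * (-(f u0 * u0 ^ j) * d)) = 0 := by
    intro c d hcd
    have h1 : HasDerivAt (fun x : ℂ => Ei f w (z0 + c * x) (z0 + c * x) -
        ∑ j ∈ Finset.range (w + 1), hj j (z0 + c * x) * Mo f j (u0 + d * x))
        (k' * c - ∑ j ∈ Finset.range (w + 1), ((deriv (hj j) z0 * c) * Mo f j u0 +
        hj j z0 * (-(f u0 * u0 ^ j) * d))) ((0:ℝ):ℂ) := by
      rw [Complex.ofReal_zero]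
      refine (comp _ _ _ c hKd).sub (HasDerivAt.fun_sum fun j _ => ?_)
      refine ((comp _ _ _ c (hjd j)).mul (comp _ _ _ d (hMd j))).congr_deriv ?_
      simp
    have h2 := h1.comp_ofReal
    refine h2.unique ((hasDerivAt_const (0:ℝ) (0:ℂ)).congr_of_eventuallyEq ?_)
    have hcont : Filter.Tendsto (fun x : ℝ => (z0 + c * x).im) (nhds 0) (nhds z0.im) := by
      have : Continuous (fun x : ℝ => (z0 + c * x).im) := by fun_prop
      simpa using this.tendsto 0
    filter_upwards [hcd, hcont.eventually (lt_mem_nhds hz0)] with x hx hpos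
    rw [← F.AA_zero hm hev hpos, AA, hx]
    congr 1
    rw [Ei]
    refine Finset.sum_congr rfl fun j _ => ?_
    simp only [hhj, neg_neg, hw]
  have d1 := dir 1 (-1) (Filter.Eventually.of_forall fun x => by
    rw [← hmc]; unfold mc; simp; ring)
  have d2 := dir Complex.I Complex.I (Filter.Eventually.of_forall fun x => by
    rw [← hmc]; unfold mc; simp; ring)
  have hS : ∑ j ∈ Finset.range (w + 1), hj j z0 * (f u0 * u0 ^ j) = f u0 * (u0 + z0) ^ w := by
    rw [add_pow, Finset.mul_sum]
    refine Finset.sum_congr rfl fun j _ => ?_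
    simp only [hhj]; ring
  have e1 : k' - ∑ j ∈ Finset.range (w + 1), deriv (hj j) z0 * Mo f j u0 -
      f u0 * (u0 + z0) ^ w = 0 := by
    rw [← d1, ← hS, mul_one, sub_sub, ← Finset.sum_add_distrib]
    congr 1
    exact Finset.sum_congr rfl fun j _ => by ring
  have e2 : Complex.I * (k' - ∑ j ∈ Finset.range (w + 1), deriv (hj j) z0 * Mo f j u0 +
      f u0 * (u0 + z0) ^ w) = 0 := by
    rw [← d2, ← hS, sub_add, ← Finset.sum_sub_distrib, mul_sub, Finset.mul_sum, mul_comm k']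
    congr 1
    exact Finset.sum_congr rfl fun j _ => by ring
  have e3 := (mul_eq_zero.mp e2).resolve_left Complex.I_ne_zero
  have e4 : f u0 * (u0 + z0) ^ w = 0 := by linear_combination (e3 - e1) / 2
  refine (mul_eq_zero.mp e4).resolve_right (pow_ne_zero _ (H_ne ?_))
  simp only [Complex.add_im]; linarith

/-- Injectivity of the first odd periods. -/
theorem FP.inj {m : ℕ} {f h : ℂ → ℂ} (F : FP m f h) (d : ℕ) (hd : m ≤ 2 * d + 2) (hm : 1 ≤ m)
    (hdm : 2 * d < 2 * m) (hr : ∀ i < d, Mo f (2 * i + 1) 0 = 0) {z : ℂ} (hz : 0 < z.im) : f z = 0 :=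
  F.eq_zero hm (F.per_even d hd hm hdm hr) hz

open Matrix.SpecialLinearGroup in
lemma strip_low (x0 y0 : ℝ) (hy0 : 0 < y0) : ∃ M : ℝ, 0 < M ∧ ∀ z : ℂ, y0 ≤ z.im → |z.re| ≤ x0 →
    ∀ a b : ℤ, ((a:ℝ) ^ 2 + (b:ℝ) ^ 2) ≤ M * ‖(a:ℂ) * z + b‖ ^ 2 := by
  refine ⟨2 + (1 + 2 * x0 ^ 2) / y0 ^ 2, by positivity, fun z hy hx a b => ?_⟩
  rw [← Complex.normSq_eq_norm_sq, Complex.normSq_apply]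
  simp only [Complex.add_re, Complex.mul_re, Complex.intCast_re, Complex.intCast_im, Complex.add_im,
    Complex.mul_im, zero_mul, sub_zero, add_zero]
  set u := (a:ℝ) * z.re + b
  set K := (1 + 2 * x0 ^ 2) / y0 ^ 2 with hK
  have hK' : K * y0 ^ 2 = 1 + 2 * x0 ^ 2 := by rw [hK]; field_simp
  have hK0 : 0 ≤ K := by positivity
  have hb : (b:ℝ) = u - a * z.re := by simp [u]
  have hx2 : z.re ^ 2 ≤ x0 ^ 2 := by
    rw [← sq_abs]; exact pow_le_pow_left₀ (abs_nonneg _) hx 2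
  have h1 : (b:ℝ) ^ 2 ≤ 2 * u ^ 2 + 2 * (a:ℝ) ^ 2 * x0 ^ 2 := by
    rw [hb]
    have := mul_le_mul_of_nonneg_left hx2 (sq_nonneg (a:ℝ))
    nlinarith [sq_nonneg (u + a * z.re)]
  have h2 : y0 ^ 2 ≤ z.im ^ 2 := pow_le_pow_left₀ hy0.le hy 2
  have h3 : (a:ℝ) ^ 2 * (1 + 2 * x0 ^ 2) ≤ K * ((a:ℝ) ^ 2 * z.im ^ 2) := by
    rw [← hK']
    have := mul_le_mul_of_nonneg_left h2 (mul_nonneg hK0 (sq_nonneg (a:ℝ)))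
    nlinarith
  have h4 : 0 ≤ (a:ℝ) ^ 2 * z.im ^ 2 := by positivity
  have h5 : 0 ≤ K * u ^ 2 := by positivity
  nlinarith


lemma SLZ_det (γ : (Matrix.SpecialLinearGroup (Fin 2) ℤ)) : γ.1 0 0 * γ.1 1 1 - γ.1 0 1 * γ.1 1 0 = 1 := by
  have := γ.2
  rwa [Matrix.det_fin_two] at this

lemma row_pos (γ : (Matrix.SpecialLinearGroup (Fin 2) ℤ)) (i : Fin 2) : 0 < ((γ.1 i 0 : ℝ) ^ 2 + (γ.1 i 1 : ℝ) ^ 2) := by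
  have h := SLZ_det γ
  have : γ.1 i 0 ≠ 0 ∨ γ.1 i 1 ≠ 0 := by
    by_contra hcon
    push Not at hcon
    fin_cases i <;> simp_all
  rcases this with h | h
  · have : (γ.1 i 0 : ℝ) ≠ 0 := by exact_mod_cast h
    positivity
  · have : (γ.1 i 1 : ℝ) ≠ 0 := by exact_mod_cast h
    positivity

lemma summable_pair (Q : ℕ) (hQ : 2 ≤ Q) :
    Summable fun x : ℤ × ℤ => (((x.1:ℝ) ^ 2 + (x.2:ℝ) ^ 2) ^ Q)⁻¹ := by
  have h := EisensteinSeries.summable_one_div_norm_rpow (k := (4:ℝ)) (by norm_num)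
  have h' := (finTwoArrowEquiv ℤ).symm.summable_iff.mpr h
  refine Summable.of_nonneg_of_le (fun x => by positivity) (fun x => ?_) h'
  simp only [Function.comp]
  by_cases hx : x = 0
  · subst hx
    simp
    rw [zero_pow (by omega)]; simp
  set v := (finTwoArrowEquiv ℤ).symm x with hv
  have hv0 : v ≠ 0 := by
    intro h0; apply hx; rw [hv] at h0
    have := congrFun h0 0
    have := congrFun h0 1
    ext <;> simp_all
  have hn : 1 ≤ ‖v‖ := by
    by_contra hcon
    push Not at hcon
    apply hv0
    ext i
    have h1 := (norm_le_pi_norm v i).trans_lt hcon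
    rw [Int.norm_eq_abs] at h1
    have : |v i| < 1 := by exact_mod_cast h1
    simpa using Int.abs_lt_one_iff.mp this
  have hle : ‖v‖ ^ 2 ≤ ((x.1:ℝ) ^ 2 + (x.2:ℝ) ^ 2) := by
    have e0 : v 0 = x.1 := by simp [hv]
    have e1 : v 1 = x.2 := by simp [hv]
    have : ‖v‖ ≤ Real.sqrt ((x.1:ℝ) ^ 2 + (x.2:ℝ) ^ 2) := by
      refine (pi_norm_le_iff_of_nonneg (Real.sqrt_nonneg _)).mpr fun i => ?_
      refine Real.le_sqrt_of_sq_le ?_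
      rw [Int.norm_eq_abs, sq_abs]
      fin_cases i
      · simp [e0]; positivity
      · simp [e1]; positivity
    calc _ ≤ (Real.sqrt ((x.1:ℝ) ^ 2 + (x.2:ℝ) ^ 2)) ^ 2 := by gcongr
      _ = _ := Real.sq_sqrt (by positivity)
  have e : ‖v‖ ^ (-4:ℝ) = ((‖v‖ ^ 2) ^ 2)⁻¹ := by
    rw [Real.rpow_neg (norm_nonneg _), ← pow_mul]; norm_cast
  rw [e]
  gcongr
  calc (‖v‖ ^ 2) ^ 2 ≤ (‖v‖ ^ 2) ^ Q := pow_le_pow_right₀ (one_le_pow₀ hn) hQ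
    _ ≤ _ := by gcongr

lemma summable_int_sq : Summable fun n : ℤ => ((n:ℝ) ^ 2 + 1)⁻¹ := by
  have h := (Real.summable_one_div_int_pow (p := 2)).mpr (by norm_num)
  refine Summable.of_norm_bounded_eventually h ?_
  have : ({0}ᶜ : Set ℤ) ∈ Filter.cofinite :=
    (Set.finite_singleton (0:ℤ)).compl_mem_cofinite
  filter_upwards [this] with n hn
  have hn : (n:ℝ) ≠ 0 := by exact_mod_cast hn
  rw [Real.norm_of_nonneg (by positivity), one_div]
  gcongr
  linarith

/-- The basic majorant. -/
def maj (P Q : ℕ) (γ : (Matrix.SpecialLinearGroup (Fin 2) ℤ)) : ℝ :=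
  (((γ.1 0 0 : ℝ) ^ 2 + (γ.1 0 1 : ℝ) ^ 2) ^ P)⁻¹ * (((γ.1 1 0 : ℝ) ^ 2 + (γ.1 1 1 : ℝ) ^ 2) ^ Q)⁻¹

lemma summable_maj_one (Q : ℕ) (hQ : 3 ≤ Q) : Summable (maj 1 Q) := by
  have h1 := (summable_pair (Q - 1) (by omega)).mul_of_nonneg summable_int_sq
    (fun x => by positivity) (fun x => by positivity)
  have hinj : Function.Injective (fun γ : (Matrix.SpecialLinearGroup (Fin 2) ℤ) => (((γ.1 1 0, γ.1 1 1) : ℤ × ℤ),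
      γ.1 0 0 * γ.1 1 0 + γ.1 0 1 * γ.1 1 1)) := by
    intro γ δ h
    simp only [Prod.mk.injEq] at h
    obtain ⟨⟨h1, h2⟩, h3⟩ := h
    have d1 := SLZ_det γ
    have d2 := SLZ_det δ
    rw [← h1, ← h2] at h3 d2
    have hpos : (γ.1 1 0) ^ 2 + (γ.1 1 1) ^ 2 ≠ 0 := by
      have := (row_pos γ 1).ne'
      exact_mod_cast this
    have e0 : γ.1 0 0 = δ.1 0 0 := by
      apply mul_left_cancel₀ hpos
      linear_combination (γ.1 1 0) * h3 + (γ.1 1 1) * (d1 - d2)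
    have e1 : γ.1 0 1 = δ.1 0 1 := by
      apply mul_left_cancel₀ hpos
      linear_combination (γ.1 1 1) * h3 - (γ.1 1 0) * (d1 - d2)
    ext i j
    fin_cases i <;> fin_cases j <;> simp_all
  refine (h1.comp_injective hinj).congr fun γ => ?_
  simp only [Function.comp, maj, pow_one]
  have hp1 := row_pos γ 1
  have hp0 := row_pos γ 0
  have hd : (γ.1 0 0 : ℝ) * γ.1 1 1 - γ.1 0 1 * γ.1 1 0 = 1 := by exact_mod_cast SLZ_det γ
  have e : (((γ.1 0 0 * γ.1 1 0 + γ.1 0 1 * γ.1 1 1 : ℤ) : ℝ) ^ 2 + 1) =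
      ((γ.1 0 0 : ℝ) ^ 2 + (γ.1 0 1 : ℝ) ^ 2) * ((γ.1 1 0 : ℝ) ^ 2 + (γ.1 1 1 : ℝ) ^ 2) := by
    push_cast
    linear_combination (-1 - ((γ.1 0 0 : ℝ) * γ.1 1 1 - γ.1 0 1 * γ.1 1 0)) * hd
  rw [e]
  obtain ⟨R, rfl⟩ : ∃ R, Q = R + 1 := ⟨Q - 1, by omega⟩
  rw [Nat.add_sub_cancel, pow_succ]
  field_simp
  ring

lemma summable_maj_two (P Q : ℕ) (hP : 2 ≤ P) (hQ : 2 ≤ Q) : Summable (maj P Q) := by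
  have h1 := (summable_pair P hP).mul_of_nonneg (summable_pair Q hQ)
    (fun x => by positivity) (fun x => by positivity)
  have hinj : Function.Injective (fun γ : (Matrix.SpecialLinearGroup (Fin 2) ℤ) => (((γ.1 0 0, γ.1 0 1) : ℤ × ℤ),
      ((γ.1 1 0, γ.1 1 1) : ℤ × ℤ))) := by
    intro γ δ h
    simp only [Prod.mk.injEq] at h
    obtain ⟨⟨h1, h2⟩, h3, h4⟩ := h
    ext i j
    fin_cases i <;> fin_cases j
    · exact h1
    · exact h2
    · exact h3
    · exact h4
  exact (h1.comp_injective hinj).congr fun γ => rfl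

lemma summable_maj_swap (P Q : ℕ) (h : Summable (maj P Q)) : Summable (maj Q P) := by
  have := (Equiv.mulLeft ModularGroup.S).summable_iff.mpr h
  refine this.congr fun γ => ?_
  simp only [Function.comp, maj, Equiv.coe_mulLeft]
  have e : ∀ j, (ModularGroup.S * γ).1 0 j = - γ.1 1 j ∧ (ModularGroup.S * γ).1 1 j = γ.1 0 j := by
    intro j
    have hS : (ModularGroup.S * γ).1 = !![0, -1; 1, 0] * γ.1 := rfl
    rw [hS]
    simp [Matrix.mul_apply, Fin.sum_univ_two]
  rw [(e 0).1, (e 0).2, (e 1).1, (e 1).2]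
  push_cast
  rw [neg_sq, neg_sq, mul_comm]

lemma summable_maj (P Q : ℕ) (hP : 1 ≤ P) (hQ : 1 ≤ Q) (hPQ : 4 ≤ P + Q) : Summable (maj P Q) := by
  by_cases h1 : P = 1
  · subst h1; exact summable_maj_one Q (by omega)
  by_cases h2 : Q = 1
  · subst h2; exact summable_maj_swap _ _ (summable_maj_one P (by omega))
  exact summable_maj_two P Q (by omega) (by omega)

/-- The terms of the series. -/
def trm (P Q : ℕ) (γ : (Matrix.SpecialLinearGroup (Fin 2) ℤ)) (z : ℂ) : ℂ :=
  (((γ.1 0 0 : ℂ) * z + (γ.1 0 1 : ℂ)) ^ (2 * P))⁻¹ * (((γ.1 1 0 : ℂ) * z + (γ.1 1 1 : ℂ)) ^ (2 * Q))⁻¹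

lemma row_ne (γ : (Matrix.SpecialLinearGroup (Fin 2) ℤ)) (i : Fin 2) {z : ℂ} (hz : 0 < z.im) :
    (γ.1 i 0 : ℂ) * z + (γ.1 i 1 : ℂ) ≠ 0 := by
  intro h
  have hp := row_pos γ i
  obtain ⟨M, hM, hb⟩ := strip_low |z.re| z.im hz
  have := hb z le_rfl le_rfl (γ.1 i 0) (γ.1 i 1)
  rw [h] at this
  simp at this
  linarith

lemma trm_bound (P Q : ℕ) (x0 y0 : ℝ) (hy0 : 0 < y0) : ∃ M : ℝ, 0 < M ∧ ∀ z : ℂ, y0 ≤ z.im →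
    |z.re| ≤ x0 → ∀ γ : (Matrix.SpecialLinearGroup (Fin 2) ℤ), ‖trm P Q γ z‖ ≤ M * maj P Q γ := by
  obtain ⟨M, hM, hb⟩ := strip_low x0 y0 hy0
  refine ⟨M ^ P * M ^ Q, by positivity, fun z hy hx γ => ?_⟩
  have hz : 0 < z.im := lt_of_lt_of_le hy0 hy
  have key : ∀ (i : Fin 2) (R : ℕ), ‖(((γ.1 i 0 : ℂ) * z + (γ.1 i 1 : ℂ)) ^ (2 * R))⁻¹‖ ≤
      M ^ R * ((((γ.1 i 0 : ℝ) ^ 2 + (γ.1 i 1 : ℝ) ^ 2) ^ R)⁻¹) := by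
    intro i R
    have hp := row_pos γ i
    have hn : 0 < ‖(γ.1 i 0 : ℂ) * z + (γ.1 i 1 : ℂ)‖ := norm_pos_iff.mpr (row_ne γ i hz)
    rw [norm_inv, norm_pow, pow_mul, ← div_eq_mul_inv, le_div_iff₀ (by positivity), inv_mul_le_iff₀ (by positivity),
      ← mul_pow]
    refine pow_le_pow_left₀ hp.le ?_ R
    have := hb z hy hx (γ.1 i 0) (γ.1 i 1)
    linarith
  unfold trm maj
  rw [norm_mul]
  calc _ ≤ (M ^ P * ((((γ.1 0 0 : ℝ) ^ 2 + (γ.1 0 1 : ℝ) ^ 2) ^ P)⁻¹)) *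
        (M ^ Q * ((((γ.1 1 0 : ℝ) ^ 2 + (γ.1 1 1 : ℝ) ^ 2) ^ Q)⁻¹)) :=
        mul_le_mul (key 0 P) (key 1 Q) (norm_nonneg _) (by positivity)
    _ = _ := by ring

lemma maj_nonneg (P Q : ℕ) (γ : (Matrix.SpecialLinearGroup (Fin 2) ℤ)) : 0 ≤ maj P Q γ := by unfold maj; positivity

/-- The series. -/
def Rser (P Q : ℕ) (z : ℂ) : ℂ := ∑' γ : CongruenceSubgroup.Gamma0 2, trm P Q γ.1 z

lemma summable_maj0 (P Q : ℕ) (hP : 1 ≤ P) (hQ : 1 ≤ Q) (hPQ : 4 ≤ P + Q) :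
    Summable fun γ : CongruenceSubgroup.Gamma0 2 => maj P Q γ.1 :=
  (summable_maj P Q hP hQ hPQ).comp_injective Subtype.val_injective

lemma trm_summable (P Q : ℕ) (hP : 1 ≤ P) (hQ : 1 ≤ Q) (hPQ : 4 ≤ P + Q) {z : ℂ} (hz : 0 < z.im) :
    Summable fun γ : (Matrix.SpecialLinearGroup (Fin 2) ℤ) => ‖trm P Q γ z‖ := by
  obtain ⟨M, hM, hb⟩ := trm_bound P Q |z.re| z.im hz
  exact Summable.of_nonneg_of_le (fun _ => norm_nonneg _) (fun γ => hb z le_rfl le_rfl γ)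
    ((summable_maj P Q hP hQ hPQ).mul_left M)

lemma trm_diff (P Q : ℕ) (γ : (Matrix.SpecialLinearGroup (Fin 2) ℤ)) : DifferentiableOn ℂ (trm P Q γ) {z | 0 < z.im} := by
  intro z hz
  have h0 := row_ne γ 0 hz
  have h1 := row_ne γ 1 hz
  unfold trm
  apply DifferentiableAt.differentiableWithinAt
  refine DifferentiableAt.mul (DifferentiableAt.inv (by fun_prop) (pow_ne_zero _ h0))
    (DifferentiableAt.inv (by fun_prop) (pow_ne_zero _ h1))

lemma Rser_diff (P Q : ℕ) (hP : 1 ≤ P) (hQ : 1 ≤ Q) (hPQ : 4 ≤ P + Q) :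
    DifferentiableOn ℂ (Rser P Q) {z | 0 < z.im} := by
  intro z hz
  have hz : 0 < z.im := hz
  obtain ⟨M, hM, hb⟩ := trm_bound P Q (|z.re| + 1) (z.im / 2) (by linarith)
  set U : Set ℂ := {u | z.im / 2 < u.im} ∩ {u | |u.re| < |z.re| + 1} with hU
  have hUo : IsOpen U := (isOpen_lt continuous_const Complex.continuous_im).inter
    (isOpen_lt (continuous_abs.comp Complex.continuous_re) continuous_const)
  have hzU : z ∈ U := ⟨by show z.im / 2 < z.im; linarith, by show |z.re| < |z.re| + 1; linarith⟩
  have := Complex.differentiableOn_tsum_of_summable_norm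
    (F := fun γ : CongruenceSubgroup.Gamma0 2 => trm P Q γ.1)
    ((summable_maj0 P Q hP hQ hPQ).mul_left M) (fun γ => (trm_diff P Q γ.1).mono (fun u hu => by
      have : z.im / 2 < u.im := hu.1
      show 0 < u.im
      linarith)) hUo (fun γ u hu => hb u (le_of_lt hu.1) (le_of_lt hu.2) γ.1)
  exact ((this z hzU).differentiableAt (hUo.mem_nhds hzU)).differentiableWithinAt

lemma trm_mul (P Q : ℕ) (γ δ : (Matrix.SpecialLinearGroup (Fin 2) ℤ)) {z : ℂ} (hz : 0 < z.im) :
    trm P Q γ (((δ.1 0 0 : ℂ) * z + (δ.1 0 1 : ℂ)) / ((δ.1 1 0 : ℂ) * z + (δ.1 1 1 : ℂ))) =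
      ((δ.1 1 0 : ℂ) * z + (δ.1 1 1 : ℂ)) ^ (2 * P + 2 * Q) * trm P Q (γ * δ) z := by
  have h1 := row_ne δ 1 hz
  have e : ∀ i, (γ.1 i 0 : ℂ) * (((δ.1 0 0 : ℂ) * z + (δ.1 0 1 : ℂ)) / ((δ.1 1 0 : ℂ) * z + (δ.1 1 1 : ℂ)))
      + (γ.1 i 1 : ℂ) = (((γ * δ).1 i 0 : ℂ) * z + ((γ * δ).1 i 1 : ℂ)) / ((δ.1 1 0 : ℂ) * z + (δ.1 1 1 : ℂ)) := by
    intro i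
    have hm : ∀ j, (γ * δ).1 i j = γ.1 i 0 * δ.1 0 j + γ.1 i 1 * δ.1 1 j := by
      intro j
      have : (γ * δ).1 = γ.1 * δ.1 := rfl
      rw [this, Matrix.mul_apply, Fin.sum_univ_two]
    rw [hm, hm]
    push_cast
    rw [eq_div_iff h1, add_mul, mul_assoc, div_mul_cancel₀ _ h1]
    ring
  have h0' := row_ne (γ * δ) 0 hz
  have h1' := row_ne (γ * δ) 1 hz
  unfold trm
  rw [e, e, div_pow, div_pow, pow_add]
  field_simp

lemma Rser_inv (P Q : ℕ) (δ : CongruenceSubgroup.Gamma0 2) {z : ℂ} (hz : 0 < z.im) :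
    Rser P Q (((δ.1.1 0 0 : ℂ) * z + (δ.1.1 0 1 : ℂ)) / ((δ.1.1 1 0 : ℂ) * z + (δ.1.1 1 1 : ℂ))) =
      ((δ.1.1 1 0 : ℂ) * z + (δ.1.1 1 1 : ℂ)) ^ (2 * P + 2 * Q) * Rser P Q z := by
  unfold Rser
  rw [← tsum_mul_left, ← (Equiv.mulRight δ).tsum_eq
    (fun γ : CongruenceSubgroup.Gamma0 2 => _ * trm P Q γ.1 z)]
  exact tsum_congr fun γ => trm_mul P Q γ.1 δ.1 hz

lemma Gamma0_even (γ : CongruenceSubgroup.Gamma0 2) : 2 * (γ.1.1 1 0 / 2) = γ.1.1 1 0 := by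
  have h := CongruenceSubgroup.Gamma0_mem.mp γ.2
  have : (2:ℤ) ∣ γ.1.1 1 0 := by
    have := (ZMod.intCast_zmod_eq_zero_iff_dvd (γ.1.1 1 0) 2).mp h
    exact_mod_cast this
  omega

/-- Conjugation by the Fricke involution. -/
def fricke (γ : CongruenceSubgroup.Gamma0 2) : CongruenceSubgroup.Gamma0 2 :=
  ⟨⟨!![γ.1.1 1 1, -(γ.1.1 1 0 / 2); -(2 * γ.1.1 0 1), γ.1.1 0 0], by
    have h := SLZ_det γ.1
    have h2 := Gamma0_even γ
    rw [Matrix.det_fin_two]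
    simp
    linear_combination h - (γ.1.1 0 1) * h2⟩, CongruenceSubgroup.Gamma0_mem.mpr (by
    show ((-(2 * γ.1.1 0 1) : ℤ) : ZMod 2) = 0
    rw [ZMod.intCast_zmod_eq_zero_iff_dvd]
    exact ⟨-(γ.1.1 0 1), by push_cast; ring⟩)⟩

lemma fricke_apply (γ : CongruenceSubgroup.Gamma0 2) :
    (fricke γ).1.1 0 0 = γ.1.1 1 1 ∧ (fricke γ).1.1 0 1 = -(γ.1.1 1 0 / 2) ∧
    (fricke γ).1.1 1 0 = -(2 * γ.1.1 0 1) ∧ (fricke γ).1.1 1 1 = γ.1.1 0 0 := ⟨rfl, rfl, rfl, rfl⟩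

lemma fricke_invol (γ : CongruenceSubgroup.Gamma0 2) : fricke (fricke γ) = γ := by
  obtain ⟨h00, h01, h10, h11⟩ := fricke_apply (fricke γ)
  obtain ⟨g00, g01, g10, g11⟩ := fricke_apply γ
  have h2 := Gamma0_even γ
  apply Subtype.ext
  ext i j
  fin_cases i <;> fin_cases j
  · show (fricke (fricke γ)).1.1 0 0 = γ.1.1 0 0
    rw [h00, g11]
  · show (fricke (fricke γ)).1.1 0 1 = γ.1.1 0 1
    rw [h01, g10]; omega
  · show (fricke (fricke γ)).1.1 1 0 = γ.1.1 1 0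
    rw [h10, g01]; omega
  · show (fricke (fricke γ)).1.1 1 1 = γ.1.1 1 1
    rw [h11, g00]

lemma trm_W (P Q : ℕ) (γ : CongruenceSubgroup.Gamma0 2) {z : ℂ} (hz : 0 < z.im) :
    trm P Q γ.1 (Wz z) = (2 ^ (2 * P) * z ^ (2 * P + 2 * Q)) * trm Q P (fricke γ).1 z := by
  obtain ⟨g00, g01, g10, g11⟩ := fricke_apply γ
  have hz0 := H_ne hz
  have n0 := row_ne (fricke γ).1 0 hz
  have n1 := row_ne (fricke γ).1 1 hz
  have h2 : (γ.1.1 1 0 : ℂ) = 2 * ((γ.1.1 1 0 / 2 : ℤ) : ℂ) := by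
    exact_mod_cast (Gamma0_even γ).symm
  unfold trm
  have e0 : (γ.1.1 0 0 : ℂ) * Wz z + (γ.1.1 0 1 : ℂ) =
      (-1) * (((fricke γ).1.1 1 0 : ℂ) * z + ((fricke γ).1.1 1 1 : ℂ)) / (2 * z) := by
    rw [g10, g11, Wz]; push_cast; field_simp; ring
  have e1 : (γ.1.1 1 0 : ℂ) * Wz z + (γ.1.1 1 1 : ℂ) =
      (((fricke γ).1.1 0 0 : ℂ) * z + ((fricke γ).1.1 0 1 : ℂ)) / z := by
    rw [g00, g01, Wz, h2]; push_cast; field_simp; ring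
  rw [e0, e1, div_pow, div_pow, mul_pow, mul_pow, pow_mul (-1:ℂ), pow_add]
  field_simp
  norm_num

lemma Rser_W (P Q : ℕ) {z : ℂ} (hz : 0 < z.im) :
    Rser P Q (Wz z) = (2 ^ (2 * P) * z ^ (2 * P + 2 * Q)) * Rser Q P z := by
  unfold Rser
  let e : CongruenceSubgroup.Gamma0 2 ≃ CongruenceSubgroup.Gamma0 2 :=
    ⟨fricke, fricke, fricke_invol, fricke_invol⟩
  rw [← tsum_mul_left, ← e.tsum_eq (fun γ : CongruenceSubgroup.Gamma0 2 => _ * trm Q P γ.1 z)]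
  exact tsum_congr fun γ => trm_W P Q γ hz

/-- The translation in the group. -/
def T0 : CongruenceSubgroup.Gamma0 2 :=
  ⟨ModularGroup.T, by rw [CongruenceSubgroup.Gamma0_mem]; simp [ModularGroup.T]⟩

lemma Rser_per (P Q : ℕ) {z : ℂ} (hz : 0 < z.im) : Rser P Q (z + 1) = Rser P Q z := by
  have := Rser_inv P Q T0 hz
  have h00 : T0.1.1 0 0 = 1 := rfl
  have h01 : T0.1.1 0 1 = 1 := rfl
  have h10 : T0.1.1 1 0 = 0 := rfl
  have h11 : T0.1.1 1 1 = 1 := rfl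
  rw [h00, h01, h10, h11] at this
  simpa using this

/-- Vanishing at infinity. -/
def ZI (F : ℂ → ℂ) : Prop := ∀ ε : ℝ, 0 < ε → ∃ A : ℝ, ∀ z : ℂ, A ≤ z.im → ‖F z‖ ≤ ε

lemma per_int {F : ℂ → ℂ} (hF : ∀ z : ℂ, 0 < z.im → F (z + 1) = F z) (n : ℤ) {z : ℂ} (hz : 0 < z.im) :
    F (z + n) = F z := by
  induction n using Int.induction_on with
  | zero => simp
  | succ k ih =>
    rw [← ih, ← hF (z + (k:ℤ)) (by simpa using hz)]
    push_cast; ring_nf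
  | pred k ih =>
    rw [← ih, ← hF (z + ((-(k:ℤ) - 1 : ℤ):ℂ)) (by simpa using hz)]
    push_cast; ring_nf

lemma ZI_of_strip {F : ℂ → ℂ} (hF : ∀ z : ℂ, 0 < z.im → F (z + 1) = F z)
    (h : Filter.Tendsto F (Filter.comap Complex.im Filter.atTop ⊓ Filter.principal {z | |z.re| ≤ 1}) (nhds 0)) :
    ZI F := by
  intro ε hε
  have := (Metric.tendsto_nhds.mp h) ε hε
  rw [Filter.eventually_inf_principal, Filter.eventually_comap] at this
  obtain ⟨A, hA⟩ := Filter.eventually_atTop.mp this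
  refine ⟨max A 1, fun z hz => ?_⟩
  have hz1 : 0 < z.im := lt_of_lt_of_le one_pos ((le_max_right _ _).trans hz)
  rw [← per_int hF (-⌊z.re⌋) hz1]
  have := hA z.im ((le_max_left _ _).trans hz) (z + ((-⌊z.re⌋ : ℤ) : ℂ)) (by simp) (by
    show |_| ≤ (1:ℝ)
    simp only [Complex.add_re, Complex.intCast_re]
    push_cast
    rw [abs_le]
    constructor <;> linarith [Int.floor_le z.re, Int.lt_floor_add_one z.re])
  rw [dist_zero_right] at this
  exact this.le

lemma row_ge_one (γ : (Matrix.SpecialLinearGroup (Fin 2) ℤ)) (i : Fin 2) {z : ℂ} (hz : 1 ≤ z.im) :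
    1 ≤ ‖(γ.1 i 0 : ℂ) * z + (γ.1 i 1 : ℂ)‖ := by
  by_cases h : γ.1 i 0 = 0
  · have hp := row_pos γ i
    have h1 : γ.1 i 1 ≠ 0 := by
      intro h1; rw [h, h1] at hp; simp at hp
    rw [h]
    simp
    exact_mod_cast Int.one_le_abs h1
  · have : |((γ.1 i 0 : ℂ) * z + (γ.1 i 1 : ℂ)).im| ≤ _ := Complex.abs_im_le_norm _
    refine le_trans ?_ this
    simp [abs_mul]
    have h2 : (1:ℝ) ≤ |(γ.1 i 0 : ℝ)| := by exact_mod_cast Int.one_le_abs h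
    rw [abs_of_pos (by linarith : 0 < z.im)]
    nlinarith

lemma row_ge_im (γ : (Matrix.SpecialLinearGroup (Fin 2) ℤ)) (i : Fin 2) (h : γ.1 i 0 ≠ 0) {z : ℂ} (hz : 1 ≤ z.im) :
    z.im ≤ ‖(γ.1 i 0 : ℂ) * z + (γ.1 i 1 : ℂ)‖ := by
  have : |((γ.1 i 0 : ℂ) * z + (γ.1 i 1 : ℂ)).im| ≤ _ := Complex.abs_im_le_norm _
  refine le_trans ?_ this
  simp [abs_mul]
  have h2 : (1:ℝ) ≤ |(γ.1 i 0 : ℝ)| := by exact_mod_cast Int.one_le_abs h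
  rw [abs_of_pos (by linarith : 0 < z.im)]
  nlinarith

lemma trm_small (P Q : ℕ) (hP : 1 ≤ P) (γ : CongruenceSubgroup.Gamma0 2) {z : ℂ} (hz : 1 ≤ z.im) :
    ‖trm P Q γ.1 z‖ ≤ z.im⁻¹ := by
  have ha : γ.1.1 0 0 ≠ 0 := by
    intro h
    have h1 := SLZ_det γ.1
    have h2 := Gamma0_even γ
    rw [h, ← h2] at h1
    have : 2 * (-(γ.1.1 0 1 * (γ.1.1 1 0 / 2))) = 1 := by linarith
    omega
  have h0 := row_ge_im γ.1 0 ha hz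
  have h1 := row_ge_one γ.1 1 hz
  unfold trm
  rw [norm_mul, norm_inv, norm_inv, norm_pow, norm_pow]
  have hz0 : 0 < z.im := by linarith
  have e0 : (‖(γ.1.1 0 0 : ℂ) * z + (γ.1.1 0 1 : ℂ)‖ ^ (2 * P))⁻¹ ≤ z.im⁻¹ := by
    gcongr
    calc z.im ≤ _ := h0
      _ ≤ _ := le_self_pow₀ (hz.trans h0) (by omega)
  have e1 : (‖(γ.1.1 1 0 : ℂ) * z + (γ.1.1 1 1 : ℂ)‖ ^ (2 * Q))⁻¹ ≤ 1 :=
    inv_le_one_of_one_le₀ (one_le_pow₀ h1)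
  calc _ ≤ z.im⁻¹ * 1 := mul_le_mul e0 e1 (by positivity) (by positivity)
    _ = _ := mul_one _

lemma Rser_ZI (P Q : ℕ) (hP : 1 ≤ P) (hQ : 1 ≤ Q) (hPQ : 4 ≤ P + Q) : ZI (Rser P Q) := by
  refine ZI_of_strip (fun z hz => Rser_per P Q hz) ?_
  obtain ⟨M, hM, hb⟩ := trm_bound P Q 1 1 one_pos
  set l := Filter.comap Complex.im Filter.atTop ⊓ Filter.principal {z : ℂ | |z.re| ≤ 1} with hl
  have him : Filter.Tendsto Complex.im l Filter.atTop :=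
    Filter.tendsto_comap.mono_left inf_le_left
  have h1 : ∀ᶠ z in l, 1 ≤ z.im := him.eventually_ge_atTop 1
  have h2 : ∀ᶠ z in l, |z.re| ≤ 1 := Filter.mem_inf_of_right (Filter.mem_principal_self _)
  have := tendsto_tsum_of_dominated_convergence (𝓕 := l)
    (f := fun z (γ : CongruenceSubgroup.Gamma0 2) => trm P Q γ.1 z) (g := fun _ => 0)
    ((summable_maj0 P Q hP hQ hPQ).mul_left M) (fun γ => by
      refine squeeze_zero_norm' ?_ (tendsto_inv_atTop_zero.comp him)
      filter_upwards [h1] with z hz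
      exact trm_small P Q hP γ hz) (by
      filter_upwards [h1, h2] with z hz hz2 γ
      exact hb z hz hz2 γ.1)
  rw [tsum_zero] at this
  exact this

lemma RG_eq (P Q : ℕ) (hP : 1 ≤ P) (hQ : 1 ≤ Q) (z : ℂ) :
    RG 2 (2 * P + 2 * Q - 2) (2 * Q - 1) z = (cwn (2 * P + 2 * Q - 2) (2 * Q - 1))⁻¹ * Rser P Q z := by
  unfold RG Rser
  congr 1
  refine tsum_congr fun γ => ?_
  unfold trm
  have e1 : (-(((2 * P + 2 * Q - 2 : ℕ) : ℤ) - ((2 * Q - 1 : ℕ) : ℤ) + 1)) = -((2 * P : ℕ) : ℤ) := by omega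
  have e2 : (-(((2 * Q - 1 : ℕ) : ℤ) + 1)) = -((2 * Q : ℕ) : ℤ) := by omega
  rw [e1, e2, zpow_neg, zpow_neg, zpow_natCast, zpow_natCast]

lemma cwn_ne (P Q : ℕ) (hP : 1 ≤ P) (hQ : 1 ≤ Q) : cwn (2 * P + 2 * Q - 2) (2 * Q - 1) ≠ 0 := by
  unfold cwn
  have : (2 * P + 2 * Q - 2).choose (2 * Q - 1) ≠ 0 := (Nat.choose_pos (by omega)).ne'
  have hpi := Real.pi_ne_zero
  simp [this, hpi]

/-- Cusp forms as functions on the complex plane. -/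
structure MF (m : ℕ) (F : ℂ → ℂ) : Prop where
  d : DifferentiableOn ℂ F {z | 0 < z.im}
  inv : ∀ γ : CongruenceSubgroup.Gamma0 2, ∀ z : ℂ, 0 < z.im →
    F (((γ.1.1 0 0 : ℂ) * z + (γ.1.1 0 1 : ℂ)) / ((γ.1.1 1 0 : ℂ) * z + (γ.1.1 1 1 : ℂ))) =
      ((γ.1.1 1 0 : ℂ) * z + (γ.1.1 1 1 : ℂ)) ^ (2 * m + 2) * F z
  z0 : ZI F
  z1 : ZI (fun z => F (Wz z) / (2 * z ^ 2) ^ (m + 1))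

lemma smul_coe (γ : (Matrix.SpecialLinearGroup (Fin 2) ℤ)) (τ : UpperHalfPlane) : ((γ • τ : UpperHalfPlane) : ℂ) =
    ((γ.1 0 0 : ℂ) * τ + (γ.1 0 1 : ℂ)) / ((γ.1 1 0 : ℂ) * τ + (γ.1 1 1 : ℂ)) := by
  rw [UpperHalfPlane.coe_specialLinearGroup_apply]
  simp

lemma denom_coe (γ : (Matrix.SpecialLinearGroup (Fin 2) ℤ)) (τ : UpperHalfPlane) : UpperHalfPlane.denom γ τ =
    ((γ.1 1 0 : ℂ) * τ + (γ.1 1 1 : ℂ)) := by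
  simp [UpperHalfPlane.denom]

lemma mob_pos (γ : (Matrix.SpecialLinearGroup (Fin 2) ℤ)) {z : ℂ} (hz : 0 < z.im) :
    0 < (((γ.1 0 0 : ℂ) * z + (γ.1 0 1 : ℂ)) / ((γ.1 1 0 : ℂ) * z + (γ.1 1 1 : ℂ))).im := by
  have := smul_coe γ ⟨z, hz⟩
  rw [UpperHalfPlane.coe_mk] at this
  rw [← this]
  exact (γ • (⟨z, hz⟩ : UpperHalfPlane)).2

lemma mem_Gamma0_iff (γ : (Matrix.SpecialLinearGroup (Fin 2) ℤ)) : γ ∈ CongruenceSubgroup.Gamma0 2 ↔ (2:ℤ) ∣ γ.1 1 0 := by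
  rw [CongruenceSubgroup.Gamma0_mem]
  have := (ZMod.intCast_zmod_eq_zero_iff_dvd (γ.1 1 0) 2)
  exact_mod_cast this

lemma MF.slash {m : ℕ} {F : ℂ → ℂ} (hF : MF m F) (γ : (Matrix.SpecialLinearGroup (Fin 2) ℤ)) (hγ : ¬ (2:ℤ) ∣ γ.1 1 0) {z : ℂ} (hz : 0 < z.im) :
    F (((γ.1 0 0 : ℂ) * z + (γ.1 0 1 : ℂ)) / ((γ.1 1 0 : ℂ) * z + (γ.1 1 1 : ℂ))) /
      ((γ.1 1 0 : ℂ) * z + (γ.1 1 1 : ℂ)) ^ (2 * m + 2) =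
      ((2:ℂ) ^ (m + 1))⁻¹ * (fun z => F (Wz z) / (2 * z ^ 2) ^ (m + 1)) ((z + (γ.1 1 1 : ℂ)) / 2) := by
  have hdet := SLZ_det γ
  have hdetC : (γ.1 0 0 : ℂ) * γ.1 1 1 - γ.1 0 1 * γ.1 1 0 = 1 := by exact_mod_cast hdet
  have hn := row_ne γ 1 hz
  set a := γ.1 0 0
  set b := γ.1 0 1
  set c := γ.1 1 0
  set d := γ.1 1 1
  let δ : (Matrix.SpecialLinearGroup (Fin 2) ℤ) := ⟨!![a * d - b, a; c * d - d, c], by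
    rw [Matrix.det_fin_two]; simp; linear_combination hdet⟩
  have hδ : δ ∈ CongruenceSubgroup.Gamma0 2 := by
    rw [mem_Gamma0_iff]
    show (2:ℤ) ∣ c * d - d
    obtain ⟨e, he⟩ : ∃ e, c = 2 * e + 1 := ⟨c / 2, by omega⟩
    exact ⟨e * d, by rw [he]; ring⟩
  have hzd : z + (d:ℂ) ≠ 0 := by
    intro h
    have := congrArg Complex.im h
    simp at this
    linarith
  have hu : 0 < (Wz ((z + (d:ℂ)) / 2)).im := Wz_pos (by
    rw [show ((z + (d:ℂ)) / 2) = (z + (d:ℂ)) * (((1/2 : ℝ)) : ℂ) by push_cast; ring, Complex.im_mul_ofReal]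
    simp; linarith)
  have hW : Wz ((z + (d:ℂ)) / 2) = -1 / (z + (d:ℂ)) := by
    unfold Wz; field_simp
  have h := hF.inv ⟨δ, hδ⟩ _ hu
  have h00 : δ.1 0 0 = a * d - b := rfl
  have h01 : δ.1 0 1 = a := rfl
  have h10 : δ.1 1 0 = c * d - d := rfl
  have h11 : δ.1 1 1 = c := rfl
  simp only [h00, h01, h10, h11] at h
  push_cast at h
  rw [hW] at h
  have e1 : ((c:ℂ) * d - d) * (-1 / (z + (d:ℂ))) + c = (c * z + d) / (z + d) := by
    field_simp; ring
  have e2 : ((a:ℂ) * d - b) * (-1 / (z + (d:ℂ))) + a = (a * z + b) / (z + d) := by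
    field_simp; ring
  rw [e1, e2, div_div_div_cancel_right₀ hzd] at h
  simp only []
  rw [h, hW, show 2 * ((z + (d:ℂ)) / 2) ^ 2 = (z + d) ^ 2 / 2 by ring, div_pow, div_pow, ← pow_mul,
    show 2 * (m + 1) = 2 * m + 2 by ring]
  field_simp

lemma MF.exists_cusp {m : ℕ} {F : ℂ → ℂ} (hF : MF m F) (k : ℤ) (hk : k = 2 * m + 2) :
    ∃ f : CuspForm (CongruenceSubgroup.Gamma0 2) k, ∀ τ : UpperHalfPlane, f τ = F τ := by
  have hk' : k = ((2 * m + 2 : ℕ) : ℤ) := by rw [hk]; push_cast; ring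
  have hz : ∀ γ : (Matrix.SpecialLinearGroup (Fin 2) ℤ), UpperHalfPlane.IsZeroAtImInfty
      (SlashAction.map k γ (fun τ : UpperHalfPlane => F τ)) := by
    intro γ
    rw [UpperHalfPlane.isZeroAtImInfty_iff]
    have hval : ∀ τ : UpperHalfPlane, (SlashAction.map k γ (fun τ : UpperHalfPlane => F τ)) τ =
      F (((γ.1 0 0 : ℂ) * τ + (γ.1 0 1 : ℂ)) / ((γ.1 1 0 : ℂ) * τ + (γ.1 1 1 : ℂ))) /
      ((γ.1 1 0 : ℂ) * τ + (γ.1 1 1 : ℂ)) ^ (2 * m + 2) := by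
      intro τ
      rw [ModularForm.SL_slash_apply, smul_coe, denom_coe, hk', zpow_neg, zpow_natCast]
      exact (div_eq_mul_inv _ _).symm
    intro ε hε
    by_cases hγ : (2:ℤ) ∣ γ.1 1 0
    · obtain ⟨A, hA⟩ := hF.z0 ε hε
      refine ⟨A, fun τ hτ => ?_⟩
      rw [hval, hF.inv ⟨γ, (mem_Gamma0_iff γ).mpr hγ⟩ τ τ.2,
        mul_div_cancel_left₀ _ (pow_ne_zero _ (row_ne γ 1 τ.2))]
      exact hA τ hτ
    · obtain ⟨A, hA⟩ := hF.z1 (ε * 2 ^ (m + 1)) (by positivity)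
      refine ⟨2 * A, fun τ hτ => ?_⟩
      rw [hval, hF.slash γ hγ τ.2, norm_mul, norm_inv, norm_pow, Complex.norm_ofNat,
        inv_mul_le_iff₀ (by positivity), mul_comm]
      refine hA _ ?_
      rw [show (((τ:ℂ) + (γ.1 1 1:ℂ)) / 2) = (τ + (γ.1 1 1:ℂ)) * (((1/2 : ℝ)) : ℂ) by push_cast; ring,
        Complex.im_mul_ofReal]
      simp
      linarith [show (2 * A ≤ τ.im) from hτ]
  refine ⟨{ toFun := fun τ => F τ, slash_action_eq' := ?_, holo' := ?_, zero_at_cusps' := ?_ }, fun τ => rfl⟩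
  · rintro _ ⟨γ, hγ, rfl⟩
    show SlashAction.map k γ (fun τ : UpperHalfPlane => F τ) = _
    ext τ
    rw [ModularForm.SL_slash_apply, smul_coe, denom_coe, hF.inv ⟨γ, hγ⟩ τ τ.2, hk', zpow_neg, zpow_natCast,
      mul_comm, inv_mul_cancel_left₀ (pow_ne_zero _ (row_ne γ 1 τ.2))]
  · rw [UpperHalfPlane.mdifferentiable_iff]
    refine hF.d.congr fun z hz => ?_
    simp only [Function.comp]
    show F ((UpperHalfPlane.ofComplex z : UpperHalfPlane) : ℂ) = F z
    rw [UpperHalfPlane.ofComplex_apply_of_im_pos hz]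
  · intro c hc
    rw [Subgroup.IsArithmetic.isCusp_iff_isCusp_SL2Z] at hc
    rw [OnePoint.isZeroAt_iff_forall_SL2Z hc]
    intro γ _
    exact hz γ

lemma CF_of {m : ℕ} {G : ℂ → ℂ} (hd : DifferentiableOn ℂ G {z | 0 < z.im})
    (hp : ∀ z : ℂ, 0 < z.im → G (z + 1) = G z) (hz : ZI G)
    (hb : ∃ C, ∀ z : ℂ, 0 < z.im → ‖G z‖ * z.im ^ (m + 1) ≤ C) : CF G := by
  refine ⟨hd, hp, 2 * Real.pi, by positivity, fun y0 hy0 => ?_⟩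
  have hz' : UpperHalfPlane.IsZeroAtImInfty (fun τ : UpperHalfPlane => G τ) := by
    rw [UpperHalfPlane.isZeroAtImInfty_iff]
    intro ε hε
    obtain ⟨A, hA⟩ := hz ε hε
    exact ⟨A, fun z hz => hA z hz⟩
  have h := hz'.exp_decay_atImInfty (h := 1) one_pos (by
    intro u
    simp only [Function.comp]
    by_cases hu : 0 < u.im
    · have hu' : 0 < (u + ((1:ℝ):ℂ)).im := by simpa using hu
      rw [UpperHalfPlane.ofComplex_apply_of_im_pos hu, UpperHalfPlane.ofComplex_apply_of_im_pos hu']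
      show G (u + ((1:ℝ):ℂ)) = G u
      rw [Complex.ofReal_one]
      exact hp u hu
    · rw [UpperHalfPlane.ofComplex_apply_eq_of_im_nonpos (w := u + ((1:ℝ):ℂ)) (w' := u)
        (by simpa using hu) (by simpa using hu)]) (by
    rw [UpperHalfPlane.mdifferentiable_iff]
    refine hd.congr fun z hz => ?_
    simp only [Function.comp]
    rw [UpperHalfPlane.ofComplex_apply_of_im_pos hz]) hz'.isBoundedAtImInfty
  obtain ⟨C1, hC1, h1⟩ := h.exists_pos
  rw [Asymptotics.isBigOWith_iff, UpperHalfPlane.atImInfty, Filter.eventually_comap] at h1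
  obtain ⟨A, hA⟩ := Filter.eventually_atTop.mp h1
  obtain ⟨C2, hC2⟩ := hb
  have hC20 : 0 ≤ C2 := le_trans (by simp) (hC2 Complex.I (by simp))
  refine ⟨C1 + C2 / y0 ^ (m + 1) * Real.exp (2 * Real.pi * A), by positivity, fun z hyz => ?_⟩
  have hz0 : 0 < z.im := lt_of_lt_of_le hy0 hyz
  rw [add_mul]
  by_cases hAz : A ≤ z.im
  · have := hA z.im hAz ⟨z, hz0⟩ rfl
    rw [Real.norm_of_nonneg (Real.exp_nonneg _)] at this
    have e : Real.exp (-2 * Real.pi * (⟨z, hz0⟩ : UpperHalfPlane).im / 1) = Real.exp (-(2 * Real.pi) * z.im) := by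
      congr 1
      show -2 * Real.pi * z.im / 1 = _
      ring
    rw [e] at this
    have h2 : 0 ≤ C2 / y0 ^ (m + 1) * Real.exp (2 * Real.pi * A) * Real.exp (-(2 * Real.pi) * z.im) := by
      positivity
    exact le_trans this (by linarith)
  · have h3 : ‖G z‖ ≤ C2 / y0 ^ (m + 1) := by
      rw [le_div_iff₀ (by positivity)]
      refine le_trans ?_ (hC2 z hz0)
      gcongr
    have h4 : 1 ≤ Real.exp (2 * Real.pi * A) * Real.exp (-(2 * Real.pi) * z.im) := by
      rw [← Real.exp_add]
      apply Real.one_le_exp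
      have := Real.pi_pos
      push Not at hAz
      nlinarith
    have h5 : 0 ≤ C1 * Real.exp (-(2 * Real.pi) * z.im) := by positivity
    have h6 : C2 / y0 ^ (m + 1) * 1 ≤ C2 / y0 ^ (m + 1) * (Real.exp (2 * Real.pi * A) * Real.exp (-(2 * Real.pi) * z.im)) := by
      gcongr
    rw [← mul_assoc] at h6
    linarith

/-- The lower triangular element. -/
def L0 : CongruenceSubgroup.Gamma0 2 :=
  ⟨⟨!![1, 0; -2, 1], by rw [Matrix.det_fin_two]; simp⟩, (mem_Gamma0_iff _).mpr ⟨-1, rfl⟩⟩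

lemma MF.per {m : ℕ} {F : ℂ → ℂ} (hF : MF m F) {z : ℂ} (hz : 0 < z.im) : F (z + 1) = F z := by
  have := hF.inv T0 z hz
  have h00 : T0.1.1 0 0 = 1 := rfl
  have h01 : T0.1.1 0 1 = 1 := rfl
  have h10 : T0.1.1 1 0 = 0 := rfl
  have h11 : T0.1.1 1 1 = 1 := rfl
  rw [h00, h01, h10, h11] at this
  simpa using this

lemma MF.fp {m : ℕ} {F : ℂ → ℂ} (hF : MF m F) (hb : ∃ C, ∀ z : ℂ, 0 < z.im → ‖F z‖ * z.im ^ (m + 1) ≤ C) :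
    FP m F (fun z => F (Wz z) / (2 * z ^ 2) ^ (m + 1)) := by
  refine ⟨CF_of hF.d (fun z hz => hF.per hz) hF.z0 hb, ?_, fun z hz => rfl, hb⟩
  refine CF_of (m := m) ?_ ?_ hF.z1 ?_
  · intro z hz
    have hz0 := H_ne hz
    have hW : DifferentiableAt ℂ Wz z := by
      unfold Wz
      exact DifferentiableAt.div (by fun_prop) (by fun_prop) (by simpa using hz0)
    have h1 : DifferentiableAt ℂ F (Wz z) := (hF.d _ (Wz_pos hz)).differentiableAt
      (isOpen_H.mem_nhds (Wz_pos hz))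
    have h2 : DifferentiableAt ℂ (fun z : ℂ => F (Wz z)) z := h1.comp z hW
    have h3 : DifferentiableAt ℂ (fun z : ℂ => (2 * z ^ 2) ^ (m + 1)) z := by fun_prop
    have h4 : (2 * z ^ 2) ^ (m + 1) ≠ 0 := pow_ne_zero _ (by simpa using hz0)
    exact (DifferentiableAt.fun_div h2 h3 h4).differentiableWithinAt
  · intro z hz
    have hz0 := H_ne hz
    have hz1 : 0 < (z + 1).im := by simpa using hz
    have hz10 := H_ne hz1
    have h := hF.inv L0 (Wz z) (Wz_pos hz)
    have h00 : L0.1.1 0 0 = 1 := rfl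
    have h01 : L0.1.1 0 1 = 0 := rfl
    have h10 : L0.1.1 1 0 = -2 := rfl
    have h11 : L0.1.1 1 1 = 1 := rfl
    rw [h00, h01, h10, h11] at h
    push_cast at h
    have e1 : -2 * Wz z + 1 = (z + 1) / z := by unfold Wz; field_simp; ring
    have e2 : (1 * Wz z + 0) / (-2 * Wz z + 1) = Wz (z + 1) := by
      rw [e1]; unfold Wz; field_simp; ring
    rw [e2, e1] at h
    rw [h, mul_pow, mul_pow, ← pow_mul, ← pow_mul, show 2 * (m + 1) = 2 * m + 2 by ring, div_pow]
    field_simp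
  · obtain ⟨C, hC⟩ := hb
    refine ⟨C, fun z hz => ?_⟩
    have hz0 := H_ne hz
    have hn : 0 < ‖z‖ := norm_pos_iff.mpr hz0
    refine le_trans (le_of_eq ?_) (hC (Wz z) (Wz_pos hz))
    rw [Wz_im, Complex.normSq_eq_norm_sq, norm_div, norm_pow, norm_mul, norm_pow, Complex.norm_ofNat, div_pow]
    ring

lemma MF.of_cusp {m : ℕ} (k : ℤ) (hk : k = 2 * m + 2) (f : CuspForm (CongruenceSubgroup.Gamma0 2) k) :
    MF m (fun z => f (UpperHalfPlane.ofComplex z)) := by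
  obtain rfl : k = ((2 * m + 2 : ℕ) : ℤ) := by rw [hk]; push_cast; ring
  refine ⟨UpperHalfPlane.mdifferentiable_iff.mp f.holo', ?_, ?_, ?_⟩
  · intro γ z hz
    have h := SlashInvariantForm.slash_action_eqn_SL'' f γ.2 ⟨z, hz⟩
    rw [denom_coe, zpow_natCast] at h
    rw [UpperHalfPlane.ofComplex_apply_of_im_pos hz, UpperHalfPlane.ofComplex_apply_of_im_pos (mob_pos γ.1 hz)]
    refine Eq.trans ?_ h
    congr 1
    apply UpperHalfPlane.ext
    rw [smul_coe]
  · have h := CuspFormClass.zero_at_infty_slash f (1 : (Matrix.SpecialLinearGroup (Fin 2) ℤ))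
    rw [SlashAction.slash_one, UpperHalfPlane.isZeroAtImInfty_iff] at h
    intro ε hε
    obtain ⟨A, hA⟩ := h ε hε
    refine ⟨max A 1, fun z hz => ?_⟩
    have hz0 : 0 < z.im := lt_of_lt_of_le one_pos ((le_max_right _ _).trans hz)
    simp only []
    rw [UpperHalfPlane.ofComplex_apply_of_im_pos hz0]
    exact hA _ ((le_max_left _ _).trans hz)
  · have h := CuspFormClass.zero_at_infty_slash f ModularGroup.S
    rw [UpperHalfPlane.isZeroAtImInfty_iff] at h
    intro ε hε
    obtain ⟨A, hA⟩ := h (ε / 2 ^ (m + 1)) (by positivity)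
    refine ⟨max A 1, fun z hz => ?_⟩
    have hz0 : 0 < z.im := lt_of_lt_of_le one_pos ((le_max_right _ _).trans hz)
    have hzn := H_ne hz0
    have h2 : 0 < (2 * z).im := by simpa using hz0
    have := hA ⟨2 * z, h2⟩ (by
      show A ≤ (2 * z).im
      simp
      linarith [(le_max_left A 1).trans hz])
    rw [ModularForm.SL_slash_apply, denom_coe, zpow_neg, zpow_natCast, le_div_iff₀ (by positivity)] at this
    simp only []
    rw [UpperHalfPlane.ofComplex_apply_of_im_pos (Wz_pos hz0)]
    refine le_trans (le_of_eq ?_) this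
    have h10 : ModularGroup.S.1 1 0 = 1 := rfl
    have h11 : ModularGroup.S.1 1 1 = 0 := rfl
    have h00 : ModularGroup.S.1 0 0 = 0 := rfl
    have h01 : ModularGroup.S.1 0 1 = -1 := rfl
    have e : (ModularGroup.S • (⟨2 * z, h2⟩ : UpperHalfPlane)) = ⟨Wz z, Wz_pos hz0⟩ := by
      apply UpperHalfPlane.ext
      rw [smul_coe, h10, h11, h00, h01, UpperHalfPlane.coe_mk, UpperHalfPlane.coe_mk]
      unfold Wz
      push_cast
      simp
    rw [e, h10, h11, UpperHalfPlane.coe_mk]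
    simp only [norm_div, norm_mul, norm_pow, norm_inv, Complex.norm_ofNat, Int.cast_one, Int.cast_zero, one_mul,
      add_zero]
    have : 0 < ‖z‖ := norm_pos_iff.mpr hzn
    rw [mul_pow, mul_pow, ← pow_mul, show 2 * (m + 1) = 2 * m + 2 by ring,
      show (2:ℝ) ^ (2 * m + 2) = 2 ^ (m + 1) * 2 ^ (m + 1) by ring]
    field_simp

lemma FP.of_cusp {m : ℕ} (k : ℤ) (hk : k = 2 * m + 2) (f : CuspForm (CongruenceSubgroup.Gamma0 2) k) :
    FP m (fun z => f (UpperHalfPlane.ofComplex z))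
      (fun z => f (UpperHalfPlane.ofComplex (Wz z)) / (2 * z ^ 2) ^ (m + 1)) := by
  refine (MF.of_cusp k hk f).fp ?_
  obtain ⟨C, hC⟩ := CuspFormClass.exists_bound f
  refine ⟨C, fun z hz => ?_⟩
  have := hC ⟨z, hz⟩
  have e : ((k:ℝ) / 2) = ((m + 1 : ℕ) : ℝ) := by rw [hk]; push_cast; ring
  rw [e, Real.rpow_natCast, le_div_iff₀ (pow_pos (UpperHalfPlane.im_pos _) _)] at this
  rw [UpperHalfPlane.ofComplex_apply_of_im_pos hz]
  exact this

lemma Rser_MF (m P Q : ℕ) (hP : 1 ≤ P) (hQ : 1 ≤ Q) (hPQ : P + Q = m + 1) (hm : 3 ≤ m) : MF m (Rser P Q) := by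
  refine ⟨Rser_diff P Q hP hQ (by omega), ?_, Rser_ZI P Q hP hQ (by omega), ?_⟩
  · intro γ z hz
    rw [Rser_inv P Q γ hz, show 2 * P + 2 * Q = 2 * m + 2 by omega]
  · intro ε hε
    obtain ⟨A, hA⟩ := Rser_ZI Q P hQ hP (by omega) (ε / 2 ^ (2 * P)) (by positivity)
    refine ⟨max A 1, fun z hz => ?_⟩
    have hz0 : 0 < z.im := lt_of_lt_of_le one_pos ((le_max_right _ _).trans hz)
    have hzn := H_ne hz0
    have := hA z ((le_max_left _ _).trans hz)
    rw [le_div_iff₀ (by positivity)] at this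
    have : 0 < ‖z‖ := norm_pos_iff.mpr hzn
    simp only []
    rw [Rser_W P Q hz0, show 2 * P + 2 * Q = 2 * (m + 1) by omega, pow_mul z, mul_pow]
    rw [mul_comm (2 ^ (2 * P) : ℂ), mul_assoc, mul_comm (2 ^ (m + 1) : ℂ),
      mul_div_mul_left _ _ (pow_ne_zero _ (pow_ne_zero _ hzn)), norm_div, norm_mul, norm_pow, norm_pow,
      Complex.norm_ofNat]
    rw [div_le_iff₀ (by positivity)]
    have h1 : (1:ℝ) ≤ 2 ^ (m + 1) := one_le_pow₀ (by norm_num)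
    nlinarith

/-- Imaginary part to infinity. -/
def LI : Filter ℂ := Filter.comap Complex.im Filter.atTop

lemma LI_ev {p : ℂ → Prop} : (∀ᶠ z in LI, p z) ↔ ∃ A : ℝ, ∀ z : ℂ, A ≤ z.im → p z := by
  rw [LI, Filter.eventually_comap, Filter.eventually_atTop]
  constructor
  · rintro ⟨A, hA⟩
    exact ⟨A, fun z hz => hA _ hz z rfl⟩
  · rintro ⟨A, hA⟩
    exact ⟨A, fun b hb z hz => hA z (by rw [hz]; exact hb)⟩

instance LI_neBot : LI.NeBot := by
  refine Filter.comap_neBot fun t ht => ?_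
  obtain ⟨A, hA⟩ := Filter.mem_atTop_sets.mp ht
  exact ⟨⟨0, A⟩, hA A le_rfl⟩

lemma LI_pos : ∀ᶠ z in LI, 0 < z.im := LI_ev.mpr ⟨1, fun _ hz => lt_of_lt_of_le one_pos hz⟩

lemma ZI_of_tendsto {F : ℂ → ℂ} (h : Filter.Tendsto F LI (nhds 0)) : ZI F := by
  intro ε hε
  have := (Metric.tendsto_nhds.mp h) ε hε
  obtain ⟨A, hA⟩ := LI_ev.mp this
  refine ⟨A, fun z hz => ?_⟩
  have := hA z hz
  rw [dist_zero_right] at this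
  exact this.le

/-- Modular forms with values at the two cusps. -/
structure QF (r : ℕ) (F : ℂ → ℂ) (a b : ℂ) : Prop where
  d : DifferentiableOn ℂ F {z | 0 < z.im}
  inv : ∀ γ : CongruenceSubgroup.Gamma0 2, ∀ z : ℂ, 0 < z.im →
    F (((γ.1.1 0 0 : ℂ) * z + (γ.1.1 0 1 : ℂ)) / ((γ.1.1 1 0 : ℂ) * z + (γ.1.1 1 1 : ℂ))) =
      ((γ.1.1 1 0 : ℂ) * z + (γ.1.1 1 1 : ℂ)) ^ (2 * r) * F z
  t0 : Filter.Tendsto F LI (nhds a)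
  t1 : Filter.Tendsto (fun z => F (Wz z) / (2 * z ^ 2) ^ r) LI (nhds b)

lemma QF.mul {r s : ℕ} {F G : ℂ → ℂ} {a b a' b' : ℂ} (hF : QF r F a b) (hG : QF s G a' b') :
    QF (r + s) (fun z => F z * G z) (a * a') (b * b') := by
  refine ⟨hF.d.mul hG.d, fun γ z hz => ?_, hF.t0.mul hG.t0, ?_⟩
  · rw [hF.inv γ z hz, hG.inv γ z hz]
    ring
  · refine (hF.t1.mul hG.t1).congr fun z => ?_
    rw [div_mul_div_comm, pow_add]

lemma QF.lin {r : ℕ} {F G : ℂ → ℂ} {a b a' b' : ℂ} (hF : QF r F a b) (hG : QF r G a' b') (u v : ℂ) :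
    QF r (fun z => u * F z + v * G z) (u * a + v * a') (u * b + v * b') := by
  refine ⟨(hF.d.const_mul u).add (hG.d.const_mul v), fun γ z hz => ?_,
    (hF.t0.const_mul u).add (hG.t0.const_mul v), ?_⟩
  · rw [hF.inv γ z hz, hG.inv γ z hz]
    ring
  · refine ((hF.t1.const_mul u).add (hG.t1.const_mul v)).congr fun z => ?_
    ring

lemma QF.one : QF 0 (fun _ => 1) 1 1 := by
  refine ⟨differentiableOn_const _, fun γ z hz => ?_, tendsto_const_nhds, ?_⟩
  · simp
  · simp

lemma QF.pow {r : ℕ} {F : ℂ → ℂ} {a b : ℂ} (hF : QF r F a b) (n : ℕ) :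
    QF (n * r) (fun z => F z ^ n) (a ^ n) (b ^ n) := by
  induction n with
  | zero => simpa using QF.one
  | succ n ih =>
    have := ih.mul hF
    simp only [← pow_succ] at this
    rwa [← Nat.succ_mul] at this

lemma QF.mf {m : ℕ} {F : ℂ → ℂ} (hF : QF (m + 1) F 0 0) : MF m F := by
  refine ⟨hF.d, fun γ z hz => ?_, ZI_of_tendsto hF.t0, ZI_of_tendsto hF.t1⟩
  rw [hF.inv γ z hz, Nat.mul_add]

/-- Level one forms with limit `1`. -/
structure LF (r : ℕ) (F : ℂ → ℂ) : Prop where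
  d : DifferentiableOn ℂ F {z | 0 < z.im}
  inv : ∀ γ : (Matrix.SpecialLinearGroup (Fin 2) ℤ), ∀ z : ℂ, 0 < z.im →
    F (((γ.1 0 0 : ℂ) * z + (γ.1 0 1 : ℂ)) / ((γ.1 1 0 : ℂ) * z + (γ.1 1 1 : ℂ))) =
      ((γ.1 1 0 : ℂ) * z + (γ.1 1 1 : ℂ)) ^ (2 * r) * F z
  t0 : Filter.Tendsto F LI (nhds 1)

lemma LF_E (r : ℕ) (hr : 2 ≤ r) : ∃ F, LF r F := by
  have hk : 3 ≤ 2 * r := by omega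
  let f := ModularForm.E hk
  refine ⟨fun z => f (UpperHalfPlane.ofComplex z), UpperHalfPlane.mdifferentiable_iff.mp f.holo', ?_, ?_⟩
  · intro γ z hz
    have h := SlashInvariantForm.slash_action_eqn'' f (γ := Matrix.SpecialLinearGroup.mapGL ℝ γ)
      (MonoidHom.mem_range.mpr ⟨γ, rfl⟩) ⟨z, hz⟩
    have hd : UpperHalfPlane.denom (Matrix.SpecialLinearGroup.mapGL ℝ γ) (⟨z, hz⟩ : UpperHalfPlane) = 
      ((γ.1 1 0 : ℂ) * z + (γ.1 1 1 : ℂ)) := denom_coe γ _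
    rw [hd, zpow_natCast] at h
    rw [UpperHalfPlane.ofComplex_apply_of_im_pos hz, UpperHalfPlane.ofComplex_apply_of_im_pos (mob_pos γ hz)]
    refine Eq.trans ?_ h
    congr 1
    apply UpperHalfPlane.ext
    exact (smul_coe γ ⟨z, hz⟩).symm
  · have hv : UpperHalfPlane.valueAtInfty f = 1 := by
      have h1 := EisensteinSeries.E_qExpansion_coeff_zero hk (by simp)
      have hS : (1:ℝ) ∈ (Matrix.SpecialLinearGroup.mapGL ℝ : (Matrix.SpecialLinearGroup (Fin 2) ℤ) →* _).range.strictPeriods := by simp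
      rw [← h1, UpperHalfPlane.qExpansion_coeff_zero one_pos
        (ModularFormClass.analyticAt_cuspFunction_zero f one_pos hS)
        (SlashInvariantFormClass.periodic_comp_ofComplex f hS)]
    obtain ⟨c, hc, h⟩ := ModularFormClass.exp_decay_sub_atImInfty' f
    rw [hv] at h
    have ht : Filter.Tendsto (fun τ : UpperHalfPlane => Real.exp (-c * τ.im)) UpperHalfPlane.atImInfty (nhds 0) := by
      refine Real.tendsto_exp_atBot.comp ?_
      have : Filter.Tendsto UpperHalfPlane.im UpperHalfPlane.atImInfty Filter.atTop := Filter.tendsto_comap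
      exact this.const_mul_atTop_of_neg (by linarith)
    have h2 := h.trans_tendsto ht
    rw [tendsto_sub_nhds_zero_iff] at h2
    refine h2.comp ?_
    unfold UpperHalfPlane.atImInfty
    rw [Filter.tendsto_comap_iff]
    refine Filter.Tendsto.congr' ?_ (Filter.tendsto_comap : Filter.Tendsto Complex.im LI Filter.atTop)
    filter_upwards [LI_pos] with z hz
    simp only [Function.comp]
    rw [UpperHalfPlane.ofComplex_apply_of_im_pos hz]
    rfl

lemma LF.S {r : ℕ} {F : ℂ → ℂ} (hF : LF r F) {z : ℂ} (hz : 0 < z.im) : F (-1 / z) = z ^ (2 * r) * F z := by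
  have h := hF.inv ModularGroup.S z hz
  have h10 : ModularGroup.S.1 1 0 = 1 := rfl
  have h11 : ModularGroup.S.1 1 1 = 0 := rfl
  have h00 : ModularGroup.S.1 0 0 = 0 := rfl
  have h01 : ModularGroup.S.1 0 1 = -1 := rfl
  rw [h10, h11, h00, h01] at h
  simpa using h

lemma LI_two : Filter.Tendsto (fun z : ℂ => 2 * z) LI LI := by
  intro s hs
  rw [Filter.mem_map]
  obtain ⟨A, hA⟩ := LI_ev.mp hs
  refine LI_ev.mpr ⟨A / 2, fun z hz => hA _ ?_⟩
  simp
  linarith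

lemma LF.A {r : ℕ} {F : ℂ → ℂ} (hF : LF r F) : QF r F 1 (2 ^ r) := by
  refine ⟨hF.d, fun γ z hz => hF.inv γ.1 z hz, hF.t0, ?_⟩
  have := ((hF.t0.comp LI_two).const_mul (2 ^ r))
  rw [mul_one] at this
  refine this.congr' ?_
  filter_upwards [LI_pos] with z hz
  have hz0 := H_ne hz
  have h2 : 0 < (2 * z).im := by simpa using hz
  simp only [Function.comp]
  unfold Wz
  rw [hF.S h2, mul_pow, mul_pow, ← pow_mul, show (2:ℂ) ^ (2 * r) = 2 ^ r * 2 ^ r by rw [two_mul, pow_add]]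
  field_simp

lemma LF.B {r : ℕ} {F : ℂ → ℂ} (hF : LF r F) : QF r (fun z => F (2 * z)) 1 ((2 ^ r)⁻¹) := by
  refine ⟨?_, fun γ z hz => ?_, hF.t0.comp LI_two, ?_⟩
  · refine hF.d.comp (by fun_prop) fun z hz => ?_
    simpa using hz
  · have hdet := SLZ_det γ.1
    obtain ⟨e, he⟩ := (mem_Gamma0_iff γ.1).mp γ.2
    set a := γ.1.1 0 0
    set b := γ.1.1 0 1
    set c := γ.1.1 1 0
    set d := γ.1.1 1 1
    let δ : (Matrix.SpecialLinearGroup (Fin 2) ℤ) := ⟨!![a, 2 * b; e, d], by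
      rw [Matrix.det_fin_two]; simp; rw [he] at hdet; linear_combination hdet⟩
    have h2 : 0 < (2 * z).im := by simpa using hz
    have h := hF.inv δ (2 * z) h2
    have h00 : δ.1 0 0 = a := rfl
    have h01 : δ.1 0 1 = 2 * b := rfl
    have h10 : δ.1 1 0 = e := rfl
    have h11 : δ.1 1 1 = d := rfl
    rw [h00, h01, h10, h11] at h
    push_cast at h
    rw [he]
    push_cast
    rw [show (e:ℂ) * (2 * z) + d = 2 * e * z + d by ring,
      show (a * (2 * z) + 2 * (b:ℂ)) = 2 * (a * z + b) by ring, mul_div_assoc] at h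
    exact h
  · have := hF.t0.const_mul ((2 ^ r)⁻¹)
    rw [mul_one] at this
    refine this.congr' ?_
    filter_upwards [LI_pos] with z hz
    have hz0 := H_ne hz
    rw [show 2 * Wz z = -1 / z by unfold Wz; field_simp, hF.S hz, mul_pow, ← pow_mul]
    field_simp

lemma QF.congr {r r' : ℕ} {F : ℂ → ℂ} {a b a' b' : ℂ} (hF : QF r F a b) (h1 : r = r') (h2 : a = a') (h3 : b = b') :
    QF r' F a' b' := by subst h1 h2 h3; exact hF

lemma exists_X : ∃ X Y Z : ℂ → ℂ, QF 2 X 0 (15/4) ∧ QF 2 Y 15 0 ∧ QF 3 Z 63 0 := by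
  obtain ⟨A4, h4⟩ := LF_E 2 le_rfl
  obtain ⟨A6, h6⟩ := LF_E 3 (by norm_num)
  refine ⟨_, _, _, (h4.A.lin h4.B 1 (-1)).congr rfl (by norm_num) (by norm_num),
    (h4.A.lin h4.B (-1) 16).congr rfl (by norm_num) (by norm_num),
    (h6.A.lin h6.B (-1) 64).congr rfl (by norm_num) (by norm_num)⟩

lemma QF.freq {r : ℕ} {X : ℂ → ℂ} {a b : ℂ} (hX : QF r X a b) (hb : b ≠ 0) : ∃ᶠ z in LI, X z ≠ 0 := by
  intro h
  simp only [not_not] at h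
  obtain ⟨A, hA⟩ := LI_ev.mp h
  have han : AnalyticOnNhd ℂ X {z | 0 < z.im} := hX.d.analyticOnNhd isOpen_H
  have hpc : IsPreconnected {z : ℂ | 0 < z.im} := (convex_halfSpace_im_gt 0).isPreconnected
  have hz0 : (⟨0, max A 0 + 1⟩ : ℂ) ∈ {z : ℂ | 0 < z.im} := by
    show 0 < max A 0 + 1
    positivity
  have h0 := han.eqOn_zero_of_preconnected_of_eventuallyEq_zero hpc hz0 (by
    have : {z : ℂ | A < z.im} ∈ nhds (⟨0, max A 0 + 1⟩ : ℂ) :=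
      (isOpen_lt continuous_const Complex.continuous_im).mem_nhds (by
        show A < max A 0 + 1
        linarith [le_max_left A 0])
    filter_upwards [this] with z hz
    exact hA z (le_of_lt hz))
  have h1 : Filter.Tendsto (fun z => X (Wz z) / (2 * z ^ 2) ^ r) LI (nhds 0) := by
    refine tendsto_const_nhds.congr' ?_
    filter_upwards [LI_pos] with z hz
    have : X (Wz z) = 0 := h0 (Wz_pos hz)
    rw [this, zero_div]
  exact hb (tendsto_nhds_unique hX.t1 h1)

lemma indep_XY {X Y U : ℂ → ℂ} {y u : ℂ} (hX : Filter.Tendsto X LI (nhds 0)) (hXf : ∃ᶠ z in LI, X z ≠ 0)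
    (hY : Filter.Tendsto Y LI (nhds y)) (hy : y ≠ 0) (hU : Filter.Tendsto U LI (nhds u)) (hu : u ≠ 0)
    (d K : ℕ) (hdK : d ≤ K) (c : Fin d → ℂ)
    (h : ∀ z : ℂ, 0 < z.im → ∑ i, c i * (X z ^ (i.1 + 1) * Y z ^ (K - 1 - i.1) * U z) = 0) : ∀ i, c i = 0 := by
  let p : Polynomial ℂ := ∑ i : Fin d, Polynomial.C (c i) * Polynomial.X ^ i.1
  have hp0 : p = 0 := by
    by_contra hp
    have hfin : {x : ℂ | p.eval x = 0 ∧ x ≠ 0}.Finite :=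
      (Polynomial.finite_setOfPred_isRoot hp).subset fun x hx => hx.1
    have hn : {x : ℂ | p.eval x = 0 ∧ x ≠ 0}ᶜ ∈ nhds (0:ℂ) := hfin.isClosed.isOpen_compl.mem_nhds (by simp)
    have ht : Filter.Tendsto (fun z => X z / Y z) LI (nhds 0) := by
      have := hX.div hY hy
      rwa [zero_div] at this
    have hY0 := hY.eventually_ne hy
    have hU0 := hU.eventually_ne hu
    obtain ⟨z, hz1, hz2, hz3, hz4, hz5⟩ :=
      (hXf.and_eventually ((ht.eventually hn).and (hY0.and (hU0.and LI_pos)))).exists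
    refine hz2 ⟨?_, div_ne_zero hz1 hz3⟩
    have e : X z * Y z ^ (K - 1) * U z * p.eval (X z / Y z) = 0 := by
      rw [← h z hz5, Polynomial.eval_finsetSum, Finset.mul_sum]
      refine Finset.sum_congr rfl fun i _ => ?_
      simp only [Polynomial.eval_mul, Polynomial.eval_C, Polynomial.eval_pow, Polynomial.eval_X]
      have : Y z ^ (K - 1) = Y z ^ (K - 1 - i.1) * Y z ^ i.1 := by
        rw [← pow_add]; congr 1; have := i.2; omega
      rw [this, div_pow]
      field_simp
      ring
    rcases mul_eq_zero.mp e with h1 | h1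
    · exact absurd h1 (mul_ne_zero (mul_ne_zero hz1 (pow_ne_zero _ hz3)) hz4)
    · exact h1
  intro i
  have := congrArg (fun q => Polynomial.coeff q i.1) hp0
  simp only [p, Polynomial.finsetSum_coeff, Polynomial.coeff_C_mul, Polynomial.coeff_X_pow,
    Polynomial.coeff_zero] at this
  rw [Finset.sum_eq_single i] at this
  · simpa using this
  · intro j _ hj
    rw [if_neg fun h => hj (Fin.ext h.symm), mul_zero]
  · simp

lemma exists_indep (m d : ℕ) (hm : 1 ≤ m) (hd : d = (m - 1) / 2) : ∃ G : Fin d → ℂ → ℂ, (∀ i, MF m (G i)) ∧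
    ∀ c : Fin d → ℂ, (∀ z : ℂ, 0 < z.im → ∑ i, c i * G i z = 0) → ∀ i, c i = 0 := by
  obtain ⟨X, Y, Z, hX, hY, hZ⟩ := exists_X
  have hf := hX.freq (by norm_num)
  rcases Nat.even_or_odd m with he | ho
  · obtain ⟨M, hM⟩ := he
    refine ⟨fun i z => X z ^ (i.1 + 1) * Y z ^ (d - 1 - i.1) * Z z, fun i => ?_, fun c hc => ?_⟩
    · refine QF.mf ((((hX.pow (i.1 + 1)).mul (hY.pow (d - 1 - i.1))).mul hZ).congr ?_ (by simp) (by simp))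
      have := i.2
      omega
    · exact indep_XY hX.t0 hf hY.t0 (by norm_num) hZ.t0 (by norm_num) d d le_rfl c hc
  · obtain ⟨M, hM⟩ := ho
    refine ⟨fun i z => X z ^ (i.1 + 1) * Y z ^ (d + 1 - 1 - i.1) * 1, fun i => ?_, fun c hc => ?_⟩
    · have := i.2
      refine QF.mf ((((hX.pow (i.1 + 1)).mul (hY.pow (d + 1 - 1 - i.1))).mul QF.one).congr ?_ (by simp) ?_)
      · omega
      · rw [zero_pow (by omega)]; simp
    · exact indep_XY hX.t0 hf hY.t0 (by norm_num) (tendsto_const_nhds (x := (1:ℂ))) one_ne_zero d (d + 1) (by omega) c hc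

lemma poly_coef (w : ℕ) (a : ℕ → ℂ) (h : ∀ X : ℂ, X ≠ 0 →
    ∑ j ∈ Finset.range (w + 1), (w.choose j : ℂ) * (-X) ^ (w - j) * a j = 0) (j : ℕ) (hj : j ≤ w) : a j = 0 := by
  let p : Polynomial ℂ := ∑ j ∈ Finset.range (w + 1), Polynomial.C ((w.choose j : ℂ) * a j) * Polynomial.X ^ (w - j)
  have hp : p = 0 := by
    refine Polynomial.eq_zero_of_infinite_isRoot p (Set.Infinite.mono (s := {0}ᶜ) ?_ (Set.finite_singleton (0:ℂ)).infinite_compl)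
    intro x hx
    have := h (-x) (by simpa using hx)
    show p.eval x = 0
    rw [← this]
    simp only [p, Polynomial.eval_finsetSum, Polynomial.eval_mul, Polynomial.eval_C, Polynomial.eval_pow, Polynomial.eval_X, neg_neg]
    exact Finset.sum_congr rfl fun i _ => by ring
  have := congrArg (fun q => Polynomial.coeff q (w - j)) hp
  simp only [p, Polynomial.finsetSum_coeff, Polynomial.coeff_C_mul, Polynomial.coeff_X_pow,
    Polynomial.coeff_zero] at this
  rw [Finset.sum_eq_single j] at this
  · simp only [if_true, mul_one, mul_eq_zero, Nat.cast_eq_zero] at this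
    rcases this with h1 | h1
    · exact absurd h1 (Nat.choose_pos hj).ne'
    · exact h1
  · intro i hi hij
    have := Finset.mem_range.mp hi
    rw [if_neg (by omega), mul_zero]
  · intro h1
    exact absurd (Finset.mem_range.mpr (by omega)) h1

lemma CF.mo_ray {f : ℂ → ℂ} (hf : CF f) (n : ℕ) {u : ℂ} (hu : 0 < u.im) :
    Filter.Tendsto (fun r : ℝ => Mo f n (r * u)) Filter.atTop (nhds 0) := by
  obtain ⟨c, hc, h⟩ := hf.e
  obtain ⟨C, hC, hCb⟩ := h 1 one_pos
  obtain ⟨D, hD, hDb⟩ := pow_mul_exp_bdd n (c / 2) (by positivity)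
  set K : ℝ := ‖u‖ / u.im + 1 with hK
  have hK1 : 1 ≤ K := by have : 0 ≤ ‖u‖ / u.im := by positivity
                         linarith
  have hKu : ‖u‖ ≤ K * u.im := by
    rw [hK, add_mul, div_mul_cancel₀ _ hu.ne']; linarith
  have hb : ∀ r : ℝ, 1 / u.im ≤ r → ‖Mo f n (r * u)‖ ≤ C * K ^ n * D * (2 / c) * Real.exp (-(c / 2) * u.im * r) := by
    intro r hr
    have hr0 : 0 < r := lt_of_lt_of_le (by positivity) hr
    have hr1 : 1 ≤ r * u.im := by rwa [div_le_iff₀ hu] at hr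
    unfold Mo
    rw [norm_mul, Complex.norm_I, one_mul]
    have hI : IntegrableOn (fun t : ℝ => C * K ^ n * D * Real.exp (-(c / 2) * u.im * r) * Real.exp (-(c / 2) * t)) (Set.Ioi 0) :=
      (integrableOn_exp_mul_Ioi (by linarith) 0).const_mul _
    refine (norm_integral_le_of_norm_le hI ?_).trans (le_of_eq ?_)
    · filter_upwards [ae_restrict_mem measurableSet_Ioi] with t ht
      have ht : 0 < t := ht
      have him : ((r:ℂ) * u + t * Complex.I).im = r * u.im + t := by simp
      have h1 := hCb (r * u + t * Complex.I) (by rw [him]; linarith)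
      have h2 : ‖(r:ℂ) * u + t * Complex.I‖ ≤ K * (r * u.im + t) := by
        refine (norm_add_le _ _).trans ?_
        rw [norm_mul, norm_mul, Complex.norm_I, Complex.norm_of_nonneg hr0.le, Complex.norm_of_nonneg ht.le]
        nlinarith
      rw [him] at h1
      have h3 := hDb (r * u.im + t) (by linarith)
      rw [norm_mul, norm_pow]
      calc _ ≤ C * Real.exp (-c * (r * u.im + t)) * (K * (r * u.im + t)) ^ n := by gcongr
        _ = C * K ^ n * ((r * u.im + t) ^ n * Real.exp (-(c / 2) * (r * u.im + t))) *
              (Real.exp (-(c / 2) * (r * u.im + t))) := by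
          have : Real.exp (-c * (r * u.im + t)) = Real.exp (-(c / 2) * (r * u.im + t)) * Real.exp (-(c / 2) * (r * u.im + t)) := by
            rw [← Real.exp_add]; congr 1; ring
          rw [this, mul_pow]; ring
        _ ≤ C * K ^ n * D * (Real.exp (-(c / 2) * (r * u.im + t))) := by gcongr
        _ = _ := by
          rw [mul_assoc _ (Real.exp _) (Real.exp _), ← Real.exp_add]
          congr 2; ring
    · rw [integral_const_mul, integral_exp_mul_Ioi (by linarith)]
      field_simp
      simp
  refine squeeze_zero_norm' (Filter.eventually_atTop.mpr ⟨_, hb⟩) ?_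
  have h1 : Filter.Tendsto (fun r : ℝ => -(c / 2) * u.im * r) Filter.atTop Filter.atBot :=
    Filter.tendsto_id.const_mul_atTop_of_neg (by nlinarith)
  simpa using (Real.tendsto_exp_atBot.comp h1).const_mul (C * K ^ n * D * (2 / c))

lemma CF.ei_ray {f : ℂ → ℂ} (hf : CF f) (w : ℕ) {u : ℂ} (hu : 0 < u.im) (X : ℂ) :
    Filter.Tendsto (fun r : ℝ => Ei f w (r * u) X) Filter.atTop (nhds 0) := by
  unfold Ei
  have := tendsto_finsetSum (Finset.range (w + 1)) (fun j _ =>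
    (hf.mo_ray j hu).const_mul ((w.choose j : ℂ) * (-X) ^ (w - j)))
  simpa using this

lemma FP.ei_ray0 {m : ℕ} {f h : ℂ → ℂ} (F : FP m f h) {u : ℂ} (hu : 0 < u.im) {X : ℂ} (hX : X ≠ 0) :
    Filter.Tendsto (fun r : ℝ => Ei f (2 * m) (r * u) X) (nhdsWithin 0 (Set.Ioi 0)) (nhds (Ei f (2 * m) 0 X)) := by
  have h1 := ((F.ch.ei_ray (2 * m) (Wz_pos hu) (Wz X)).comp tendsto_inv_nhdsGT_zero).const_mul ((2 * X ^ 2) ^ m)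
  have h2 := h1.const_add (Ei f (2 * m) 0 X)
  rw [mul_zero, add_zero] at h2
  refine h2.congr' ?_
  filter_upwards [self_mem_nhdsWithin] with r hr
  have hr : 0 < r := hr
  rw [F.ei_W hX (z := r * u) (by simp; positivity)]
  simp only [Function.comp]
  congr 3
  unfold Wz
  push_cast
  field_simp

lemma FP.ray_int {m : ℕ} {f h : ℂ → ℂ} (F : FP m f h) (n : ℕ) {u : ℂ} (hu : 0 < u.im) :
    IntegrableOn (fun r : ℝ => f (r * u) * (r * u) ^ n) (Set.Ioi 0) := by
  have hu0 : 0 < ‖u‖ := norm_pos_iff.mpr (H_ne hu)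
  have hmeas : ContinuousOn (fun t : ℝ => f (t * u) * (t * u) ^ n) (Set.Ioi 0) := by
    refine (F.cf.d' n).continuousOn.comp (f := fun t : ℝ => (t * u)) (by fun_prop) fun t ht => ?_
    have : 0 < t := ht
    simp; positivity
  obtain ⟨C, hC, h1⟩ := F.bound2 (m + 1) (by positivity)
  have hI1 : IntegrableOn (fun t : ℝ => f (t * u) * (t * u) ^ n) (Set.Ioc 0 1) := by
    refine Integrable.mono' (g := fun _ => C * (u.im / ‖u‖) ^ (-(m + 1 : ℝ) - (m + 1 : ℝ)) * ‖u‖ ^ n) (integrableOn_const (by simp))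
      ((hmeas.mono Set.Ioc_subset_Ioi_self).aestronglyMeasurable measurableSet_Ioc) ?_
    filter_upwards [ae_restrict_mem measurableSet_Ioc] with t ht
    have h3 : 0 < t := ht.1
    have h2 := h1 (t * u) (by simp; positivity)
    have e1 : ((t:ℂ) * u).im / ‖(t:ℂ) * u‖ = u.im / ‖u‖ := by
      rw [norm_mul, Complex.norm_of_nonneg h3.le, Complex.im_ofReal_mul]
      field_simp
    rw [e1, neg_add_cancel, Real.rpow_zero, mul_one] at h2
    rw [norm_mul, norm_pow]
    have : ‖(t:ℂ) * u‖ ≤ ‖u‖ := by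
      rw [norm_mul, Complex.norm_of_nonneg h3.le]
      nlinarith [ht.2]
    gcongr
  have hI2 : IntegrableOn (fun t : ℝ => f (t * u) * (t * u) ^ n) (Set.Ioi 1) := by
    obtain ⟨c, hc, h⟩ := F.cf.e
    obtain ⟨C, hC, hCb⟩ := h u.im hu
    obtain ⟨D, hD, hDb⟩ := pow_mul_exp_bdd n (c * u.im / 2) (by positivity)
    refine Integrable.mono' (g := fun t => C * ‖u‖ ^ n * D * Real.exp (-(c * u.im / 2) * t))
      ((integrableOn_exp_mul_Ioi (by have : 0 < c * u.im := by positivity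
                                     linarith) 1).const_mul _)
      ((hmeas.mono (Set.Ioi_subset_Ioi zero_le_one)).aestronglyMeasurable measurableSet_Ioi) ?_
    filter_upwards [ae_restrict_mem measurableSet_Ioi] with t ht
    have ht1 : 1 < t := ht
    have ht0 : 0 < t := by linarith
    have h2 := hCb (t * u) (by rw [Complex.im_ofReal_mul]; nlinarith)
    have h3 := hDb t ht0.le
    rw [Complex.im_ofReal_mul] at h2
    rw [norm_mul, norm_pow, norm_mul, Complex.norm_of_nonneg ht0.le, mul_pow]
    calc _ ≤ C * Real.exp (-c * (t * u.im)) * (t ^ n * ‖u‖ ^ n) := by gcongr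
      _ = C * ‖u‖ ^ n * (t ^ n * Real.exp (-(c * u.im / 2) * t)) * Real.exp (-(c * u.im / 2) * t) := by
        have : Real.exp (-c * (t * u.im)) = Real.exp (-(c * u.im / 2) * t) * Real.exp (-(c * u.im / 2) * t) := by
          rw [← Real.exp_add]; congr 1; ring
        rw [this]; ring
      _ ≤ _ := by gcongr
  rw [← Set.Ioc_union_Ioi_eq_Ioi (zero_le_one (α := ℝ))]
  exact hI1.union hI2

lemma FP.ray {m : ℕ} {f h : ℂ → ℂ} (F : FP m f h) (n : ℕ) (hn : n ≤ 2 * m) {u : ℂ} (hu : 0 < u.im) :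
    u * ∫ r in Set.Ioi (0:ℝ), f (r * u) * (r * u) ^ n = Mo f n 0 := by
  rw [← sub_eq_zero]
  refine poly_coef (2 * m) (fun n => u * (∫ r in Set.Ioi (0:ℝ), f (r * u) * (r * u) ^ n) - Mo f n 0) (fun X hX => ?_) n hn
  have hexp : ∀ r : ℝ, u * (f (r * u) * (r * u - X) ^ (2 * m)) = ∑ j ∈ Finset.range (2 * m + 1),
      (((2 * m).choose j : ℂ) * (-X) ^ (2 * m - j) * u) * (f (r * u) * (r * u) ^ j) := by
    intro r
    rw [sub_pow_expand, Finset.mul_sum, Finset.mul_sum]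
    exact Finset.sum_congr rfl fun j _ => by ring
  have upInt : ∀ j ∈ Finset.range (2 * m + 1), IntegrableOn (fun r : ℝ => 
      (((2 * m).choose j : ℂ) * (-X) ^ (2 * m - j) * u) * (f (r * u) * (r * u) ^ j)) (Set.Ioi 0) :=
    fun j _ => (F.ray_int j hu).const_mul _
  have hder : ∀ r ∈ Set.Ioi (0:ℝ), HasDerivAt (fun r : ℝ => - Ei f (2 * m) (r * u) X)
      (u * (f (r * u) * (r * u - X) ^ (2 * m))) r := by
    intro r hr
    have hr : 0 < r := hr
    have h1 := F.cf.ei_deriv (2 * m) (z := r * u) (by rw [Complex.im_ofReal_mul]; positivity) X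
    have h2 : HasDerivAt (fun r : ℝ => (r:ℂ) * u) u r := by
      simpa using (Complex.ofRealCLM.hasDerivAt (x := r)).mul_const u
    have h3 := (h1.scomp r h2).neg
    refine (h3.congr_deriv ?_)
    simp
  have hI : IntegrableOn (fun r : ℝ => u * (f (r * u) * (r * u - X) ^ (2 * m))) (Set.Ioi 0) := by
    simp_rw [hexp]
    exact integrable_finsetSum _ upInt
  have hcont : ContinuousWithinAt (fun r : ℝ => - Ei f (2 * m) (r * u) X) (Set.Ici 0) 0 := by
    rw [← continuousWithinAt_Ioi_iff_Ici]
    have := (F.ei_ray0 hu hX).neg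
    unfold ContinuousWithinAt
    simp only [Complex.ofReal_zero, zero_mul]
    exact this
  have hF := integral_Ioi_of_hasDerivAt_of_tendsto hcont hder hI (F.cf.ei_ray (2 * m) hu X).neg
  simp_rw [hexp] at hF
  rw [integral_finsetSum _ upInt] at hF
  simp_rw [integral_const_mul] at hF
  simp only [mul_sub, Finset.sum_sub_distrib]
  rw [sub_eq_zero]
  simp only [← mul_assoc]
  rw [hF]
  unfold Ei
  simp

lemma int_exp_two (l : ℤ) : ∫ θ in (0:ℝ)..Real.pi, Complex.exp (2 * l * Complex.I * θ) = if l = 0 then (Real.pi : ℂ) else 0 := by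
  split_ifs with h
  · subst h; simp
  · have hc : (2 * l * Complex.I : ℂ) ≠ 0 := by
      simp [h]
    rw [integral_exp_mul_complex hc]
    have : (2 * l * Complex.I * (Real.pi:ℂ)) = l * (2 * Real.pi * Complex.I) := by ring
    rw [this, Complex.exp_int_mul_two_pi_mul_I]
    simp

/-- angular integral -/
def kap (m P Q : ℕ) : ℂ := ∫ θ in (0:ℝ)..Real.pi, Complex.exp (Complex.I * θ) ^ (2 * P) *
  Complex.exp (-(Complex.I * θ)) ^ (2 * Q) * (Complex.sin θ) ^ (2 * m)

lemma kap_ne (m P Q : ℕ) (hP : 1 ≤ P) (hQ : 1 ≤ Q) (hPQ : P + Q = m + 1) : kap m P Q ≠ 0 := by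
  have hexp : ∀ θ : ℝ, Complex.exp (Complex.I * θ) ^ (2 * P) *
      Complex.exp (-(Complex.I * θ)) ^ (2 * Q) * (Complex.sin θ) ^ (2 * m) =
      ∑ j ∈ Finset.range (2 * m + 1), ((Complex.I / 2) ^ (2 * m) * (-1) ^ (2 * m - j) * ((2 * m).choose j : ℂ)) *
        Complex.exp (2 * ((m + P - Q - j : ℤ) : ℂ) * Complex.I * θ) := by
    intro θ
    rw [Complex.sin, show (Complex.exp (-θ * Complex.I) - Complex.exp (θ * Complex.I)) * Complex.I / 2 =
      (Complex.I / 2) * (Complex.exp (-(Complex.I * θ)) + -Complex.exp (Complex.I * θ)) by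
        rw [mul_comm Complex.I (θ:ℂ), neg_mul]; ring]
    rw [mul_pow, add_pow, Finset.mul_sum, Finset.mul_sum]
    refine Finset.sum_congr rfl fun j hj => ?_
    have hj := Finset.mem_range.mp hj
    rw [neg_pow (Complex.exp _)]
    have : Complex.exp (2 * ((m + P - Q - j : ℤ) : ℂ) * Complex.I * θ) = 
       Complex.exp (Complex.I * θ) ^ (2 * P) * Complex.exp (-(Complex.I * θ)) ^ (2 * Q) *
        Complex.exp (-(Complex.I * θ)) ^ j * Complex.exp (Complex.I * θ) ^ (2 * m - j) := by
      simp only [← Complex.exp_nat_mul, ← Complex.exp_add]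
      congr 1
      rw [Nat.cast_sub (by omega)]
      push_cast
      ring
    rw [this]
    ring
  unfold kap
  simp_rw [hexp]
  rw [intervalIntegral.integral_finsetSum]
  · simp_rw [intervalIntegral.integral_const_mul, int_exp_two]
    rw [Finset.sum_eq_single (m + P - Q)]
    · rw [if_pos (by omega)]
      have h1 : ((2 * m).choose (m + P - Q) : ℂ) ≠ 0 := by
        exact_mod_cast (Nat.choose_pos (by omega)).ne'
      have h2 : (Real.pi : ℂ) ≠ 0 := by exact_mod_cast Real.pi_ne_zero
      have h3 : (Complex.I / 2) ^ (2 * m) ≠ 0 := pow_ne_zero _ (div_ne_zero Complex.I_ne_zero two_ne_zero)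
      have h4 : ((-1:ℂ)) ^ (2 * m - (m + P - Q)) ≠ 0 := pow_ne_zero _ (by norm_num)
      exact mul_ne_zero (mul_ne_zero (mul_ne_zero h3 h4) h1) h2
    · intro j _ hj
      rw [if_neg (by omega), mul_zero]
    · intro h
      exact absurd (Finset.mem_range.mpr (by omega)) h
  · intro j _
    apply Continuous.intervalIntegrable
    fun_prop

lemma unfold_zero {G α : Type*} [Group G] [Countable G] [MulAction G α] [MeasurableSpace α] (μ : Measure α)
    [SMulInvariantMeasure G α μ] [MeasurableConstSMul G α] (Φ : α → ℂ) (hΦ : Integrable Φ μ)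
    (χ : α → ℝ) (hχm : Measurable χ) (hχ0 : ∀ z, 0 ≤ χ z) (hχ : ∀ z, HasSum (fun g : G => χ (g • z)) 1)
    (hS : ∀ z, HasSum (fun g : G => Φ (g • z)) 0) : ∫ z, Φ z ∂μ = 0 := by
  have hm1 : ∀ g : G, AEStronglyMeasurable (fun z => (χ (g • z) : ℂ) * Φ z) μ := fun g =>
    (Complex.measurable_ofReal.comp (hχm.comp (measurable_const_smul g))).aestronglyMeasurable.mul hΦ.1
  have hΦg : ∀ g : G, Integrable (fun z => Φ (g • z)) μ := fun g =>
    (measurePreserving_smul g μ).integrable_comp_of_integrable hΦ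
  have hm2 : ∀ g : G, AEStronglyMeasurable (fun z => (χ z : ℂ) * Φ (g⁻¹ • z)) μ := fun g =>
    (Complex.measurable_ofReal.comp hχm).aestronglyMeasurable.mul (hΦg g⁻¹).1
  have hl1 : ∑' g : G, ∫⁻ z, ‖(χ (g • z) : ℂ) * Φ z‖ₑ ∂μ = ∫⁻ z, ‖Φ z‖ₑ ∂μ := by
    rw [← lintegral_tsum (fun g => (hm1 g).enorm)]
    refine lintegral_congr fun z => ?_
    simp_rw [enorm_mul]
    rw [ENNReal.tsum_mul_right]
    have : ∑' g : G, ‖(χ (g • z) : ℂ)‖ₑ = 1 := by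
      have e : ∀ g : G, ‖(χ (g • z) : ℂ)‖ₑ = ENNReal.ofReal (χ (g • z)) := fun g => by
        rw [← ofReal_norm, Complex.norm_of_nonneg (hχ0 _)]
      simp_rw [e]
      rw [← ENNReal.ofReal_tsum_of_nonneg (fun g => hχ0 _) (hχ z).summable, (hχ z).tsum_eq, ENNReal.ofReal_one]
    rw [this, one_mul]
  have heq : ∀ g : G, ∀ z, (χ z : ℂ) * Φ (g⁻¹ • z) = (fun z => (χ (g • z) : ℂ) * Φ z) (g⁻¹ • z) := by
    intro g z
    simp
  have hl2 : ∑' g : G, ∫⁻ z, ‖(χ z : ℂ) * Φ (g⁻¹ • z)‖ₑ ∂μ = ∫⁻ z, ‖Φ z‖ₑ ∂μ := by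
    rw [← hl1]
    refine tsum_congr fun g => ?_
    simp_rw [heq]
    exact (measurePreserving_smul g⁻¹ μ).lintegral_comp_emb (measurableEmbedding_const_smul g⁻¹)
      (fun z => ‖(χ (g • z) : ℂ) * Φ z‖ₑ)
  have hfin : ∫⁻ z, ‖Φ z‖ₑ ∂μ ≠ ⊤ := hΦ.2.ne
  have h1 := integral_tsum hm1 (by rw [hl1]; exact hfin)
  have h2 := integral_tsum hm2 (by rw [hl2]; exact hfin)
  have e1 : ∀ z, ∑' g : G, (χ (g • z) : ℂ) * Φ z = Φ z := by
    intro z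
    rw [tsum_mul_right]
    have := Complex.hasSum_ofReal.mpr (hχ z)
    rw [this.tsum_eq]; simp
  have e2 : ∀ z, ∑' g : G, (χ z : ℂ) * Φ (g⁻¹ • z) = 0 := by
    intro z
    have h3 := (Equiv.inv G).tsum_eq (fun g => Φ (g • z))
    simp only [Equiv.inv_apply] at h3
    rw [tsum_mul_left, h3, (hS z).tsum_eq, mul_zero]
  simp_rw [e1] at h1
  simp_rw [e2] at h2
  rw [h1]
  rw [integral_zero] at h2
  rw [h2]
  refine tsum_congr fun g => ?_
  simp_rw [heq]
  exact (integral_smul_eq_self (μ := μ) (fun z => (χ (g • z) : ℂ) * Φ z) (g := g⁻¹)).symm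

lemma phi_int : ∃ φ : ℝ → ℝ, IntegrableOn φ (Set.Ioi 0) ∧ (∀ r, 0 < r → r ≤ 1 → φ r = r ^ (-(1/2) : ℝ)) ∧
    (∀ r, 1 < r → φ r = r ^ (-(3/2) : ℝ)) := by
  refine ⟨fun r => if r ≤ 1 then r ^ (-(1/2) : ℝ) else r ^ (-(3/2) : ℝ), ?_, ?_, ?_⟩
  · rw [← Set.Ioc_union_Ioi_eq_Ioi (zero_le_one (α := ℝ))]
    refine IntegrableOn.union ?_ ?_
    · have h : IntervalIntegrable (fun r : ℝ => r ^ (-(1/2) : ℝ)) volume 0 1 :=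
        intervalIntegral.intervalIntegrable_rpow' (by norm_num)
      rw [intervalIntegrable_iff_integrableOn_Ioc_of_le zero_le_one] at h
      refine h.congr_fun (fun r hr => ?_) measurableSet_Ioc
      simp only [if_pos hr.2]
    · have h := integrableOn_Ioi_rpow_of_lt (a := -(3/2)) (by norm_num) one_pos
      refine h.congr_fun (fun r hr => ?_) measurableSet_Ioi
      simp only [if_neg (not_le.mpr (Set.mem_Ioi.mp hr))]
  · intro r _ h; simp only [if_pos h]
  · intro r h; simp only [if_neg (not_le.mpr h)]

lemma sin_int : IntegrableOn (fun θ : ℝ => (Real.sin θ) ^ (-(1/2) : ℝ)) (Set.Ioo 0 Real.pi) := by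
  have hpi := Real.pi_pos
  have h1 : IntegrableOn (fun r : ℝ => r ^ (-(1/2) : ℝ)) (Set.Ioo 0 Real.pi) := by
    have h : IntervalIntegrable (fun r : ℝ => r ^ (-(1/2) : ℝ)) volume 0 Real.pi :=
        intervalIntegral.intervalIntegrable_rpow' (by norm_num)
    rw [intervalIntegrable_iff_integrableOn_Ioo_of_le hpi.le] at h
    exact h
  have h2 : IntegrableOn (fun r : ℝ => (Real.pi - r) ^ (-(1/2) : ℝ)) (Set.Ioo 0 Real.pi) := by
    have h : IntervalIntegrable (fun r : ℝ => r ^ (-(1/2) : ℝ)) volume 0 Real.pi :=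
        intervalIntegral.intervalIntegrable_rpow' (by norm_num)
    have h := h.comp_sub_left Real.pi
    simp only [sub_zero, sub_self] at h
    have h := h.symm
    rw [intervalIntegrable_iff_integrableOn_Ioo_of_le hpi.le] at h
    exact h
  have hc : 0 < 2 / Real.pi := by positivity
  refine ((h1.add h2).const_mul ((2 / Real.pi) ^ (-(1/2) : ℝ))).mono' ?_ ?_
  · refine ContinuousOn.aestronglyMeasurable (fun θ hθ => ?_) measurableSet_Ioo
    exact (ContinuousAt.rpow_const (Real.continuous_sin.continuousAt)
      (Or.inl (Real.sin_pos_of_mem_Ioo hθ).ne')).continuousWithinAt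
  · refine (ae_restrict_mem measurableSet_Ioo).mono fun θ hθ => ?_
    have hs := Real.sin_pos_of_mem_Ioo hθ
    have e1 : 0 ≤ θ ^ (-(1/2) : ℝ) := Real.rpow_nonneg hθ.1.le _
    have e2 : 0 ≤ (Real.pi - θ) ^ (-(1/2) : ℝ) := Real.rpow_nonneg (by linarith [hθ.2]) _
    have e3 : 0 ≤ (2 / Real.pi) ^ (-(1/2) : ℝ) := by positivity
    rw [Real.norm_of_nonneg (Real.rpow_nonneg hs.le _)]
    simp only [Pi.add_apply]
    rcases le_total θ (Real.pi / 2) with h | h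
    · have := Real.mul_le_sin hθ.1.le h
      have h3 : (Real.sin θ) ^ (-(1/2) : ℝ) ≤ (2 / Real.pi * θ) ^ (-(1/2) : ℝ) :=
        Real.rpow_le_rpow_of_nonpos (mul_pos hc hθ.1) this (by norm_num)
      rw [Real.mul_rpow hc.le hθ.1.le] at h3
      nlinarith
    · have := Real.mul_le_sin (x := Real.pi - θ) (by linarith [hθ.2]) (by linarith)
      rw [Real.sin_pi_sub] at this
      have h3 : (Real.sin θ) ^ (-(1/2) : ℝ) ≤ (2 / Real.pi * (Real.pi - θ)) ^ (-(1/2) : ℝ) :=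
        Real.rpow_le_rpow_of_nonpos (mul_pos hc (by linarith [hθ.2])) this (by norm_num)
      rw [Real.mul_rpow hc.le (by linarith [hθ.2])] at h3
      nlinarith

/-- the half-strip of polar coordinates -/
def PS : Set (ℝ × ℝ) := Set.Ioi 0 ×ˢ Set.Ioo 0 Real.pi

/-- unit vector -/
def uu (θ : ℝ) : ℂ := Complex.exp (Complex.I * θ)

lemma uu_eq (θ : ℝ) : uu θ = Real.cos θ + Real.sin θ * Complex.I := by
  unfold uu; rw [mul_comm, Complex.exp_mul_I]; push_cast; rfl

lemma uu_im (θ : ℝ) : (uu θ).im = Real.sin θ := by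
  rw [uu_eq, Complex.add_im, Complex.im_ofReal_mul]; simp

lemma uu_norm (θ : ℝ) : ‖uu θ‖ = 1 := by
  unfold uu; rw [mul_comm]; exact Complex.norm_exp_ofReal_mul_I θ

lemma uu_ne (θ : ℝ) : uu θ ≠ 0 := Complex.exp_ne_zero _

lemma uu_conj (θ : ℝ) : (starRingEnd ℂ) (uu θ) = (uu θ)⁻¹ := by
  unfold uu; rw [← Complex.exp_conj, ← Complex.exp_neg]; simp

lemma ru_im (r θ : ℝ) : ((r : ℂ) * uu θ).im = r * Real.sin θ := by
  rw [Complex.im_ofReal_mul, uu_im]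

/-- polar integrand -/
def pint (f : ℂ → ℂ) (m P Q : ℕ) (p : ℝ × ℝ) : ℂ :=
  f (p.1 * uu p.2) * (p.1 : ℂ) ^ (2 * Q - 1) * uu p.2 ^ (2 * P) * (Real.sin p.2 : ℂ) ^ (2 * m)

lemma pint_bound {m : ℕ} {f h : ℂ → ℂ} (F : FP m f h) (P Q : ℕ) (hP : 1 ≤ P) (hQ : 1 ≤ Q)
    (hPQ : P + Q = m + 1) : IntegrableOn (pint f m P Q) PS := by
  have hm : 1 ≤ m := by omega
  obtain ⟨φ, hφ, hφ1, hφ2⟩ := phi_int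
  obtain ⟨C1, hC1, hb1⟩ := F.bound (m - 1/2) (by have : (1:ℝ) ≤ m := by exact_mod_cast hm
                                                 linarith)
  obtain ⟨C2, hC2, hb2⟩ := F.bound2 (m - 1/2) (by have : (1:ℝ) ≤ m := by exact_mod_cast hm
                                                  linarith)
  have hI : Integrable (fun p : ℝ × ℝ => φ p.1 * (Real.sin p.2) ^ (-(1/2) : ℝ)) (volume.restrict PS) := by
    unfold PS
    rw [Measure.volume_eq_prod, ← Measure.prod_restrict]
    exact Integrable.mul_prod hφ sin_int
  have hPS : MeasurableSet PS := measurableSet_Ioi.prod measurableSet_Ioo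
  refine (hI.const_mul (C1 + C2)).mono' ?_ ?_
  · refine ContinuousOn.aestronglyMeasurable ?_ hPS
    unfold pint
    have hu : Continuous uu := by unfold uu; fun_prop
    have h1 : ContinuousOn (fun p : ℝ × ℝ => f (p.1 * uu p.2)) PS := by
      refine F.cf.d.continuousOn.comp (f := fun p : ℝ × ℝ => (p.1 : ℂ) * uu p.2) (by fun_prop) ?_
      intro p hp
      show 0 < ((p.1 : ℂ) * uu p.2).im
      rw [ru_im]
      exact mul_pos hp.1 (Real.sin_pos_of_mem_Ioo hp.2)
    refine ((h1.mul ?_).mul ?_).mul ?_ <;> apply Continuous.continuousOn <;> fun_prop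
  · refine (ae_restrict_mem hPS).mono fun p hp => ?_
    obtain ⟨r, θ⟩ := p
    have hr : 0 < r := hp.1
    have hs : 0 < Real.sin θ := Real.sin_pos_of_mem_Ioo hp.2
    have him : 0 < ((r : ℂ) * uu θ).im := by rw [ru_im]; positivity
    have hQm : (Q:ℝ) ≤ m := by exact_mod_cast (by omega : Q ≤ m)
    have hQ1 : (1:ℝ) ≤ Q := by exact_mod_cast hQ
    unfold pint
    simp only [norm_mul, norm_pow, uu_norm, one_pow, mul_one, Complex.norm_real, Real.norm_of_nonneg hr.le,
      Real.norm_of_nonneg hs.le]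
    set s := Real.sin θ
    have es : s ^ (2 * m) = s ^ ((2 * m : ℕ) : ℝ) := (Real.rpow_natCast _ _).symm
    have er : r ^ (2 * Q - 1) = r ^ ((2 * Q - 1 : ℕ) : ℝ) := (Real.rpow_natCast _ _).symm
    have ec : ((2 * Q - 1 : ℕ) : ℝ) = 2 * Q - 1 := by
      rw [Nat.cast_sub (by omega)]; push_cast; ring
    have hsp : 0 ≤ s ^ (-(1/2) : ℝ) := by positivity
    rcases le_or_gt r 1 with h | h
    · rw [hφ1 r hr h]
      have hb := hb2 _ him
      rw [ru_im] at hb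
      simp only [norm_mul, uu_norm, mul_one, Complex.norm_real, Real.norm_of_nonneg hr.le] at hb
      rw [mul_div_cancel_left₀ _ hr.ne'] at hb
      calc _ ≤ C2 * s ^ (-(m + 1 : ℝ) - (m - 1/2)) * r ^ (-(m + 1 : ℝ) + (m - 1/2)) * r ^ (2 * Q - 1) * s ^ (2 * m) := by
            gcongr
        _ = C2 * ((r ^ (-(m + 1 : ℝ) + (m - 1/2)) * r ^ (2 * Q - 1)) * (s ^ (-(m + 1 : ℝ) - (m - 1/2)) * s ^ (2 * m))) := by ring
        _ = C2 * (r ^ (2 * Q - 5/2 : ℝ) * s ^ (-(1/2) : ℝ)) := by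
            rw [es, er, ← Real.rpow_add hr, ← Real.rpow_add hs, ec]
            push_cast; ring_nf
        _ ≤ C2 * (r ^ (-(1/2) : ℝ) * s ^ (-(1/2) : ℝ)) := by
            have := Real.rpow_le_rpow_of_exponent_ge hr h (by linarith : (-(1/2) : ℝ) ≤ 2 * Q - 5/2)
            gcongr
        _ ≤ _ := by
            have : 0 ≤ r ^ (-(1/2) : ℝ) * s ^ (-(1/2) : ℝ) := by positivity
            nlinarith
    · rw [hφ2 r h]
      have hb := hb1 _ him
      rw [ru_im, Real.mul_rpow hr.le hs.le] at hb
      calc _ ≤ C1 * (r ^ (-(m + 1 : ℝ) - (m - 1/2)) * s ^ (-(m + 1 : ℝ) - (m - 1/2))) * r ^ (2 * Q - 1) * s ^ (2 * m) := by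
            gcongr
        _ = C1 * ((r ^ (-(m + 1 : ℝ) - (m - 1/2)) * r ^ (2 * Q - 1)) * (s ^ (-(m + 1 : ℝ) - (m - 1/2)) * s ^ (2 * m))) := by ring
        _ = C1 * (r ^ (2 * Q - 2 * m - 3/2 : ℝ) * s ^ (-(1/2) : ℝ)) := by
            rw [es, er, ← Real.rpow_add hr, ← Real.rpow_add hs, ec]
            push_cast; ring_nf
        _ ≤ C1 * (r ^ (-(3/2) : ℝ) * s ^ (-(1/2) : ℝ)) := by
            have := Real.rpow_le_rpow_of_exponent_le h.le (by linarith : (2 * Q - 2 * m - 3/2 : ℝ) ≤ -(3/2))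
            gcongr
        _ ≤ _ := by
            have : 0 ≤ r ^ (-(3/2) : ℝ) * s ^ (-(1/2) : ℝ) := by positivity
            nlinarith

lemma pint_int {m : ℕ} {f h : ℂ → ℂ} (F : FP m f h) (P Q : ℕ) (hP : 1 ≤ P) (hQ : 1 ≤ Q)
    (hPQ : P + Q = m + 1) : ∫ p in PS, pint f m P Q p = kap m P Q * Mo f (2 * Q - 1) 0 := by
  have hI := pint_bound F P Q hP hQ hPQ
  unfold PS at hI ⊢
  rw [IntegrableOn, Measure.volume_eq_prod, ← Measure.prod_restrict] at hI
  rw [Measure.volume_eq_prod, ← Measure.prod_restrict, integral_prod_symm _ hI]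
  unfold kap
  rw [intervalIntegral.integral_of_le Real.pi_pos.le, integral_Ioc_eq_integral_Ioo, ← integral_mul_const]
  refine setIntegral_congr_fun measurableSet_Ioo fun θ hθ => ?_
  have hs : 0 < (uu θ).im := by rw [uu_im]; exact Real.sin_pos_of_mem_Ioo hθ
  have hray := F.ray (2 * Q - 1) (by omega) hs
  rw [← hray]
  have hu := uu_ne θ
  have e : ∀ r : ℝ, pint f m P Q (r, θ) = (uu θ ^ (2 * P) * (uu θ ^ (2 * Q - 1))⁻¹ * (Real.sin θ : ℂ) ^ (2 * m)) *
      (f (r * uu θ) * (r * uu θ) ^ (2 * Q - 1)) := by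
    intro r
    unfold pint
    simp only [mul_pow]
    field_simp
  simp_rw [e]
  rw [integral_const_mul]
  have e2 : Complex.exp (-(Complex.I * θ)) = (uu θ)⁻¹ := by rw [Complex.exp_neg]; rfl
  have e3 : Complex.exp (Complex.I * θ) = uu θ := rfl
  rw [e2, e3, Complex.ofReal_sin]
  have e4 : ((uu θ)⁻¹) ^ (2 * Q) * uu θ = (uu θ ^ (2 * Q - 1))⁻¹ := by
    obtain ⟨q, rfl⟩ : ∃ q, Q = q + 1 := ⟨Q - 1, by omega⟩
    rw [show 2 * (q + 1) - 1 = 2 * q + 1 by omega, show 2 * (q + 1) = 2 * q + 1 + 1 by ring, pow_succ _ (2 * q + 1), mul_assoc, inv_mul_cancel₀ hu,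
      mul_one, inv_pow]
  rw [← e4]
  ring

/-- the integrand on the upper half plane -/
def upInt (f : ℂ → ℂ) (m P : ℕ) (z : ℂ) : ℂ :=
  f z * (starRingEnd ℂ) ((z ^ (2 * P))⁻¹) * (z.im : ℂ) ^ (2 * m)

lemma polar_eq (f : ℂ → ℂ) {m P Q : ℕ} (hQ : 1 ≤ Q) (hPQ : P + Q = m + 1)
    (p : ℝ × ℝ) (hp : p ∈ polarCoord.target) :
    (p.1 : ℂ) * Set.indicator {z : ℂ | 0 < z.im} (upInt f m P) (Complex.polarCoord.symm p) =
      Set.indicator PS (pint f m P Q) p := by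
  obtain ⟨r, θ⟩ := p
  have hr : 0 < r := hp.1
  have ht : θ ∈ Set.Ioo (-Real.pi) Real.pi := hp.2
  have hps : Complex.polarCoord.symm (r, θ) = r * uu θ := by
    rw [Complex.polarCoord_symm_apply, uu_eq]
  rw [hps]
  by_cases h : (r, θ) ∈ PS
  · have hs : 0 < Real.sin θ := Real.sin_pos_of_mem_Ioo h.2
    have him : 0 < ((r:ℂ) * uu θ).im := by rw [ru_im]; positivity
    rw [Set.indicator_of_mem h, Set.indicator_of_mem (show (r:ℂ) * uu θ ∈ {z : ℂ | 0 < z.im} from him)]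
    unfold upInt pint
    rw [ru_im, map_inv₀, map_pow, map_mul, uu_conj, Complex.conj_ofReal]
    have hr0 : (r:ℂ) ≠ 0 := by exact_mod_cast hr.ne'
    have hu := uu_ne θ
    have : (r:ℂ) ^ (2 * m) * r = r ^ (2 * Q - 1) * r ^ (2 * P) := by
      rw [← pow_succ, ← pow_add]; congr 1; omega
    simp only [mul_pow, Complex.ofReal_mul, inv_pow]
    field_simp
    linear_combination (f (r * uu θ) * (Real.sin θ : ℂ) ^ (2 * m)) * this
  · rw [Set.indicator_of_notMem h, Set.indicator_of_notMem, mul_zero]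
    intro hc
    apply h
    have hc : 0 < ((r:ℂ) * uu θ).im := hc
    rw [ru_im] at hc
    refine ⟨hr, ?_, ht.2⟩
    by_contra hcon
    have := Real.sin_nonpos_of_nonpos_of_neg_pi_le (not_lt.mp hcon) ht.1.le
    nlinarith

lemma PS_sub : PS ⊆ polarCoord.target := by
  intro p hp
  exact ⟨hp.1, by linarith [hp.2.1, Real.pi_pos], hp.2.2⟩

lemma upInt_integrable {m : ℕ} {f h : ℂ → ℂ} (F : FP m f h) (P Q : ℕ) (hP : 1 ≤ P) (hQ : 1 ≤ Q)
    (hPQ : P + Q = m + 1) : IntegrableOn (upInt f m P) {z : ℂ | 0 < z.im} := by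
  have hH : MeasurableSet {z : ℂ | 0 < z.im} := isOpen_H.measurableSet
  refine ⟨?_, ?_⟩
  · refine ContinuousOn.aestronglyMeasurable ?_ hH
    unfold upInt
    refine (F.cf.d.continuousOn.mul ?_).mul (by apply Continuous.continuousOn; fun_prop)
    refine Complex.continuous_conj.comp_continuousOn (ContinuousOn.inv₀ (by fun_prop) ?_)
    intro z hz
    exact pow_ne_zero _ (H_ne hz)
  · have hI := (pint_bound F P Q hP hQ hPQ).2
    unfold HasFiniteIntegral at hI ⊢
    have hPS : MeasurableSet PS := measurableSet_Ioi.prod measurableSet_Ioo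
    rw [← lintegral_indicator hH, ← Complex.lintegral_comp_polarCoord_symm]
    refine lt_of_le_of_lt (le_of_eq ?_) hI
    rw [← Set.inter_eq_left.mpr PS_sub, ← setLIntegral_indicator hPS]
    · refine setLIntegral_congr_fun (polarCoord.open_target.measurableSet) fun p hp => ?_
      have := polar_eq f hQ hPQ p hp
      have hr : 0 < p.1 := hp.1
      have e : ENNReal.ofReal p.1 = ‖(p.1:ℂ)‖ₑ := by
        rw [← ofReal_norm, Complex.norm_real, Real.norm_of_nonneg hr.le]
      have e2 := congrArg enorm this
      rw [enorm_mul, enorm_indicator_eq_indicator_enorm, enorm_indicator_eq_indicator_enorm] at e2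
      rw [e, smul_eq_mul]
      exact e2

lemma upInt_int {m : ℕ} {f h : ℂ → ℂ} (F : FP m f h) (P Q : ℕ) (hP : 1 ≤ P) (hQ : 1 ≤ Q)
    (hPQ : P + Q = m + 1) : ∫ z in {z : ℂ | 0 < z.im}, upInt f m P z = kap m P Q * Mo f (2 * Q - 1) 0 := by
  have hH : MeasurableSet {z : ℂ | 0 < z.im} := isOpen_H.measurableSet
  have hPS : MeasurableSet PS := measurableSet_Ioi.prod measurableSet_Ioo
  rw [← pint_int F P Q hP hQ hPQ, ← integral_indicator hH, ← Complex.integral_comp_polarCoord_symm,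
    ← Set.inter_eq_right.mpr PS_sub, ← setIntegral_indicator hPS]
  · refine setIntegral_congr_fun (polarCoord.open_target.measurableSet) fun p hp => ?_
    have := polar_eq f hQ hPQ p hp
    simp only [Complex.real_smul]
    exact this

lemma range_coe_H : Set.range ((↑) : UpperHalfPlane → ℂ) = {z : ℂ | 0 < z.im} := by
  ext z
  constructor
  · rintro ⟨τ, rfl⟩; exact τ.2
  · intro h; exact ⟨⟨z, h⟩, rfl⟩

lemma hyp_int (g : ℂ → ℂ) : (Integrable (fun τ : UpperHalfPlane => g τ * ((τ.im : ℝ) : ℂ) ^ 2) ↔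
    IntegrableOn g {z : ℂ | 0 < z.im}) ∧
    ∫ τ : UpperHalfPlane, g τ * ((τ.im : ℝ) : ℂ) ^ 2 = ∫ z in {z : ℂ | 0 < z.im}, g z := by
  have hme := UpperHalfPlane.measurableEmbedding_coe
  have hmap := hme.map_comap (volume : Measure ℂ)
  rw [range_coe_H] at hmap
  have hmeas : Measurable (fun z : UpperHalfPlane => ((1 / NNReal.mk z.im z.im_pos.le : NNReal)) ^ 2) := by
    refine Measurable.pow_const (Measurable.div measurable_const ?_) _
    refine Measurable.subtype_mk ?_
    exact UpperHalfPlane.continuous_im.measurable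
  have e : ∀ τ : UpperHalfPlane, ((1 / NNReal.mk τ.im τ.im_pos.le : NNReal)) ^ 2 • (g τ * ((τ.im : ℝ) : ℂ) ^ 2) = g τ := by
    intro τ
    have h0 : ((τ.im : ℝ) : ℂ) ≠ 0 := by exact_mod_cast τ.im_pos.ne'
    rw [NNReal.smul_def]
    simp only [NNReal.coe_pow, NNReal.coe_div, NNReal.coe_one, NNReal.coe_mk, Complex.real_smul, Complex.ofReal_pow,
      Complex.ofReal_div, Complex.ofReal_one]
    field_simp
  constructor
  · rw [UpperHalfPlane.volume_def, integrable_withDensity_iff_integrable_smul hmeas]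
    simp_rw [e]
    rw [IntegrableOn, ← hmap, hme.integrable_map_iff]
    rfl
  · rw [UpperHalfPlane.volume_def, integral_withDensity_eq_integral_smul hmeas]
    simp_rw [e]
    rw [← hmap, hme.integral_map]

instance instCountG : Countable (CongruenceSubgroup.Gamma0 2) :=
  Function.Injective.countable (f := fun γ : CongruenceSubgroup.Gamma0 2 => (fun i j => γ.1.1 i j : Fin 2 → Fin 2 → ℤ))
    (fun γ δ h => Subtype.ext (Subtype.ext (by ext i j; exact congrFun (congrFun h i) j)))

instance instMeasG : MeasurableConstSMul (CongruenceSubgroup.Gamma0 2) UpperHalfPlane :=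
  ⟨fun g => measurable_const_smul (Matrix.SpecialLinearGroup.mapGL ℝ g.1 : GL (Fin 2) ℝ)⟩

instance instInvG : SMulInvariantMeasure (CongruenceSubgroup.Gamma0 2) UpperHalfPlane volume :=
  ⟨fun g _ hs => SMulInvariantMeasure.measure_preimage_smul (Matrix.SpecialLinearGroup.mapGL ℝ g.1 : GL (Fin 2) ℝ) hs⟩

lemma smulG_coe (γ : CongruenceSubgroup.Gamma0 2) (τ : UpperHalfPlane) : ((γ • τ : UpperHalfPlane) : ℂ) =
    ((γ.1.1 0 0 : ℂ) * τ + (γ.1.1 0 1 : ℂ)) / ((γ.1.1 1 0 : ℂ) * τ + (γ.1.1 1 1 : ℂ)) := smul_coe γ.1 τ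

lemma smulG_im (γ : CongruenceSubgroup.Gamma0 2) (τ : UpperHalfPlane) : (γ • τ : UpperHalfPlane).im =
    τ.im / ‖(γ.1.1 1 0 : ℂ) * τ + (γ.1.1 1 1 : ℂ)‖ ^ 2 := by
  have h := UpperHalfPlane.im_smul_eq_div_normSq (Matrix.SpecialLinearGroup.mapGL ℝ γ.1 : GL (Fin 2) ℝ) τ
  have h2 : UpperHalfPlane.denom (Matrix.SpecialLinearGroup.mapGL ℝ γ.1) τ = _ := denom_coe γ.1 τ
  rw [h2, Complex.normSq_eq_norm_sq] at h
  have h3 : (γ • τ : UpperHalfPlane) = (Matrix.SpecialLinearGroup.mapGL ℝ γ.1 : GL (Fin 2) ℝ) • τ := rfl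
  rw [h3, h]
  simp

/-- weight for the partition of unity -/
def Ew (τ : UpperHalfPlane) (γ : CongruenceSubgroup.Gamma0 2) : ℝ := τ.im ^ 4 * ‖trm 2 2 γ.1 τ‖

lemma Ew_smul (τ : UpperHalfPlane) (γ δ : CongruenceSubgroup.Gamma0 2) : Ew (δ • τ) γ = Ew τ (γ * δ) := by
  unfold Ew
  rw [smulG_im, smulG_coe, trm_mul 2 2 γ.1 δ.1 τ.2]
  have h : ‖(δ.1.1 1 0 : ℂ) * τ + (δ.1.1 1 1 : ℂ)‖ ≠ 0 := norm_ne_zero_iff.mpr (row_ne δ.1 1 τ.2)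
  rw [norm_mul, norm_pow]
  show _ = τ.im ^ 4 * ‖trm 2 2 (γ.1 * δ.1) τ‖
  field_simp

lemma Ew_pos (τ : UpperHalfPlane) (γ) : 0 < Ew τ γ := by
  unfold Ew trm
  have h0 := row_ne γ.1 0 τ.2
  have h1 := row_ne γ.1 1 τ.2
  have := τ.im_pos
  have h2 : 0 < ‖(((γ.1.1 0 0 : ℂ) * τ + (γ.1.1 0 1 : ℂ)) ^ (2 * 2))⁻¹ * (((γ.1.1 1 0 : ℂ) * τ + (γ.1.1 1 1 : ℂ)) ^ (2 * 2))⁻¹‖ :=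
    norm_pos_iff.mpr (mul_ne_zero (inv_ne_zero (pow_ne_zero _ h0)) (inv_ne_zero (pow_ne_zero _ h1)))
  positivity

lemma Ew_summable (τ : UpperHalfPlane) : Summable (Ew τ) :=
  ((trm_summable 2 2 (by norm_num) (by norm_num) (by norm_num) τ.2).comp_injective
    Subtype.val_injective).mul_left _

lemma Ew_meas (γ) : Measurable (fun τ => Ew τ γ) := by
  unfold Ew trm
  have h : Measurable (fun τ : UpperHalfPlane => (τ : ℂ)) := UpperHalfPlane.measurable_coe
  have h2 : Measurable (fun τ : UpperHalfPlane => τ.im) := UpperHalfPlane.continuous_im.measurable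
  refine (h2.pow_const _).mul (Measurable.norm ?_)
  refine Measurable.mul ?_ ?_
  · exact (((h.const_mul _).add_const _).pow_const _).inv
  · exact (((h.const_mul _).add_const _).pow_const _).inv

/-- total weight -/
def Dw (τ : UpperHalfPlane) : ℝ := ∑' γ, Ew τ γ

lemma Dw_meas : Measurable Dw := by
  have : Dw = fun τ => (∑' γ, ENNReal.ofReal (Ew τ γ)).toReal := by
    funext τ
    rw [← ENNReal.ofReal_tsum_of_nonneg (fun γ => (Ew_pos τ γ).le) (Ew_summable τ), ENNReal.toReal_ofReal]
    · rfl
    · exact tsum_nonneg (fun γ => (Ew_pos τ γ).le)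
  rw [this]
  exact (Measurable.tsum fun γ => (Ew_meas γ).ennreal_ofReal).ennreal_toReal

lemma Dw_pos (τ) : 0 < Dw τ := (Ew_summable τ).tsum_pos (fun γ => (Ew_pos τ γ).le) 1 (Ew_pos τ 1)

lemma Dw_smul (τ : UpperHalfPlane) (δ : CongruenceSubgroup.Gamma0 2) : Dw (δ • τ) = Dw τ := by
  unfold Dw
  rw [← (Equiv.mulRight δ).tsum_eq (Ew τ)]
  exact tsum_congr fun γ => Ew_smul τ γ δ

lemma unfold_H (Φ : UpperHalfPlane → ℂ) (hΦ : Integrable Φ)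
    (hS : ∀ τ, HasSum (fun g : CongruenceSubgroup.Gamma0 2 => Φ (g • τ)) 0) : ∫ τ, Φ τ = 0 := by
  refine unfold_zero (G := CongruenceSubgroup.Gamma0 2) volume Φ hΦ (fun τ => Ew τ 1 / Dw τ)
    ((Ew_meas 1).div Dw_meas) (fun τ => div_nonneg (Ew_pos τ 1).le (Dw_pos τ).le) (fun τ => ?_) hS
  have := (Ew_summable τ).hasSum.div_const (Dw τ)
  rw [show (∑' γ, Ew τ γ) = Dw τ from rfl, div_self (Dw_pos τ).ne'] at this
  refine this.congr_fun ?_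
  intro γ
  rw [Ew_smul, Dw_smul, one_mul]

theorem orth {m d : ℕ} (hm : 3 ≤ m) {f h : ℂ → ℂ} (F : FP m f h) (M : MF m f) (P Q : Fin d → ℕ)
    (hP : ∀ i, 1 ≤ P i) (hQ : ∀ i, 1 ≤ Q i) (hPQ : ∀ i, P i + Q i = m + 1) (c : Fin d → ℂ)
    (hc : ∀ z : ℂ, 0 < z.im → ∑ i, c i * Rser (P i) (Q i) z = 0) :
    ∑ i, (starRingEnd ℂ) (c i) * (kap m (P i) (Q i) * Mo f (2 * Q i - 1) 0) = 0 := by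
  set g : ℂ → ℂ := fun z => ∑ i, (starRingEnd ℂ) (c i) * upInt f m (P i) z with hg
  have hgi : ∀ i ∈ Finset.univ, Integrable (fun z => (starRingEnd ℂ) (c i) * upInt f m (P i) z)
      (volume.restrict {z : ℂ | 0 < z.im}) := fun i _ =>
    (upInt_integrable F (P i) (Q i) (hP i) (hQ i) (hPQ i)).const_mul _
  have hgI : IntegrableOn g {z : ℂ | 0 < z.im} := integrable_finsetSum _ hgi
  have hgint : ∫ z in {z : ℂ | 0 < z.im}, g z =
      ∑ i, (starRingEnd ℂ) (c i) * (kap m (P i) (Q i) * Mo f (2 * Q i - 1) 0) := by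
    rw [hg, integral_finsetSum _ hgi]
    refine Finset.sum_congr rfl fun i _ => ?_
    rw [integral_const_mul, upInt_int F (P i) (Q i) (hP i) (hQ i) (hPQ i)]
  rw [← hgint, ← (hyp_int g).2]
  refine unfold_H _ ((hyp_int g).1.mpr hgI) fun τ => ?_
  -- each translate
  have key : ∀ γ : CongruenceSubgroup.Gamma0 2,
      g ((γ • τ : UpperHalfPlane) : ℂ) * (((γ • τ : UpperHalfPlane).im : ℝ) : ℂ) ^ 2 =
      (f τ * ((τ.im : ℝ) : ℂ) ^ (2 * m + 2)) * (starRingEnd ℂ) (∑ i, c i * trm (P i) (Q i) γ.1 τ) := by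
    intro γ
    have hD := row_ne γ.1 1 τ.2
    have hN := row_ne γ.1 0 τ.2
    have hfi := M.inv γ τ τ.2
    have him := smulG_im γ τ
    have hco := smulG_coe γ τ
    have him' : ((γ • τ : UpperHalfPlane) : ℂ).im = _ := him
    simp only [hg, upInt]
    rw [him, him', hco, hfi, map_sum, Finset.sum_mul, Finset.mul_sum]
    refine Finset.sum_congr rfl fun i _ => ?_
    set D := (γ.1.1 1 0 : ℂ) * τ + (γ.1.1 1 1 : ℂ) with hDd
    set N := (γ.1.1 0 0 : ℂ) * τ + (γ.1.1 0 1 : ℂ) with hNd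
    have htr : trm (P i) (Q i) γ.1 τ = (N ^ (2 * P i))⁻¹ * (D ^ (2 * Q i))⁻¹ := rfl
    have hnorm : ((‖D‖ : ℝ) : ℂ) ^ 2 = D * (starRingEnd ℂ) D := (Complex.mul_conj' D).symm
    have hDc : (starRingEnd ℂ) D ≠ 0 := (map_ne_zero _).mpr hD
    have hNc : (starRingEnd ℂ) N ≠ 0 := (map_ne_zero _).mpr hN
    rw [htr]
    push_cast
    rw [hnorm]
    simp only [map_mul, map_inv₀, map_pow, map_div₀]
    have e1 : 2 * m + 2 = 2 * P i + 2 * Q i := by have := hPQ i; omega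
    have e2 : 2 * m = 2 * P i + 2 * Q i - 2 := by omega
    generalize (starRingEnd ℂ) D = D' at *
    generalize (starRingEnd ℂ) N = N' at *
    generalize (τ.im : ℂ) = y
    have e3 : (y / (D * D')) ^ (2 * m) * (y / (D * D')) ^ 2 = y ^ (2 * m + 2) * (D ^ (2 * m + 2))⁻¹ * (D' ^ (2 * P i + 2 * Q i))⁻¹ := by
      rw [← pow_add, div_pow, mul_pow, ← e1]; field_simp
    have hDp : D ^ (2 * m + 2) ≠ 0 := pow_ne_zero _ hD
    rw [mul_assoc, mul_assoc, mul_assoc, mul_assoc, e3, pow_add D', div_pow]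
    field_simp
  have hs : HasSum (fun γ : CongruenceSubgroup.Gamma0 2 => ∑ i, c i * trm (P i) (Q i) γ.1 τ) 0 := by
    rw [← hc τ τ.2]
    refine hasSum_sum fun i _ => HasSum.mul_left _ ?_
    have := trm_summable (P i) (Q i) (hP i) (hQ i) (by have := hPQ i; omega) τ.2
    exact ((this.comp_injective (Subtype.val_injective (p := fun x => x ∈ CongruenceSubgroup.Gamma0 2))).of_norm).hasSum
  have hs2 := (hs.map (starRingEnd ℂ) Complex.continuous_conj).mul_left (f τ * ((τ.im : ℝ) : ℂ) ^ (2 * m + 2))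
  rw [map_zero, mul_zero] at hs2
  exact hs2.congr_fun key

lemma FP.inj2 {m : ℕ} {f h : ℂ → ℂ} (F : FP m f h) (d : ℕ) (hd : m ≤ 2 * d + 2) (hm : 1 ≤ m)
    (hdm : 2 * d < 2 * m) (hr : ∀ i < d, Mo f (2 * m - (2 * i + 1)) 0 = 0) {z : ℂ} (hz : 0 < z.im) : f z = 0 := by
  have hrel : ∀ X : ℂ, X ≠ 0 → Ei f (2 * m) 0 X + (2 * X ^ 2) ^ m * Ei h (2 * m) 0 (Wz X) = 0 := by
    intro X hX
    have hWX : Wz X ≠ 0 := by unfold Wz; simp [hX]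
    have h1 := F.ei_W hX hz
    have h2 := F.symm.ei_W hWX (Wz_pos hz)
    rw [Wz_Wz, Wz_Wz] at h2
    have h3 : (2 * X ^ 2) ^ m * (2 * Wz X ^ 2) ^ m = 1 := by
      rw [← mul_pow, show 2 * X ^ 2 * (2 * Wz X ^ 2) = 1 by unfold Wz; field_simp, one_pow]
    rw [h2] at h1
    linear_combination -h1 - (Ei f (2 * m) z X) * h3
  have hcoef := poly_coef (2 * m) (fun j => Mo f j 0 + (-1) ^ (2 * m - j) * (2 ^ m * (2 ^ j)⁻¹) * Mo h (2 * m - j) 0) (by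
    intro X hX
    refine Eq.trans ?_ (hrel X hX)
    unfold Ei
    simp_rw [mul_add]
    rw [Finset.sum_add_distrib, Finset.mul_sum]
    congr 1
    rw [← Finset.sum_range_reflect]
    refine Finset.sum_congr rfl fun j hj => ?_
    have hj : j ≤ 2 * m := by have := Finset.mem_range.mp hj; omega
    rw [show 2 * m + 1 - 1 - j = 2 * m - j by omega, show 2 * m - (2 * m - j) = j by omega, Nat.choose_symm hj]
    have e1 : (-X) ^ j * (-1) ^ j = X ^ j := by rw [← mul_pow]; simp
    have e2 : (2 ^ m * (2 ^ (2 * m - j))⁻¹) * X ^ j = (2 * X ^ 2) ^ m * (-Wz X) ^ (2 * m - j) := by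
      rw [show -Wz X = (2 * X)⁻¹ by unfold Wz; field_simp, mul_pow, inv_pow, mul_pow 2 X, ← pow_mul]
      have : X ^ (2 * m) = X ^ j * X ^ (2 * m - j) := by rw [← pow_add]; congr 1; omega
      rw [this]
      field_simp
    linear_combination ((2 * m).choose j : ℂ) * Mo h j 0 * (2 ^ m * (2 ^ (2 * m - j))⁻¹) * e1 + ((2 * m).choose j : ℂ) * Mo h j 0 * e2)
  have hh : ∀ i < d, Mo h (2 * i + 1) 0 = 0 := by
    intro i hi
    have h1 := hcoef (2 * m - (2 * i + 1)) (by omega)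
    rw [hr i hi, zero_add, show 2 * m - (2 * m - (2 * i + 1)) = 2 * i + 1 by omega] at h1
    refine (mul_eq_zero.mp h1).resolve_left (mul_ne_zero (pow_ne_zero _ (by norm_num)) ?_)
    exact mul_ne_zero (pow_ne_zero _ two_ne_zero) (inv_ne_zero (pow_ne_zero _ two_ne_zero))
  rw [F.hf z hz, F.symm.inj d hd hm hdm hh (Wz_pos hz), zero_div]

/-- the period map -/
def perMap (m : ℕ) (k : ℤ) (hk : k = 2 * m + 2) {d : ℕ} (n : Fin d → ℕ) :
    CuspForm (CongruenceSubgroup.Gamma0 2) k →ₗ[ℂ] (Fin d → ℂ) where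
  toFun f := fun i => Mo (fun z => f (UpperHalfPlane.ofComplex z)) (n i) 0
  map_add' f g := by
    funext i
    have h1 := (FP.of_cusp k hk f).period_int (n i)
    have h2 := (FP.of_cusp k hk g).period_int (n i)
    simp only [Mo, zero_add, Pi.add_apply]
    rw [← mul_add, ← integral_add h1 h2]
    congr 1
    refine integral_congr_ae (Filter.Eventually.of_forall fun t => ?_)
    exact add_mul (f _) (g _) _
  map_smul' a f := by
    funext i
    simp only [Mo, zero_add, Pi.smul_apply, RingHom.id_apply, smul_eq_mul]
    rw [mul_left_comm, ← integral_const_mul a]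
    congr 1
    refine integral_congr_ae (Filter.Eventually.of_forall fun t => ?_)
    exact mul_assoc a (f _) _

theorem family (m d : ℕ) (hm : 3 ≤ m) (hd : d = (m - 1) / 2) (P Q : Fin d → ℕ) (hP : ∀ i, 1 ≤ P i)
    (hQ : ∀ i, 1 ≤ Q i) (hPQ : ∀ i, P i + Q i = m + 1)
    (hinj : ∀ f h : ℂ → ℂ, FP m f h → (∀ i, Mo f (2 * Q i - 1) 0 = 0) → ∀ z : ℂ, 0 < z.im → f z = 0)
    (k : ℤ) (hk : k = 2 * m + 2) :
    (∀ c : Fin d → ℂ, (∀ z : ℂ, 0 < z.im → ∑ i, c i * Rser (P i) (Q i) z = 0) → ∀ i, c i = 0) ∧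
    ∀ f : CuspForm (CongruenceSubgroup.Gamma0 2) k, ∃ c : Fin d → ℂ, ∀ z : UpperHalfPlane,
      f z = ∑ i, c i * Rser (P i) (Q i) z := by
  set ρ := perMap m k hk (fun i => 2 * Q i - 1) with hρ
  have hρinj : Function.Injective ρ := by
    rw [← LinearMap.ker_eq_bot, LinearMap.ker_eq_bot']
    intro f hf
    ext τ
    have := hinj _ _ (FP.of_cusp k hk f) (fun i => congrFun hf i) τ τ.2
    simp only [UpperHalfPlane.ofComplex_apply] at this
    rw [this]; rfl
  have hfin : FiniteDimensional ℂ (CuspForm (CongruenceSubgroup.Gamma0 2) k) :=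
    FiniteDimensional.of_injective ρ hρinj
  have hle : Module.finrank ℂ (CuspForm (CongruenceSubgroup.Gamma0 2) k) ≤ d := by
    have := LinearMap.finrank_le_finrank_of_injective hρinj
    simpa using this
  have hsum : ∀ (g : Fin d → CuspForm (CongruenceSubgroup.Gamma0 2) k) (c : Fin d → ℂ) (τ : UpperHalfPlane),
      (∑ i, c i • g i) τ = ∑ i, c i * g i τ := by
    intro g c τ
    have : ∀ s : Finset (Fin d), (∑ i ∈ s, c i • g i) τ = ∑ i ∈ s, c i * g i τ := by
      intro s
      induction s using Finset.induction_on with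
      | empty => simp
      | insert a s ha ih => rw [Finset.sum_insert ha, Finset.sum_insert ha, ← ih]; rfl
    exact this _
  have hge : d ≤ Module.finrank ℂ (CuspForm (CongruenceSubgroup.Gamma0 2) k) := by
    obtain ⟨G, hG, hGi⟩ := exists_indep m d (by omega) hd
    choose g hg using fun i => (hG i).exists_cusp k hk
    have : LinearIndependent ℂ g := by
      rw [Fintype.linearIndependent_iff]
      intro c hc
      apply hGi
      intro z hz
      have h1 := congrArg (fun F : CuspForm (CongruenceSubgroup.Gamma0 2) k => F ⟨z, hz⟩) hc
      rw [hsum] at h1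
      simp only [hg] at h1
      exact h1
    simpa using this.fintype_card_le_finrank
  have hdim : Module.finrank ℂ (CuspForm (CongruenceSubgroup.Gamma0 2) k) = d := le_antisymm hle hge
  have hsurj : Function.Surjective ρ :=
    (LinearMap.injective_iff_surjective_of_finrank_eq_finrank (by rw [hdim]; simp)).mp hρinj
  have hind : ∀ c : Fin d → ℂ, (∀ z : ℂ, 0 < z.im → ∑ i, c i * Rser (P i) (Q i) z = 0) → ∀ i, c i = 0 := by
    intro c hc i
    obtain ⟨f, hf⟩ := hsurj (Pi.single i 1)
    have h := orth hm (FP.of_cusp k hk f) (MF.of_cusp k hk f) P Q hP hQ hPQ c hc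
    have e : ∀ j, Mo (fun z => f (UpperHalfPlane.ofComplex z)) (2 * Q j - 1) 0 = (Pi.single i 1 : Fin d → ℂ) j :=
      fun j => congrFun hf j
    simp_rw [e] at h
    rw [Finset.sum_eq_single i (fun j _ hj => by rw [Pi.single_eq_of_ne hj]; simp) (by simp)] at h
    rw [Pi.single_eq_same, mul_one] at h
    have := (mul_eq_zero.mp h).resolve_right (kap_ne m (P i) (Q i) (hP i) (hQ i) (hPQ i))
    exact (map_eq_zero _).mp this
  refine ⟨hind, fun f => ?_⟩
  choose r hr using fun i => (Rser_MF m (P i) (Q i) (hP i) (hQ i) (hPQ i) hm).exists_cusp k hk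
  have hli : LinearIndependent ℂ r := by
    rw [Fintype.linearIndependent_iff]
    intro c hc
    apply hind
    intro z hz
    have h1 := congrArg (fun F : CuspForm (CongruenceSubgroup.Gamma0 2) k => F ⟨z, hz⟩) hc
    rw [hsum] at h1
    simp only [hr] at h1
    exact h1
  have hspan := hli.span_eq_top_of_card_eq_finrank' (by rw [hdim]; simp)
  have hmem : f ∈ Submodule.span ℂ (Set.range r) := by rw [hspan]; trivial
  obtain ⟨c, hc⟩ := (Submodule.mem_span_range_iff_exists_fun ℂ).mp hmem
  refine ⟨c, fun τ => ?_⟩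
  rw [← hc, hsum]
  simp only [hr]

theorem family_RG (m d : ℕ) (hm : 3 ≤ m) (hd : d = (m - 1) / 2) (P Q : Fin d → ℕ) (hP : ∀ i, 1 ≤ P i)
    (hQ : ∀ i, 1 ≤ Q i) (hPQ : ∀ i, P i + Q i = m + 1)
    (hinj : ∀ f h : ℂ → ℂ, FP m f h → (∀ i, Mo f (2 * Q i - 1) 0 = 0) → ∀ z : ℂ, 0 < z.im → f z = 0)
    (k : ℤ) (hk : k = 2 * m + 2) (n : Fin d → ℕ) (hn : ∀ i, n i = 2 * Q i - 1) :
    (∀ c : Fin d → ℂ, (∀ z : ℂ, 0 < z.im → ∑ i, c i * RG 2 (2 * m) (n i) z = 0) → ∀ i, c i = 0) ∧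
    ∀ f : CuspForm (CongruenceSubgroup.Gamma0 2) k, ∃ c : Fin d → ℂ, ∀ z : UpperHalfPlane,
      f z = ∑ i, c i * RG 2 (2 * m) (n i) z := by
  obtain ⟨h1, h2⟩ := family m d hm hd P Q hP hQ hPQ hinj k hk
  have e0 : ∀ i, 2 * P i + 2 * Q i - 2 = 2 * m := fun i => by have := hPQ i; omega
  have e : ∀ i z, RG 2 (2 * m) (n i) z = (cwn (2 * m) (2 * Q i - 1))⁻¹ * Rser (P i) (Q i) z := by
    intro i z
    have := RG_eq (P i) (Q i) (hP i) (hQ i) z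
    rw [e0 i] at this
    rw [hn i, this]
  have hne : ∀ i, cwn (2 * m) (2 * Q i - 1) ≠ 0 := by
    intro i
    have := cwn_ne (P i) (Q i) (hP i) (hQ i)
    rwa [e0 i] at this
  simp_rw [e]
  constructor
  · intro c hc i
    have := h1 (fun i => c i * (cwn (2 * m) (2 * Q i - 1))⁻¹) (fun z hz => by
      rw [← hc z hz]; exact Finset.sum_congr rfl fun i _ => by ring) i
    exact (mul_eq_zero.mp this).resolve_right (inv_ne_zero (hne i))
  · intro f
    obtain ⟨c, hc⟩ := h2 f
    refine ⟨fun i => c i * cwn (2 * m) (2 * Q i - 1), fun z => ?_⟩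
    rw [hc z]
    refine Finset.sum_congr rfl fun i _ => ?_
    have := hne i
    field_simp

theorem R_odd_bases (w : ℕ) (hw : 6 ≤ w) (hwe : Even w) (hdw : 1 ≤ (w - 2) / 4) :
    ((∀ c : Fin ((w - 2) / 4) → ℂ,
        (∀ z : ℂ, 0 < z.im → ∑ i, c i * RG 2 w (2 * (i.1 + 1) - 1) z = 0) → ∀ i, c i = 0) ∧
      ∀ f : CuspForm (CongruenceSubgroup.Gamma0 2) ((w : ℤ) + 2),
        ∃ c : Fin ((w - 2) / 4) → ℂ,
          ∀ z : UpperHalfPlane, f z = ∑ i, c i * RG 2 w (2 * (i.1 + 1) - 1) (z : ℂ)) ∧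
    ((∀ c : Fin ((w - 2) / 4) → ℂ,
        (∀ z : ℂ, 0 < z.im → ∑ i, c i * RG 2 w (w - 2 * (i.1 + 1) + 1) z = 0) → ∀ i, c i = 0) ∧
      ∀ f : CuspForm (CongruenceSubgroup.Gamma0 2) ((w : ℤ) + 2),
        ∃ c : Fin ((w - 2) / 4) → ℂ,
          ∀ z : UpperHalfPlane, f z = ∑ i, c i * RG 2 w (w - 2 * (i.1 + 1) + 1) (z : ℂ)) := by
  obtain ⟨m, rfl⟩ : ∃ m, w = 2 * m := by
    obtain ⟨m, hm⟩ := hwe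
    exact ⟨m, by omega⟩
  have hd : (2 * m - 2) / 4 = (m - 1) / 2 := by omega
  have hk : (((2 * m : ℕ) : ℤ) + 2) = 2 * m + 2 := by push_cast; ring
  generalize (2 * m - 2) / 4 = d at *
  constructor
  · refine family_RG m d (by omega) hd (fun i => m - i.1) (fun i => i.1 + 1) (fun i => ?_) (fun i => ?_) (fun i => ?_)
      ?_ _ hk (fun i => 2 * (i.1 + 1) - 1) (fun i => rfl)
    · have := i.2; omega
    · omega
    · have := i.2; omega
    · intro f h F hr z hz
      refine F.inj d (by omega) (by omega) (by omega) (fun i hi => ?_) hz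
      exact hr ⟨i, hi⟩
  · refine family_RG m d (by omega) hd (fun i => i.1 + 1) (fun i => m - i.1) (fun i => ?_) (fun i => ?_) (fun i => ?_)
      ?_ _ hk (fun i => 2 * m - 2 * (i.1 + 1) + 1) (fun i => ?_)
    · omega
    · have := i.2; omega
    · have := i.2; omega
    · intro f h F hr z hz
      refine F.inj2 d (by omega) (by omega) (by omega) (fun i hi => ?_) hz
      have := hr ⟨i, hi⟩
      simp only [] at this
      rw [← this]; congr 1; omega
    · have := i.2; omega
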